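/- arXiv:1301.3335 — 2 statements merged into one kernel-verified Lean document; each statement's English description precedes it below -/
import Mathlib

section
/- (Γ-convergence of many-particle actions, Theorem 3.1.) The functionals 𝔸_{μ_a^{(N)},μ_b^{(N)}} Γ-converge to 𝔸_{μ_a,μ_b} on 𝒫(C([a,b];ℝⁿ)) with respect to weak convergence, i.e.: (i) whenever π^{(N)} ⇀ π weakly in 𝒫(C([a,b];ℝⁿ)), then liminf_{N→∞} 𝔸_{μ_a^{(N)},μ_b^{(N)}}(π^{(N)}) ≥ 𝔸_{μ_a,μ_b}(π); and (ii) for every π ∈ 𝒫(C([a,b];ℝⁿ)) there exist absolutely continuous curves γ_1^{(N)},…,γ_N^{(N)} ∈ C([a,b];ℝⁿ) such that the measures π^{(N)} = (1/N)∑_{i=1}^N δ_{γ_i^{(N)}} converge weakly to π and lim_{N→∞} 𝔸_{μ_a^{(N)},μ_b^{(N)}}(π^{(N)}) = 𝔸_{μ_a,μ_b}(π). -/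
open MeasureTheory Filter Topology
open scoped ENNReal NNReal

noncomputable section

/-- Euclidean space `ℝⁿ`. -/
abbrev Eu (n : ℕ) := EuclideanSpace ℝ (Fin n)

/-- The space `C([a,b];ℝⁿ)` of continuous curves with the supremum metric. -/
abbrev CPath (a b : ℝ) (n : ℕ) := C(Set.Icc a b, Eu n)

/-- We endow the path space with its Borel σ-algebra. -/
noncomputable instance pathMeasurableSpace (a b : ℝ) (n : ℕ) :
    MeasurableSpace (CPath a b n) := borel _

instance pathBorelSpace (a b : ℝ) (n : ℕ) : BorelSpace (CPath a b n) :=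
  ⟨rfl⟩

/-- Evaluation of a curve at time `t ∈ [a,b]` (junk value `0` outside `[a,b]`). -/
def pev {a b : ℝ} {n : ℕ} (γ : CPath a b n) (t : ℝ) : Eu n :=
  if ht : t ∈ Set.Icc a b then γ ⟨t, ht⟩ else 0

/-- A curve is absolutely continuous if it has a Bochner-integrable derivative `g` with
`γ t = γ s + ∫_s^t g`. -/
def IsACC {a b : ℝ} {n : ℕ} (γ : CPath a b n) : Prop :=
  ∃ g : ℝ → Eu n, IntegrableOn g (Set.Icc a b) ∧
    ∀ s t : Set.Icc a b, γ t = γ s + ∫ u in (s : ℝ)..(t : ℝ), g u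

open Classical in
/-- The action `𝒜(γ) = ∫_a^b L(γ(t), γ̇(t)) dt ∈ (−∞,+∞]`, equal to `+∞` on curves that are
not absolutely continuous (and, by the convention that the integral is `+∞` when the
integrand fails to be integrable -- its negative part being automatically integrable --
also on absolutely continuous curves with non-integrable Lagrangian). -/
def action {n : ℕ} (L : Eu n → Eu n → ℝ) (a b : ℝ) (γ : CPath a b n) : EReal :=
  if h : IsACC γ then
    (if IntegrableOn (fun t => L (pev γ t) (h.choose t)) (Set.Icc a b) then
      (((∫ t in Set.Icc a b, L (pev γ t) (h.choose t)) : ℝ) : EReal)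
    else ⊤)
  else ⊤

/-- Positive part of an extended real, as `ℝ≥0∞`. -/
def epos (x : EReal) : ℝ≥0∞ := if x = ⊤ then ⊤ else ENNReal.ofReal x.toReal

/-- The integral `∫ F dπ ∈ [−∞,+∞]` of an extended-real-valued function, defined as the
difference of the lower integrals of the positive and negative parts. -/
def mint {X : Type*} [MeasurableSpace X] (F : X → EReal) (π : Measure X) : EReal :=
  ((∫⁻ γ, epos (F γ) ∂π : ℝ≥0∞) : EReal) - ((∫⁻ γ, epos (-(F γ)) ∂π : ℝ≥0∞) : EReal)

open Classical in
/-- The constrained functional `𝔸_{μa,μb}(π) = ∫ 𝒜 dπ` if `pr_a#π = μa` and `pr_b#π = μb`,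
and `+∞` otherwise, for a given (extended-real-valued) action functional `F`. -/
def aFun {a b : ℝ} {n : ℕ} (F : CPath a b n → EReal) (μa μb : Measure (Eu n))
    (π : Measure (CPath a b n)) : EReal :=
  if Measure.map (fun γ => pev γ a) π = μa ∧ Measure.map (fun γ => pev γ b) π = μb then
    mint F π
  else ⊤

/-- Weak convergence of a sequence of measures: convergence of the integrals of all bounded
continuous functions. -/
def WeakLim {X : Type*} [TopologicalSpace X] [MeasurableSpace X]
    (πs : ℕ → Measure X) (π : Measure X) : Prop :=
  ∀ φ : BoundedContinuousFunction X ℝ,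
    Tendsto (fun N => ∫ x, φ x ∂(πs N)) atTop (𝓝 (∫ x, φ x ∂π))

/-- The empirical measure `(1/N) ∑_{i=1}^N δ_{x i}`. -/
def emp {X : Type*} [MeasurableSpace X] (N : ℕ) (x : Fin N → X) : Measure X :=
  (N : ℝ≥0∞)⁻¹ • ∑ i : Fin N, Measure.dirac (x i)

/-- The topological support of a measure. -/
def msupp {α : Type*} [TopologicalSpace α] [MeasurableSpace α] (μ : Measure α) : Set α :=
  {x | ∀ U : Set α, IsOpen U → x ∈ U → 0 < μ U}

/-- The set `Γ^min_{K₁,K₂}` of minimizing extremals starting in `K₁` and ending in `K₂`. -/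
def GammaMin {n : ℕ} (L : Eu n → Eu n → ℝ) (a b : ℝ) (K₁ K₂ : Set (Eu n)) :
    Set (CPath a b n) :=
  {γ | IsACC γ ∧ pev γ a ∈ K₁ ∧ pev γ b ∈ K₂ ∧
    ∀ γ' : CPath a b n, IsACC γ' → pev γ' a = pev γ a → pev γ' b = pev γ b →
      action L a b γ ≤ action L a b γ'}

/-- The Lagrangian cost `c(x,y)`: the minimal action among absolutely continuous curves
from `x` to `y`. -/
def cost {n : ℕ} (L : Eu n → Eu n → ℝ) (a b : ℝ) (x y : Eu n) : EReal :=
  ⨅ γ ∈ {γ : CPath a b n | IsACC γ ∧ pev γ a = x ∧ pev γ b = y}, action L a b γ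

/-- The restriction of a continuous curve `ℝ → ℝⁿ` to `[a,b]` as an element of the path
space. -/
def toPath {n : ℕ} (a b : ℝ) (f : ℝ → Eu n) (hf : Continuous f) : CPath a b n :=
  (ContinuousMap.mk f hf).restrict (Set.Icc a b)

/-- `Φ : ℝⁿ × ℝⁿ → C([a,b];ℝⁿ)` is the Euler–Lagrange (Newton) flow map for the Lagrangian
`L(x,v) = (m/2)|v|² − V(x)`: it is continuous and `Φ(x,v)` is a `C²` solution of
`m γ'' = −∇V(γ)` with initial position `x` and initial velocity `v`. -/
def IsNewtonFlow {n : ℕ} (m : ℝ) (V : Eu n → ℝ) (a b : ℝ)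
    (Φ : Eu n × Eu n → CPath a b n) : Prop :=
  Continuous Φ ∧ ∀ x v : Eu n, ∃ f : ℝ → Eu n, ContDiff ℝ 2 f ∧
    (∀ t : Set.Icc a b, Φ (x, v) t = f t) ∧ f a = x ∧ deriv f a = v ∧
    ∀ t ∈ Set.Icc a b, m • deriv (deriv f) t = -gradient V (f t)

/-- The set of `C²` solutions of `m γ'' = −∇V(γ)` starting in `Ka` and ending in `Kb`,
viewed as a subset of the path space. -/
def NewtonSet {n : ℕ} (m : ℝ) (V : Eu n → ℝ) (a b : ℝ) (Ka Kb : Set (Eu n)) :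
    Set (CPath a b n) :=
  {γ | ∃ f : ℝ → Eu n, ContDiff ℝ 2 f ∧ (∀ t : Set.Icc a b, γ t = f t) ∧
    (∀ t ∈ Set.Icc a b, m • deriv (deriv f) t = -gradient V (f t)) ∧
    f a ∈ Ka ∧ f b ∈ Kb}

/-- `γ` is piecewise affine subordinate to the partition `a = τ₀ < … < τ_l = b`. -/
def PiecewiseAffine {n : ℕ} (a b : ℝ) (τ : ℕ → ℝ) (l : ℕ) (γ : CPath a b n) : Prop :=
  ∀ j < l, ∀ t : Set.Icc a b, (t : ℝ) ∈ Set.Icc (τ j) (τ (j + 1)) →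
    γ t = pev γ (τ j) + (((t : ℝ) - τ j) / (τ (j + 1) - τ j)) •
      (pev γ (τ (j + 1)) - pev γ (τ j))

/-- `IsPartition a b τ l h`: `a = τ₀ < τ₁ < … < τ_l = b` is a partition of `[a,b]` of mesh
at most `h`. -/
def IsPartition (a b : ℝ) (τ : ℕ → ℝ) (l : ℕ) (h : ℝ) : Prop :=
  1 ≤ l ∧ τ 0 = a ∧ τ l = b ∧ (∀ j < l, τ j < τ (j + 1)) ∧
    ∀ j < l, τ (j + 1) - τ j ≤ h

/-- The midpoint-rule discrete action, as a (real-valued) sum over the first `l` intervals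
of the partition. -/
def dActionSum {n : ℕ} (m : ℝ) (V : Eu n → ℝ) {a b : ℝ} (τ : ℕ → ℝ) (l : ℕ)
    (γ : CPath a b n) : ℝ :=
  ∑ j ∈ Finset.range l,
    (m / 2 * ‖pev γ (τ (j + 1)) - pev γ (τ j)‖ ^ 2 / (τ (j + 1) - τ j) -
      V ((2 : ℝ)⁻¹ • (pev γ (τ (j + 1)) + pev γ (τ j))) * (τ (j + 1) - τ j))

open Classical in
/-- The discrete action `𝒜^{[h]}`: the midpoint-rule discrete action for piecewise affine
curves subordinate to the partition, `+∞` otherwise. -/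
def dAction {n : ℕ} (m : ℝ) (V : Eu n → ℝ) (a b : ℝ) (τ : ℕ → ℝ) (l : ℕ)
    (γ : CPath a b n) : EReal :=
  if PiecewiseAffine a b τ l γ then ((dActionSum m V τ l γ : ℝ) : EReal) else ⊤

/-- The discrete Euler–Lagrange equations for a piecewise affine curve subordinate to the
partition `a = τ₀ < … < τ_l = b`. -/
def DiscreteEL {n : ℕ} (m : ℝ) (V : Eu n → ℝ) {a b : ℝ} (τ : ℕ → ℝ) (l : ℕ)
    (γ : CPath a b n) : Prop :=
  ∀ j, 1 ≤ j → j < l →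
    m • ((τ j - τ (j - 1))⁻¹ • (pev γ (τ j) - pev γ (τ (j - 1)))) -
      m • ((τ (j + 1) - τ j)⁻¹ • (pev γ (τ (j + 1)) - pev γ (τ j))) =
    ((τ j - τ (j - 1)) / 2) • gradient V ((2 : ℝ)⁻¹ • (pev γ (τ (j - 1)) + pev γ (τ j))) +
      ((τ (j + 1) - τ j) / 2) • gradient V ((2 : ℝ)⁻¹ • (pev γ (τ j) + pev γ (τ (j + 1))))

end

/-- `g` is a velocity of the absolutely continuous curve `γ`. -/
def HasVel {a b : ℝ} {n : ℕ} (γ : CPath a b n) (g : ℝ → Eu n) : Prop :=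
  IntegrableOn g (Set.Icc a b) ∧
    ∀ s t : Set.Icc a b, γ t = γ s + ∫ u in (s : ℝ)..(t : ℝ), g u

lemma HasVel.isACC {a b : ℝ} {n : ℕ} {γ : CPath a b n} {g : ℝ → Eu n} (h : HasVel γ g) :
    IsACC γ := ⟨g, h⟩

lemma pev_coe {a b : ℝ} {n : ℕ} (γ : CPath a b n) (t : Set.Icc a b) : pev γ t = γ t := by
  simp [pev]

lemma pev_of_mem {a b : ℝ} {n : ℕ} (γ : CPath a b n) {t : ℝ} (ht : t ∈ Set.Icc a b) :
    pev γ t = γ ⟨t, ht⟩ := by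
  simp only [pev, dif_pos ht]

lemma continuousOn_pev {a b : ℝ} {n : ℕ} (γ : CPath a b n) :
    ContinuousOn (pev γ) (Set.Icc a b) := by
  rw [continuousOn_iff_continuous_domRestrict]
  convert! γ.continuous using 1
  ext1 t
  exact pev_coe γ t

lemma continuous_pev_left {a b : ℝ} {n : ℕ} (t : ℝ) :
    Continuous (fun γ : CPath a b n => pev γ t) := by
  by_cases ht : t ∈ Set.Icc a b
  · simp only [pev, dif_pos ht]
    exact continuous_eval_const _
  · simp only [pev, dif_neg ht]
    exact continuous_const

lemma HasVel.pev_sub {a b : ℝ} {n : ℕ} {γ : CPath a b n} {g : ℝ → Eu n} (h : HasVel γ g)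
    {s t : ℝ} (hs : s ∈ Set.Icc a b) (ht : t ∈ Set.Icc a b) :
    pev γ t = pev γ s + ∫ u in s..t, g u := by
  rw [pev_of_mem γ hs, pev_of_mem γ ht]
  exact h.2 ⟨s, hs⟩ ⟨t, ht⟩

lemma HasVel.congr {a b : ℝ} {n : ℕ} {γ : CPath a b n} {g g' : ℝ → Eu n} (h : HasVel γ g)
    (hg : g =ᵐ[volume.restrict (Set.Icc a b)] g') : HasVel γ g' := by
  refine ⟨h.1.congr hg, fun s t => ?_⟩
  rw [h.2 s t]
  congr 1
  apply intervalIntegral.integral_congr_ae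
  have := (ae_restrict_iff' measurableSet_Icc).1 hg
  filter_upwards [this] with x hx hx'
  exact hx (Set.uIcc_subset_Icc s.2 t.2 (Set.uIoc_subset_uIcc hx'))

lemma HasVel.ae_eq {a b : ℝ} {n : ℕ} (hab : a < b) {γ : CPath a b n} {g g' : ℝ → Eu n}
    (h : HasVel γ g) (h' : HasVel γ g') : g =ᵐ[volume.restrict (Set.Icc a b)] g' := by
  have key : ∀ g : ℝ → Eu n, HasVel γ g →
      ∀ᵐ x, x ∈ Set.Ioo a b → HasDerivAt (pev γ) (g x) x := by
    intro g h
    have hi : IntervalIntegrable g volume a b :=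
      (intervalIntegrable_iff_integrableOn_Icc_of_le hab.le).2 h.1
    filter_upwards [hi.ae_hasDerivAt_integral] with x hx hxm
    have hd := hx (by rw [Set.uIcc_of_le hab.le]; exact Set.Ioo_subset_Icc_self hxm) a
      Set.left_mem_uIcc
    refine (hd.const_add (pev γ a)).congr_of_eventuallyEq ?_
    filter_upwards [Ioo_mem_nhds hxm.1 hxm.2] with t ht
    exact h.pev_sub (Set.left_mem_Icc.2 hab.le) (Set.Ioo_subset_Icc_self ht)
  rw [← Measure.restrict_congr_set (Ioo_ae_eq_Icc (a := a) (b := b) (μ := volume))]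
  refine (ae_restrict_iff' measurableSet_Ioo).2 ?_
  filter_upwards [key g h, key g' h'] with x hx hx' hm
  exact (hx hm).unique (hx' hm)

open Classical in
/-- The action shifted by a constant added to the Lagrangian, as an extended nonnegative real. -/
noncomputable def energy {n : ℕ} (L : Eu n → Eu n → ℝ) (c : ℝ) {a b : ℝ} (γ : CPath a b n) :
    ℝ≥0∞ :=
  if h : IsACC γ then
    ∫⁻ t in Set.Icc a b, ENNReal.ofReal (L (pev γ t) (h.choose t) + c)
  else ⊤

lemma HasVel.energy_eq {a b : ℝ} {n : ℕ} (hab : a < b) {γ : CPath a b n} {g : ℝ → Eu n}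
    (h : HasVel γ g) (L : Eu n → Eu n → ℝ) (c : ℝ) :
    energy L c γ = ∫⁻ t in Set.Icc a b, ENNReal.ofReal (L (pev γ t) (g t) + c) := by
  rw [energy, dif_pos h.isACC]
  apply lintegral_congr_ae
  have h2 : HasVel γ h.isACC.choose := h.isACC.choose_spec
  filter_upwards [h2.ae_eq hab h] with t ht
  rw [ht]

lemma isACC_of_energy_ne_top {a b : ℝ} {n : ℕ} {γ : CPath a b n} {L : Eu n → Eu n → ℝ} {c : ℝ}
    (h : energy L c γ ≠ ⊤) : ∃ g : ℝ → Eu n, StronglyMeasurable g ∧ HasVel γ g := by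
  by_cases hγ : IsACC γ
  · obtain ⟨g, hg⟩ := hγ
    have hg' : HasVel γ g := hg
    exact ⟨hg.1.1.mk g, hg.1.1.stronglyMeasurable_mk, hg'.congr hg.1.1.ae_eq_mk⟩
  · rw [energy, dif_neg hγ] at h
    exact absurd rfl h

lemma action_eq_energy_sub {a b : ℝ} {n : ℕ} (hab : a < b) {L : Eu n → Eu n → ℝ}
    (hLc : Continuous (Function.uncurry L)) {c : ℝ} (hc : ∀ x v, 0 ≤ L x v + c)
    (γ : CPath a b n) :
    action L a b γ = (energy L c γ : EReal) - ((c * (b - a) : ℝ) : EReal) := by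
  unfold action energy
  by_cases h : IsACC γ
  · simp only [dif_pos h]
    have hm : AEStronglyMeasurable (fun t => L (pev γ t) (h.choose t))
        (volume.restrict (Set.Icc a b)) := by
      have h1 : AEStronglyMeasurable (pev γ) (volume.restrict (Set.Icc a b)) :=
        (continuousOn_pev γ).aestronglyMeasurable measurableSet_Icc
      have h2 : AEStronglyMeasurable h.choose (volume.restrict (Set.Icc a b)) :=
        h.choose_spec.1.1
      exact hLc.comp_aestronglyMeasurable (h1.prodMk h2)
    have hcI : IntegrableOn (fun _ : ℝ => c) (Set.Icc a b) := by
      simp [integrableOn_const_iff]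
    split_ifs with hi
    · have hi2 : IntegrableOn (fun t => L (pev γ t) (h.choose t) + c) (Set.Icc a b) := hi.add hcI
      have e1 := ofReal_integral_eq_lintegral_ofReal hi2 (Eventually.of_forall fun t => hc _ _)
      rw [← e1, integral_add hi hcI]
      have hnn : 0 ≤ (∫ t in Set.Icc a b, L (pev γ t) (h.choose t)) + ∫ t in Set.Icc a b, c := by
        rw [← integral_add hi hcI]
        exact integral_nonneg fun t => hc _ _
      rw [EReal.coe_ennreal_ofReal, max_eq_left hnn, ← EReal.coe_sub]
      congr 1
      simp only [integral_const, MeasurableSet.univ, measureReal_restrict_apply, Set.univ_inter,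
        Real.volume_real_Icc_of_le hab.le, smul_eq_mul]
      ring
    · have : ∫⁻ t in Set.Icc a b, ENNReal.ofReal (L (pev γ t) (h.choose t) + c) = ⊤ := by
        by_contra hne
        apply hi
        have hi2 : IntegrableOn (fun t => L (pev γ t) (h.choose t) + c) (Set.Icc a b) := by
          refine ⟨hm.add hcI.1, ?_⟩
          rw [hasFiniteIntegral_iff_ofReal (Eventually.of_forall fun t => hc _ _)]
          exact lt_top_iff_ne_top.2 hne
        refine (hi2.sub hcI).congr_fun (fun t _ => ?_) measurableSet_Icc
        simp
      rw [this, EReal.coe_ennreal_top, EReal.top_sub_coe]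
  · rw [dif_neg h, dif_neg h, EReal.coe_ennreal_top, EReal.top_sub_coe]

lemma mint_eq_lintegral_sub {X : Type*} [MeasurableSpace X] (π : Measure X)
    [IsProbabilityMeasure π] {F : X → EReal} {E : X → ℝ≥0∞} (hE : Measurable E) {c : ℝ}
    (hc : 0 ≤ c) (hF : ∀ x, F x = (E x : EReal) - (c : EReal)) :
    mint F π = ((∫⁻ x, E x ∂π : ℝ≥0∞) : EReal) - (c : EReal) := by
  have pt : ∀ x, epos (F x) + ENNReal.ofReal c = E x + epos (-(F x)) := by
    intro x
    rw [hF x]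
    rcases eq_or_ne (E x) ⊤ with h | h
    · simp [h, epos]
    · lift E x to ℝ≥0 using h with e
      have : ((e : ℝ≥0∞) : EReal) - (c : EReal) = ((e - c : ℝ) : EReal) := by
        rw [EReal.coe_sub, EReal.coe_nnreal_eq_coe_real]
      rw [this, ← EReal.coe_neg]
      simp only [epos, EReal.coe_ne_top, if_false, EReal.toReal_coe]
      rw [← ENNReal.ofReal_coe_nnreal]
      rcases le_total c (e : ℝ) with h | h
      · rw [ENNReal.ofReal_of_nonpos (show -((e : ℝ) - c) ≤ 0 by linarith),
          ← ENNReal.ofReal_add (by linarith) hc]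
        simp
      · rw [ENNReal.ofReal_of_nonpos (show ((e : ℝ) - c) ≤ 0 by linarith),
          ← ENNReal.ofReal_add (by positivity) (by linarith)]
        simp
  have hneg : ∀ x, epos (-(F x)) ≤ ENNReal.ofReal c := by
    intro x
    rw [hF x]
    rcases eq_or_ne (E x) ⊤ with h | h
    · simp [h, epos]
    · lift E x to ℝ≥0 using h with e
      have : ((e : ℝ≥0∞) : EReal) - (c : EReal) = ((e - c : ℝ) : EReal) := by
        rw [EReal.coe_sub, EReal.coe_nnreal_eq_coe_real]
      rw [this, ← EReal.coe_neg]
      simp only [epos, EReal.coe_ne_top, if_false, EReal.toReal_coe]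
      exact ENNReal.ofReal_le_ofReal (by linarith [e.2])
  have hsum : ∫⁻ x, epos (F x) ∂π + ENNReal.ofReal c = ∫⁻ x, E x ∂π + ∫⁻ x, epos (-(F x)) ∂π := by
    rw [← lintegral_add_left hE, ← lintegral_congr pt, lintegral_add_right _ measurable_const]
    simp
  have hQ : ∫⁻ x, epos (-(F x)) ∂π ≠ ⊤ := by
    refine ne_top_of_le_ne_top (ENNReal.ofReal_ne_top (r := c)) ?_
    refine (lintegral_mono hneg).trans ?_
    simp
  unfold mint
  set Q := ∫⁻ x, epos (-(F x)) ∂π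
  set P := ∫⁻ x, epos (F x) ∂π
  set I := ∫⁻ x, E x ∂π
  rcases eq_or_ne I ⊤ with hI | hI
  · have hP : P = ⊤ := by
      rw [hI] at hsum
      simpa using hsum
    rw [hP, hI]
    clear_value Q
    lift Q to ℝ≥0 using hQ
    rw [EReal.coe_nnreal_eq_coe_real, EReal.coe_ennreal_top, EReal.top_sub_coe, EReal.top_sub_coe]
  · have hP : P ≠ ⊤ := by
      intro hP
      rw [hP, top_add] at hsum
      exact ENNReal.add_ne_top.2 ⟨hI, hQ⟩ hsum.symm
    clear_value P Q I
    lift Q to ℝ≥0 using hQ with q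
    lift P to ℝ≥0 using hP with p
    lift I to ℝ≥0 using hI with i
    have : (p : ℝ) + c = i + q := by
      rw [ENNReal.ofReal, ← ENNReal.coe_add, ← ENNReal.coe_add, ENNReal.coe_inj] at hsum
      have := congrArg ((↑) : ℝ≥0 → ℝ) hsum
      simpa [hc] using this
    have h2 : (p : ℝ) - q = i - c := by linarith
    simp only [EReal.coe_nnreal_eq_coe_real]
    rw [← EReal.coe_sub, ← EReal.coe_sub, h2]

/-- A continuous Lagrangian which is convex and locally uniformly quadratically coercive in the
velocity, with velocity differential `D`, and bounded below by `-c`. -/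
structure IsTonelli {n : ℕ} (L : Eu n → Eu n → ℝ) (D : Eu n → Eu n → Eu n →L[ℝ] ℝ) (c : ℝ) :
    Prop where
  cont : Continuous (Function.uncurry L)
  contD : Continuous (Function.uncurry D)
  tangent : ∀ x v w, L x v + D x v (w - v) ≤ L x w
  quad : ∀ R : ℝ, ∃ κ C : ℝ, 0 < κ ∧ ∀ x v, ‖x‖ ≤ R → κ * ‖v‖ ^ 2 - C ≤ L x v
  nonneg : ∀ x v, 0 ≤ L x v + c

lemma taylor_lower_bound {E : Type*} [NormedAddCommGroup E] [NormedSpace ℝ E] {f : E → ℝ}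
    (hf : ContDiff ℝ 2 f) {c₀ : ℝ}
    (h2 : ∀ v w : E, c₀ * ‖w‖ ^ 2 ≤ fderiv ℝ (fderiv ℝ f) v w w) (v w : E) :
    f v + fderiv ℝ f v (w - v) + c₀ / 2 * ‖w - v‖ ^ 2 ≤ f w := by
  set u := w - v with hu
  have hline : ∀ s : ℝ, HasDerivAt (fun s : ℝ => v + s • u) u s := by
    intro s
    simpa using ((hasDerivAt_id s).smul_const u).const_add v
  have hd1 : ∀ s : ℝ, HasDerivAt (fun s : ℝ => f (v + s • u) - c₀ / 2 * ‖u‖ ^ 2 * s ^ 2)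
      (fderiv ℝ f (v + s • u) u - c₀ * ‖u‖ ^ 2 * s) s := by
    intro s
    have h1 : HasFDerivAt f (fderiv ℝ f (v + s • u)) (v + s • u) :=
      (hf.differentiable (by norm_num)).differentiableAt.hasFDerivAt
    have h3 := h1.comp_hasDerivAt s (hline s)
    have h4 := ((hasDerivAt_id s).pow 2).const_mul (c₀ / 2 * ‖u‖ ^ 2)
    convert! h3.sub h4 using 1
    simp only [Nat.cast_ofNat, Nat.add_one_sub_one, pow_one, mul_one, id]
    ring
  have hd2 : ∀ s : ℝ, HasDerivAt (fun s : ℝ => fderiv ℝ f (v + s • u) u - c₀ * ‖u‖ ^ 2 * s)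
      (fderiv ℝ (fderiv ℝ f) (v + s • u) u u - c₀ * ‖u‖ ^ 2) s := by
    intro s
    have hc1 : ContDiff ℝ 1 (fderiv ℝ f) := hf.fderiv_right (by norm_num)
    have h1 : HasFDerivAt (fderiv ℝ f) (fderiv ℝ (fderiv ℝ f) (v + s • u)) (v + s • u) :=
      (hc1.differentiable (by norm_num)).differentiableAt.hasFDerivAt
    have h3 : HasDerivAt (fun s : ℝ => fderiv ℝ f (v + s • u) u)
        (fderiv ℝ (fderiv ℝ f) (v + s • u) u u) s :=
      (ContinuousLinearMap.apply ℝ ℝ u).hasFDerivAt.comp_hasDerivAt s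
        (h1.comp_hasDerivAt s (hline s))
    have h4 := (hasDerivAt_id s).const_mul (c₀ * ‖u‖ ^ 2)
    simpa using h3.fun_sub h4
  have hmono : Monotone (fun s : ℝ => fderiv ℝ f (v + s • u) u - c₀ * ‖u‖ ^ 2 * s) := by
    apply monotone_of_deriv_nonneg (fun s => (hd2 s).differentiableAt)
    intro s
    rw [(hd2 s).deriv]
    linarith [h2 (v + s • u) u]
  obtain ⟨ξ, hξ, he⟩ := exists_hasDerivAt_eq_slope
    (fun s : ℝ => f (v + s • u) - c₀ / 2 * ‖u‖ ^ 2 * s ^ 2) _ (zero_lt_one)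
    (fun s _ => (hd1 s).continuousAt.continuousWithinAt) (fun s _ => hd1 s)
  have := hmono hξ.1.le
  simp only [zero_smul, add_zero, one_smul, mul_zero, sub_zero, mul_one, div_one, one_pow]
    at this he
  rw [he] at this
  have hw : v + u = w := by rw [hu]; abel
  rw [hw] at this
  simp at this
  linarith

lemma isTonelli_of_contDiff {n : ℕ} {L : Eu n → Eu n → ℝ}
    (hL1 : ContDiff ℝ (⊤ : ℕ∞) (Function.uncurry L))
    (hL2 : ∀ K : Set (Eu n), IsCompact K → ∃ c₀ : ℝ, 0 < c₀ ∧
      ∀ x ∈ K, ∀ v w : Eu n, c₀ * ‖w‖ ^ 2 ≤ fderiv ℝ (fderiv ℝ (L x)) v w w)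
    {c₁ c₂ : ℝ} (hc₁ : 0 < c₁) (hL3 : ∀ x v : Eu n, c₁ * ‖v‖ - c₂ ≤ L x v) :
    IsTonelli L (fun x v => fderiv ℝ (L x) v) c₂ := by
  have hLx : ∀ x, ContDiff ℝ 2 (L x) := by
    intro x
    have : ContDiff ℝ 2 (Function.uncurry L) := contDiff_infty.1 hL1 2
    exact this.comp (contDiff_const.prodMk contDiff_id)
  have hD : Continuous (Function.uncurry fun x v => fderiv ℝ (L x) v) := by
    have h1 : ContDiff ℝ 0 (fun p : Eu n × Eu n => fderiv ℝ (L p.1) p.2) := by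
      apply ContDiff.fderiv (n := 0) (m := 1) (f := fun p : Eu n × Eu n => L p.1) (g := Prod.snd)
      · have : ContDiff ℝ 1 (Function.uncurry L) := contDiff_infty.1 hL1 1
        exact this.comp ((contDiff_fst.comp contDiff_fst).prodMk contDiff_snd)
      · exact contDiff_snd
      · norm_num
    exact h1.continuous
  refine ⟨hL1.continuous, hD, ?_, ?_, ?_⟩
  · intro x v w
    obtain ⟨c₀, h0, hc⟩ := hL2 {x} isCompact_singleton
    have := taylor_lower_bound (hLx x) (hc x rfl) v w
    have : 0 ≤ c₀ / 2 * ‖w - v‖ ^ 2 := by positivity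
    linarith
  · intro R
    obtain ⟨c₀, h0, hc⟩ := hL2 (Metric.closedBall 0 R) (isCompact_closedBall _ _)
    obtain ⟨B, hB⟩ := (isCompact_closedBall (0 : Eu n) R).exists_bound_of_continuousOn
      (f := fun x => fderiv ℝ (L x) 0)
      (hD.comp (continuous_id.prodMk continuous_const)).continuousOn
    refine ⟨c₀ / 4, c₂ + B ^ 2 / c₀, by positivity, fun x v hx => ?_⟩
    have hxm : x ∈ Metric.closedBall (0 : Eu n) R := by simpa using hx
    have h1 := taylor_lower_bound (hLx x) (hc x hxm) 0 v
    have h2 : -(B * ‖v‖) ≤ fderiv ℝ (L x) 0 v := by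
      have := (fderiv ℝ (L x) 0).le_opNorm v
      have h3 := mul_le_mul_of_nonneg_right (hB x hxm) (norm_nonneg v)
      have := neg_abs_le (fderiv ℝ (L x) 0 v)
      rw [Real.norm_eq_abs] at *
      linarith
    have h4 := hL3 x 0
    simp only [sub_zero, norm_zero, mul_zero, zero_sub] at h1 h4
    have h5 : B * ‖v‖ ≤ c₀ / 4 * ‖v‖ ^ 2 + B ^ 2 / c₀ := by
      have : c₀ / 4 * ‖v‖ ^ 2 + B ^ 2 / c₀ - B * ‖v‖ = (c₀ * ‖v‖ - 2 * B) ^ 2 / (4 * c₀) := by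
        field_simp
        ring
      have : 0 ≤ (c₀ * ‖v‖ - 2 * B) ^ 2 / (4 * c₀) := by positivity
      linarith
    linarith
  · intro x v
    have := hL3 x v
    have : 0 ≤ c₁ * ‖v‖ := by positivity
    linarith

lemma IsTonelli.slow_le {n : ℕ} {L : Eu n → Eu n → ℝ} {D : Eu n → Eu n → Eu n →L[ℝ] ℝ} {c : ℝ}
    (H : IsTonelli L D c) (x v : Eu n) {l : ℝ} (hl : 1 ≤ l) :
    l * (L x (l⁻¹ • v) + c) ≤ L x v + c + (l - 1) * (L x 0 + c) := by
  have h0 : 0 < l := by linarith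
  have h1 := H.tangent x (l⁻¹ • v) v
  have h2 := H.tangent x (l⁻¹ • v) 0
  have e1 : v - l⁻¹ • v = (l - 1) • (l⁻¹ • v) := by
    rw [sub_smul, one_smul, smul_smul, mul_inv_cancel₀ h0.ne', one_smul]
  rw [e1, map_smul, smul_eq_mul] at h1
  rw [zero_sub, map_neg] at h2
  have := mul_le_mul_of_nonneg_left h2 (sub_nonneg.2 hl)
  linarith

/-- A continuous function of position and velocity is uniformly continuous on bounded sets. -/
lemma exists_modulus {n : ℕ} {F : Type*} [PseudoMetricSpace F] {f : Eu n → Eu n → F}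
    (hf : Continuous (Function.uncurry f)) (R M : ℝ) {ε : ℝ} (hε : 0 < ε) :
    ∃ δ > 0, ∀ x x' v v' : Eu n, ‖x‖ ≤ R → ‖x'‖ ≤ R → ‖v‖ ≤ M → ‖v'‖ ≤ M →
      ‖x - x'‖ ≤ δ → ‖v - v'‖ ≤ δ → dist (f x v) (f x' v') < ε := by
  have hK : IsCompact (Metric.closedBall (0 : Eu n) R ×ˢ Metric.closedBall (0 : Eu n) M) :=
    (isCompact_closedBall _ _).prod (isCompact_closedBall _ _)
  have hu := hK.uniformContinuousOn_of_continuous hf.continuousOn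
  obtain ⟨δ, hδ, h⟩ := Metric.uniformContinuousOn_iff.1 hu ε hε
  refine ⟨δ / 2, by positivity, fun x x' v v' hx hx' hv hv' h1 h2 => ?_⟩
  refine h (x, v) (by simp [hx, hv]) (x', v') (by simp [hx', hv']) ?_
  rw [Prod.dist_eq, dist_eq_norm, dist_eq_norm]
  exact max_lt (by simp only; linarith) (by simp only; linarith)

/-- A continuous function of position and velocity is bounded on bounded sets. -/
lemma exists_norm_bound {n : ℕ} {F : Type*} [SeminormedAddCommGroup F] {f : Eu n → Eu n → F}
    (hf : Continuous (Function.uncurry f)) (R M : ℝ) :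
    ∃ B, 0 ≤ B ∧ ∀ x v : Eu n, ‖x‖ ≤ R → ‖v‖ ≤ M → ‖f x v‖ ≤ B := by
  have hK : IsCompact (Metric.closedBall (0 : Eu n) R ×ˢ Metric.closedBall (0 : Eu n) M) :=
    (isCompact_closedBall _ _).prod (isCompact_closedBall _ _)
  obtain ⟨B, hB⟩ := hK.exists_bound_of_continuousOn hf.continuousOn
  refine ⟨max B 0, le_max_right _ _, fun x v hx hv => ?_⟩
  exact (hB (x, v) (by simp [hx, hv])).trans (le_max_left _ _)

lemma hasVel_of_le {a b : ℝ} {n : ℕ} {γ : CPath a b n} {g : ℝ → Eu n}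
    (hg : IntegrableOn g (Set.Icc a b))
    (h : ∀ s t : Set.Icc a b, (s : ℝ) ≤ t → γ t - γ s = ∫ u in Set.Ioc (s : ℝ) t, g u) :
    HasVel γ g := by
  refine ⟨hg, fun s t => ?_⟩
  rcases le_total (s : ℝ) t with hst | hst
  · rw [intervalIntegral.integral_of_le hst, ← h s t hst]
    abel
  · rw [intervalIntegral.integral_of_ge hst, ← h t s hst]
    abel

lemma HasVel.sub_eq {a b : ℝ} {n : ℕ} {γ : CPath a b n} {g : ℝ → Eu n} (h : HasVel γ g)
    {s t : Set.Icc a b} (hst : (s : ℝ) ≤ t) : γ t - γ s = ∫ u in Set.Ioc (s : ℝ) t, g u := by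
  rw [h.2 s t, intervalIntegral.integral_of_le hst]
  abel

lemma exists_weak_limit_velocity {a b : ℝ} {n : ℕ} {U : Ultrafilter ℕ} {γs : ℕ → CPath a b n}
    {γ : CPath a b n} (hγ : Tendsto γs U (𝓝 γ)) {g : ℕ → ℝ → Eu n}
    (hg : ∀ k, HasVel (γs k) (g k)) {B : ℝ≥0}
    (hm : ∀ k, MemLp (g k) 2 (volume.restrict (Set.Icc a b)))
    (hB : ∀ k, eLpNorm (g k) 2 (volume.restrict (Set.Icc a b)) ≤ B) :
    ∃ g' : ℝ → Eu n, StronglyMeasurable g' ∧ HasVel γ g' ∧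
      ∀ f : ℝ → Eu n, MemLp f 2 (volume.restrict (Set.Icc a b)) →
        Tendsto (fun k => ∫ t in Set.Icc a b, inner ℝ (f t) (g k t)) U
          (𝓝 (∫ t in Set.Icc a b, inner ℝ (f t) (g' t))) := by
  set μ := volume.restrict (Set.Icc a b) with hμ
  set G : ℕ → Lp (Eu n) 2 μ := fun k => (hm k).toLp (g k) with hG
  have hGB : ∀ k, ‖G k‖ ≤ B := by
    intro k
    rw [hG, Lp.norm_toLp]
    exact ENNReal.toReal_le_coe_of_le_coe (hB k)
  set Λ : ℕ → WeakDual ℝ (Lp (Eu n) 2 μ) := fun k =>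
    StrongDual.toWeakDual (InnerProductSpace.toDual ℝ (Lp (Eu n) 2 μ) (G k)) with hΛ
  have hc := WeakDual.isCompact_closedBall (𝕜 := ℝ) (E := Lp (Eu n) 2 μ) 0 B
  obtain ⟨l, -, hl⟩ := hc.ultrafilter_le_nhds (U.map Λ) (by
    rw [le_principal_iff]
    refine Ultrafilter.mem_coe.2 (Ultrafilter.mem_map.2 (Filter.univ_mem' fun k => ?_))
    simp only [hΛ, Set.mem_preimage, Metric.mem_closedBall, dist_zero_right]
    exact (LinearIsometryEquiv.norm_map (InnerProductSpace.toDual ℝ (Lp (Eu n) 2 μ)) (G k)).le.trans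
      (hGB k))
  have hl' : Tendsto Λ U (𝓝 l) := hl
  set g' : Lp (Eu n) 2 μ := (InnerProductSpace.toDual ℝ (Lp (Eu n) 2 μ)).symm
    (WeakDual.toStrongDual l) with hg'
  have hw : ∀ f : Lp (Eu n) 2 μ, Tendsto (fun k => inner ℝ f (G k)) U (𝓝 (inner ℝ f g')) := by
    intro f
    have h1 : Tendsto (fun k => Λ k f) U (𝓝 (l f)) :=
      ((WeakDual.eval_continuous f).tendsto l).comp hl'
    have h2 : inner ℝ f g' = l f := by
      rw [real_inner_comm, hg', InnerProductSpace.toDual_symm_apply]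
      rfl
    rw [h2]
    refine h1.congr fun k => ?_
    rw [real_inner_comm]
    rfl
  have hGg : ∀ k, G k =ᵐ[μ] g k := fun k => (hm k).coeFn_toLp
  have hgi : ∀ k, IntegrableOn (g k) (Set.Icc a b) := fun k => (hg k).1
  refine ⟨g', Lp.stronglyMeasurable g', ?_, ?_⟩
  · have hgi' : IntegrableOn g' (Set.Icc a b) := (Lp.memLp g').integrable (by norm_num)
    refine hasVel_of_le hgi' fun s t hst => ?_
    have hsub : Set.Ioc (s : ℝ) t ⊆ Set.Icc a b :=
      Set.Ioc_subset_Icc_self.trans (Set.Icc_subset_Icc s.2.1 t.2.2)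
    have hr : ∀ h : ℝ → Eu n, ∫ u in Set.Ioc (s : ℝ) t, h u ∂μ = ∫ u in Set.Ioc (s : ℝ) t, h u := by
      intro h
      rw [hμ, Measure.restrict_restrict measurableSet_Ioc, Set.inter_eq_left.2 hsub]
    refine ext_inner_left ℝ fun w => ?_
    have hfin : μ (Set.Ioc (s : ℝ) t) ≠ ⊤ := measure_ne_top _ _
    have h1 := hw (indicatorConstLp 2 measurableSet_Ioc hfin w)
    simp only [L2.inner_indicatorConstLp_eq_inner_setIntegral] at h1
    rw [hr] at h1
    have h2 : Tendsto (fun k => inner ℝ w (γs k t - γs k s)) U (𝓝 (inner ℝ w (γ t - γ s))) := by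
      have e1 : Continuous (fun η : CPath a b n => inner ℝ w (η t - η s)) :=
        continuous_const.inner ((continuous_eval_const t).sub (continuous_eval_const s))
      exact (e1.tendsto γ).comp hγ
    refine tendsto_nhds_unique h2 (h1.congr fun k => ?_)
    rw [(hg k).sub_eq hst, ← hr]
    congr 1
    exact setIntegral_congr_ae measurableSet_Ioc ((hGg k).mono fun x hx _ => hx)
  · intro f hf
    have h1 := hw (hf.toLp f)
    simp only [L2.inner_def] at h1
    have h2 : ∫ t, inner ℝ (hf.toLp f t) (g' t) ∂μ = ∫ t, inner ℝ (f t) (g' t) ∂μ :=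
      integral_congr_ae (hf.coeFn_toLp.mono fun x hx => by simp only [hx])
    rw [h2] at h1
    refine h1.congr fun k => integral_congr_ae ?_
    filter_upwards [hf.coeFn_toLp, hGg k] with x hx hx'
    rw [hx, hx']

lemma aestronglyMeasurable_pev {a b : ℝ} {n : ℕ} (γ : CPath a b n) :
    AEStronglyMeasurable (pev γ) (volume.restrict (Set.Icc a b)) :=
  (continuousOn_pev γ).aestronglyMeasurable measurableSet_Icc

lemma norm_pev_le {a b : ℝ} {n : ℕ} (γ : CPath a b n) (t : ℝ) : ‖pev γ t‖ ≤ ‖γ‖ := by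
  by_cases ht : t ∈ Set.Icc a b
  · rw [pev_of_mem γ ht]
    exact γ.norm_coe_le_norm _
  · simp only [pev, dif_neg ht]
    simp

lemma norm_pev_sub_le {a b : ℝ} {n : ℕ} (γ γ' : CPath a b n) (t : ℝ) :
    ‖pev γ t - pev γ' t‖ ≤ dist γ γ' := by
  by_cases ht : t ∈ Set.Icc a b
  · rw [pev_of_mem γ ht, pev_of_mem γ' ht, ← dist_eq_norm]
    exact ContinuousMap.dist_apply_le_dist _
  · simp only [pev, dif_neg ht]
    simp

lemma IsTonelli.lintegral_sq_le {n : ℕ} {L : Eu n → Eu n → ℝ}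
    {D : Eu n → Eu n → Eu n →L[ℝ] ℝ} {c : ℝ} (H : IsTonelli L D c) {a b : ℝ} (hab : a < b)
    (R : ℝ) (M : ℝ≥0) : ∃ B : ℝ≥0, ∀ (γ : CPath a b n) (g : ℝ → Eu n), HasVel γ g → ‖γ‖ ≤ R →
      energy L c γ ≤ M → ∫⁻ t in Set.Icc a b, ‖g t‖ₑ ^ 2 ≤ B := by
  obtain ⟨κ, C, hκ, hq⟩ := H.quad R
  have hfin : (ENNReal.ofReal κ)⁻¹ * (M + ENNReal.ofReal (C - c) * ENNReal.ofReal (b - a)) ≠ ⊤ := by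
    apply ENNReal.mul_ne_top
    · simpa using hκ
    · exact ENNReal.add_ne_top.2 ⟨ENNReal.coe_ne_top,
        ENNReal.mul_ne_top ENNReal.ofReal_ne_top ENNReal.ofReal_ne_top⟩
  refine ⟨(_ : ℝ≥0∞).toNNReal, fun γ g hg hR hE =>
    le_of_le_of_eq ?_ (ENNReal.coe_toNNReal hfin).symm⟩
  have hpt : ∀ t, ENNReal.ofReal κ * ‖g t‖ₑ ^ 2 ≤
      ENNReal.ofReal (L (pev γ t) (g t) + c) + ENNReal.ofReal (C - c) := by
    intro t
    rw [← ofReal_norm, ← ENNReal.ofReal_pow (norm_nonneg _), ← ENNReal.ofReal_mul hκ.le]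
    refine le_trans (ENNReal.ofReal_le_ofReal ?_) ENNReal.ofReal_add_le
    have h1 := hq (pev γ t) (g t) ((norm_pev_le γ t).trans hR)
    have h2 := hq (pev γ t) 0 ((norm_pev_le γ t).trans hR)
    have h3 := H.nonneg (pev γ t) (g t)
    linarith [H.nonneg (pev γ t) 0]
  have h2 : ENNReal.ofReal κ * ∫⁻ t in Set.Icc a b, ‖g t‖ₑ ^ 2 ≤
      M + ENNReal.ofReal (C - c) * ENNReal.ofReal (b - a) := by
    rw [← lintegral_const_mul' _ _ ENNReal.ofReal_ne_top]
    refine (lintegral_mono hpt).trans ?_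
    rw [lintegral_add_right _ measurable_const, ← hg.energy_eq hab]
    simp only [lintegral_const, MeasurableSet.univ, Measure.restrict_apply, Set.univ_inter,
      Real.volume_Icc]
    gcongr
  rw [← ENNReal.mul_le_iff_le_inv (by simpa using hκ) ENNReal.ofReal_ne_top]
  exact h2

lemma energy_le_of_tendsto {n : ℕ} {L : Eu n → Eu n → ℝ}
    {D : Eu n → Eu n → Eu n →L[ℝ] ℝ} {c : ℝ} (H : IsTonelli L D c) {a b : ℝ} (hab : a < b)
    {γs : ℕ → CPath a b n} {γ : CPath a b n} (hγ : Tendsto γs atTop (𝓝 γ)) {M : ℝ≥0}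
    (hM : ∀ k, energy L c (γs k) ≤ M) : energy L c γ ≤ M := by
  set μ := volume.restrict (Set.Icc a b) with hμ
  obtain ⟨R, hR⟩ : ∃ R, ∀ k, ‖γs k‖ ≤ R := by
    obtain ⟨R, hR⟩ := (Metric.isBounded_range_of_tendsto _ hγ).exists_norm_le
    exact ⟨R, fun k => hR _ ⟨k, rfl⟩⟩
  have hRγ : ‖γ‖ ≤ R := le_of_tendsto (hγ.norm) (Eventually.of_forall hR)
  have hR0 : 0 ≤ R := (norm_nonneg _).trans hRγ
  choose g hgm hg using fun k => isACC_of_energy_ne_top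
    (ne_top_of_le_ne_top ENNReal.coe_ne_top (hM k))
  obtain ⟨B, hB⟩ := H.lintegral_sq_le hab R M
  replace hB : ∀ k, ∫⁻ t, ‖g k t‖ₑ ^ 2 ∂μ ≤ B := fun k => hB _ _ (hg k) (hR k) (hM k)
  have hL2 : ∀ k, eLpNorm (g k) 2 μ ≤ ((B ^ (1 / 2 : ℝ) : ℝ≥0) : ℝ≥0∞) := by
    intro k
    rw [eLpNorm_eq_lintegral_rpow_enorm_toReal (by norm_num) (by norm_num)]
    rw [ENNReal.coe_rpow_of_nonneg _ (by norm_num)]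
    simp only [ENNReal.toReal_ofNat, ENNReal.rpow_ofNat]
    gcongr
    exact hB k
  have hmem : ∀ k, MemLp (g k) 2 μ := fun k =>
    ⟨(hgm k).aestronglyMeasurable, (hL2 k).trans_lt ENNReal.coe_lt_top⟩
  have hgi : ∀ k, Integrable (g k) μ := fun k => (hg k).1
  -- uniform `L¹` bound
  obtain ⟨B₁, hB₁⟩ : ∃ B₁ : ℝ, ∀ k, ∫ t, ‖g k t‖ ∂μ ≤ B₁ := by
    have hfin : μ Set.univ + B ≠ ⊤ := ENNReal.add_ne_top.2 ⟨measure_ne_top _ _, ENNReal.coe_ne_top⟩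
    refine ⟨(μ Set.univ + B).toReal, fun k => ?_⟩
    rw [integral_norm_eq_lintegral_enorm (hgi k).1]
    refine ENNReal.toReal_mono hfin ?_
    have : ∀ t, ‖g k t‖ₑ ≤ 1 + ‖g k t‖ₑ ^ 2 := by
      intro t
      rcases le_total (‖g k t‖ₑ) 1 with h | h
      · exact h.trans le_self_add
      · calc ‖g k t‖ₑ = ‖g k t‖ₑ * 1 := (mul_one _).symm
          _ ≤ ‖g k t‖ₑ * ‖g k t‖ₑ := by gcongr
          _ ≤ _ := by rw [← sq]; exact le_add_self
    refine (lintegral_mono this).trans ?_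
    rw [lintegral_add_left measurable_const]
    simp only [lintegral_const, one_mul]
    gcongr
    exact hB k
  obtain ⟨g', hgm', hg', hw⟩ := exists_weak_limit_velocity (U := hyperfilter ℕ)
    (hγ.mono_left (Nat.hyperfilter_le_atTop)) hg hmem hL2
  have hgi' : Integrable g' μ := hg'.1
  -- energies as real integrals
  have hEi : ∀ k, Integrable (fun t => L (pev (γs k) t) (g k t) + c) μ ∧
      ∫ t, (L (pev (γs k) t) (g k t) + c) ∂μ ≤ M := by
    intro k
    have hm : AEStronglyMeasurable (fun t => L (pev (γs k) t) (g k t) + c) μ :=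
      (H.cont.comp_aestronglyMeasurable
        ((aestronglyMeasurable_pev (γs k)).prodMk (hgi k).1)).add aestronglyMeasurable_const
    have hk := hM k
    rw [(hg k).energy_eq hab] at hk
    refine ⟨⟨hm, ?_⟩, ?_⟩
    · rw [hasFiniteIntegral_iff_ofReal (Eventually.of_forall fun t => H.nonneg _ _)]
      exact hk.trans_lt ENNReal.coe_lt_top
    · rw [integral_eq_lintegral_of_nonneg_ae (Eventually.of_forall fun t => H.nonneg _ _) hm]
      exact ENNReal.toReal_le_coe_of_le_coe hk
  -- truncated velocities
  set p : ℕ → ℝ → Eu n := fun m => {t | ‖g' t‖ ≤ m}.indicator g' with hp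
  have hpm : ∀ m, StronglyMeasurable (p m) := fun m =>
    hgm'.indicator (measurableSet_le hgm'.norm.measurable measurable_const)
  have hpb : ∀ m t, ‖p m t‖ ≤ m := by
    intro m t
    simp only [hp, Set.indicator]
    split_ifs with h
    · exact h
    · simp
  have hpp : ∀ m, AEStronglyMeasurable (fun t => (pev γ t, p m t)) μ := fun m =>
    (aestronglyMeasurable_pev γ).prodMk (hpm m).aestronglyMeasurable
  set A : ℕ → ℝ → ℝ := fun m t => L (pev γ t) (p m t) - D (pev γ t) (p m t) (p m t) + c with hA
  set q : ℕ → ℝ → Eu n →L[ℝ] ℝ := fun m t => D (pev γ t) (p m t) with hq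
  have hqm : ∀ m, AEStronglyMeasurable (q m) μ := fun m =>
    H.contD.comp_aestronglyMeasurable (hpp m)
  have hAm : ∀ m, AEStronglyMeasurable (A m) μ := fun m =>
    ((H.cont.comp_aestronglyMeasurable (hpp m)).sub
      ((isBoundedBilinearMap_apply (𝕜 := ℝ) (E := Eu n) (F := ℝ)).continuous.comp_aestronglyMeasurable
        ((hqm m).prodMk (hpm m).aestronglyMeasurable))).add aestronglyMeasurable_const
  have hqb : ∀ m, ∃ Q, 0 ≤ Q ∧ ∀ t, ‖q m t‖ ≤ Q := by
    intro m
    obtain ⟨Q, hQ0, hQ⟩ := exists_norm_bound H.contD R m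
    exact ⟨Q, hQ0, fun t => hQ _ _ ((norm_pev_le γ t).trans hRγ) (hpb m t)⟩
  have hAi : ∀ m, Integrable (A m) μ := by
    intro m
    obtain ⟨Q, hQ0, hQ⟩ := hqb m
    obtain ⟨S, hS0, hS⟩ := exists_norm_bound H.cont R m
    refine Integrable.of_bound (hAm m) (S + Q * m + |c|) (Eventually.of_forall fun t => ?_)
    refine (norm_add_le _ _).trans (add_le_add ((norm_sub_le _ _).trans (add_le_add ?_ ?_)) le_rfl)
    · exact hS _ _ ((norm_pev_le γ t).trans hRγ) (hpb m t)
    · exact (ContinuousLinearMap.le_opNorm _ _).trans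
        (mul_le_mul (hQ t) (hpb m t) (norm_nonneg _) hQ0)
  have hqi : ∀ m (h : ℝ → Eu n), Integrable h μ → Integrable (fun t => q m t (h t)) μ := by
    intro m h hh
    obtain ⟨Q, hQ0, hQ⟩ := hqb m
    refine (hh.norm.const_mul Q).mono' ((isBoundedBilinearMap_apply (𝕜 := ℝ) (E := Eu n)
      (F := ℝ)).continuous.comp_aestronglyMeasurable ((hqm m).prodMk hh.1))
      (Eventually.of_forall fun t => ?_)
    exact (ContinuousLinearMap.le_opNorm _ _).trans
      (mul_le_mul_of_nonneg_right (hQ t) (norm_nonneg _))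
  have hqw : ∀ m, Tendsto (fun k => ∫ t, q m t (g k t) ∂μ) (hyperfilter ℕ : Filter ℕ)
      (𝓝 (∫ t, q m t (g' t) ∂μ)) := by
    intro m
    obtain ⟨Q, hQ0, hQ⟩ := hqb m
    have hf : MemLp (fun t => (InnerProductSpace.toDual ℝ (Eu n)).symm (q m t)) 2 μ := by
      refine MemLp.of_bound ?_ Q (Eventually.of_forall fun t => ?_)
      · exact (LinearIsometryEquiv.continuous _).comp_aestronglyMeasurable (hqm m)
      · rw [LinearIsometryEquiv.norm_map]
        exact hQ t
    simpa only [InnerProductSpace.toDual_symm_apply] using hw _ hf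
  have key : ∀ m : ℕ, ∫ t, A m t ∂μ + ∫ t, q m t (g' t) ∂μ ≤ M := by
    intro m
    refine le_of_forall_pos_le_add fun ε hε => ?_
    set E := (1 + m) * (b - a) + B₁ with hE
    have hB0 : 0 ≤ B₁ := (integral_nonneg fun t => norm_nonneg _).trans (hB₁ 0)
    have hE0 : 0 < E := by
      have : 0 < (1 + (m : ℝ)) * (b - a) := mul_pos (by positivity) (by linarith)
      linarith
    have hε' : 0 < ε / E := by positivity
    obtain ⟨δ₁, hδ₁, h₁⟩ := exists_modulus H.cont R m hε'
    obtain ⟨δ₂, hδ₂, h₂⟩ := exists_modulus H.contD R m hε'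
    refine le_of_tendsto (tendsto_const_nhds.add (hqw m)) ?_
    have hev : ∀ᶠ k in (hyperfilter ℕ : Filter ℕ), dist (γs k) γ < min δ₁ δ₂ :=
      (hγ.mono_left (Nat.hyperfilter_le_atTop)) (Metric.ball_mem_nhds γ (lt_min hδ₁ hδ₂))
    filter_upwards [hev] with k hk
    rw [← integral_add (hAi m) (hqi m _ (hgi k))]
    have hpt : ∀ t, A m t + q m t (g k t) ≤
        (L (pev (γs k) t) (g k t) + c) + ε / E * ((1 + m) + ‖g k t‖) := by
      intro t
      have n1 : ‖pev γ t - pev (γs k) t‖ ≤ min δ₁ δ₂ :=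
        (norm_pev_sub_le γ (γs k) t).trans (by rw [dist_comm]; exact hk.le)
      have d1 := h₁ (pev γ t) (pev (γs k) t) (p m t) (p m t) ((norm_pev_le _ t).trans hRγ)
        ((norm_pev_le _ t).trans (hR k)) (hpb m t) (hpb m t) (n1.trans (min_le_left _ _))
        (by simpa using hδ₁.le)
      have d2 := h₂ (pev γ t) (pev (γs k) t) (p m t) (p m t) ((norm_pev_le _ t).trans hRγ)
        ((norm_pev_le _ t).trans (hR k)) (hpb m t) (hpb m t) (n1.trans (min_le_right _ _))
        (by simpa using hδ₂.le)
      rw [Real.dist_eq] at d1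
      rw [dist_eq_norm] at d2
      have t1 := H.tangent (pev (γs k) t) (p m t) (g k t)
      have t2 : (D (pev γ t) (p m t) - D (pev (γs k) t) (p m t)) (g k t - p m t) ≤
          ε / E * (‖g k t‖ + m) := by
        refine (Real.le_norm_self _).trans ((ContinuousLinearMap.le_opNorm _ _).trans ?_)
        refine mul_le_mul d2.le ((norm_sub_le _ _).trans ?_) (norm_nonneg _) hε'.le
        gcongr
        exact hpb m t
      have t3 := (abs_lt.1 d1).2
      simp only [hA, hq]
      simp only [sub_apply, map_sub] at t1 t2
      linarith
    have hgn : Integrable (fun t => ε / E * ((1 + (m : ℝ)) + ‖g k t‖)) μ :=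
      ((integrable_const (μ := μ) ((1 : ℝ) + m)).add (hgi k).norm).const_mul (ε / E)
    refine (integral_mono ((hAi m).add (hqi m _ (hgi k))) ((hEi k).1.add hgn) hpt).trans ?_
    simp only [Pi.add_apply]
    rw [integral_add (hEi k).1 hgn]
    refine add_le_add (hEi k).2 ?_
    rw [integral_const_mul, integral_add (integrable_const _) (hgi k).norm]
    have hv : ∫ t, (1 + (m : ℝ)) ∂μ = (1 + m) * (b - a) := by
      simp only [integral_const, hμ, MeasurableSet.univ, measureReal_restrict_apply,
        Set.univ_inter, Real.volume_real_Icc_of_le hab.le, smul_eq_mul]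
      ring
    rw [hv]
    calc ε / E * ((1 + m) * (b - a) + ∫ t, ‖g k t‖ ∂μ) ≤ ε / E * E := by
          gcongr
          rw [hE]
          gcongr
          exact hB₁ k
      _ = ε := by field_simp
  -- remove the truncation by the Fatou lemma
  obtain ⟨Q, hQ0, hQ⟩ := exists_norm_bound H.contD R 0
  set I := ∫ t, Q * ‖g' t‖ ∂μ with hI
  have hgI : Integrable (fun t => Q * ‖g' t‖) μ := hgi'.norm.const_mul Q
  set Ψ : ℕ → ℝ → ℝ := fun m t => A m t + q m t (g' t) + Q * ‖g' t‖ with hΨ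
  have hΨ0 : ∀ m t, 0 ≤ Ψ m t := by
    intro m t
    simp only [hΨ, hA, hq, hp, Set.indicator, Set.mem_ofPred_eq]
    split_ifs with h
    · have := H.nonneg (pev γ t) (g' t)
      have : 0 ≤ Q * ‖g' t‖ := by positivity
      linarith
    · have h1 := H.nonneg (pev γ t) 0
      have h2 := (D (pev γ t) 0).le_opNorm (g' t)
      have h3 := mul_le_mul_of_nonneg_right
        (hQ (pev γ t) 0 ((norm_pev_le γ t).trans hRγ) (by simp)) (norm_nonneg (g' t))
      have h4 := neg_abs_le (D (pev γ t) 0 (g' t))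
      rw [Real.norm_eq_abs] at h2
      simp only [map_zero, sub_zero]
      linarith
  have hΨi : ∀ m, Integrable (Ψ m) μ := fun m => ((hAi m).add (hqi m _ hgi')).add hgI
  have hΨle : ∀ m, ∫⁻ t, ENNReal.ofReal (Ψ m t) ∂μ ≤ M + ENNReal.ofReal I := by
    intro m
    have hI0 : 0 ≤ I := integral_nonneg fun t => by positivity
    rw [← ofReal_integral_eq_lintegral_ofReal (hΨi m) (Eventually.of_forall (hΨ0 m)),
      ← ENNReal.ofReal_coe_nnreal, ← ENNReal.ofReal_add M.coe_nonneg hI0]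
    apply ENNReal.ofReal_le_ofReal
    simp only [hΨ]
    have e1 : ∫ t, (A m t + q m t (g' t) + Q * ‖g' t‖) ∂μ =
        ∫ t, (A m t + q m t (g' t)) ∂μ + I := integral_add ((hAi m).add (hqi m _ hgi')) hgI
    rw [e1, integral_add (hAi m) (hqi m _ hgi')]
    gcongr
    exact key m
  have hlim : ∀ t, Tendsto (fun m => ENNReal.ofReal (Ψ m t)) atTop
      (𝓝 (ENNReal.ofReal (L (pev γ t) (g' t) + c) + ENNReal.ofReal (Q * ‖g' t‖))) := by
    intro t
    apply tendsto_const_nhds.congr'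
    filter_upwards [eventually_ge_atTop ⌈‖g' t‖⌉₊] with m hm
    have : ‖g' t‖ ≤ m := Nat.ceil_le.1 hm
    simp only [hΨ, hA, hq, hp, Set.indicator, Set.mem_ofPred_eq, if_pos this]
    rw [← ENNReal.ofReal_add (H.nonneg _ _) (by positivity)]
    congr 1
    ring
  have hfat : ∫⁻ t, (ENNReal.ofReal (L (pev γ t) (g' t) + c) + ENNReal.ofReal (Q * ‖g' t‖)) ∂μ ≤
      M + ENNReal.ofReal I := by
    calc _ = ∫⁻ t, liminf (fun m => ENNReal.ofReal (Ψ m t)) atTop ∂μ := by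
          refine lintegral_congr fun t => (hlim t).liminf_eq.symm
      _ ≤ liminf (fun m => ∫⁻ t, ENNReal.ofReal (Ψ m t) ∂μ) atTop :=
          lintegral_liminf_le' fun m => (hΨi m).1.aemeasurable.ennreal_ofReal
      _ ≤ _ := by
          refine liminf_le_of_le (by isBoundedDefault) fun x hx => ?_
          obtain ⟨m, hm⟩ := hx.exists
          exact hm.trans (hΨle m)
  rw [lintegral_add_right' _ hgI.1.aemeasurable.ennreal_ofReal, ← hg'.energy_eq hab,
    ← ofReal_integral_eq_lintegral_ofReal hgI (Eventually.of_forall fun t => by positivity)] at hfat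
  exact (ENNReal.add_le_add_iff_right ENNReal.ofReal_ne_top).1 hfat

lemma IsTonelli.lowerSemicontinuous_energy {n : ℕ} {L : Eu n → Eu n → ℝ}
    {D : Eu n → Eu n → Eu n →L[ℝ] ℝ} {c : ℝ} (H : IsTonelli L D c) {a b : ℝ} (hab : a < b) :
    LowerSemicontinuous (energy L c : CPath a b n → ℝ≥0∞) := by
  rw [lowerSemicontinuous_iff_isClosed_preimage]
  intro M
  rcases eq_or_ne M ⊤ with rfl | hM
  · simp
  · lift M to ℝ≥0 using hM
    refine isSeqClosed_iff_isClosed.1 fun γs γ hs hγ => ?_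
    exact energy_le_of_tendsto H hab hγ hs

section WeakConvergence

variable {X : Type*} [TopologicalSpace X] [MeasurableSpace X]

lemma lintegral_le_liminf_lintegral_of_lowerSemicontinuous [OpensMeasurableSpace X]
    {πs : ℕ → Measure X} {π : Measure X} {f : X → ℝ≥0∞} (hf : LowerSemicontinuous f)
    (h : ∀ G, IsOpen G → π G ≤ liminf (fun i => πs i G) atTop) :
    ∫⁻ x, f x ∂π ≤ liminf (fun i => ∫⁻ x, f x ∂(πs i)) atTop := by
  have key : ∀ M : ℕ, ∫⁻ x, min (f x) M ∂π ≤ liminf (fun i => ∫⁻ x, f x ∂(πs i)) atTop := by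
    intro M
    have hnt : ∀ x, min (f x) M ≠ ⊤ := fun x => ne_top_of_le_ne_top (by simp) (min_le_right _ _)
    have hm : Measurable fun x => (min (f x) M).toReal :=
      (hf.measurable.min measurable_const).ennreal_toReal
    have hfe : ∀ ν : Measure X, ∫⁻ x, min (f x) M ∂ν =
        ∫⁻ t in Set.Ioi (0 : ℝ), ν {x | t < (min (f x) M).toReal} := by
      intro ν
      rw [← lintegral_eq_lintegral_meas_lt ν (Eventually.of_forall fun x => ENNReal.toReal_nonneg)
        hm.aemeasurable]
      exact lintegral_congr fun x => (ENNReal.ofReal_toReal (hnt x)).symm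
    have hopen : ∀ t : ℝ, 0 < t → IsOpen {x | t < (min (f x) M).toReal} := by
      intro t ht
      have : {x | t < (min (f x) M).toReal} =
          {x | ENNReal.ofReal t < f x} ∩ {_x | ENNReal.ofReal t < M} := by
        ext x
        simp only [Set.mem_inter_iff, Set.mem_ofPred_eq]
        rw [← ENNReal.ofReal_lt_iff_lt_toReal ht.le (hnt x), lt_min_iff]
      rw [this]
      exact (hf.isOpen_preimage (ENNReal.ofReal t)).inter isOpen_const
    calc ∫⁻ x, min (f x) M ∂π
        ≤ ∫⁻ t in Set.Ioi (0 : ℝ), liminf (fun i => πs i {x | t < (min (f x) M).toReal}) atTop := by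
          rw [hfe]
          exact setLIntegral_mono' measurableSet_Ioi fun t ht => h _ (hopen t ht)
      _ ≤ liminf (fun i => ∫⁻ t in Set.Ioi (0 : ℝ), πs i {x | t < (min (f x) M).toReal}) atTop :=
          lintegral_liminf_le fun i => Antitone.measurable fun s t hst =>
            measure_mono fun x hx => lt_of_le_of_lt hst hx
      _ ≤ liminf (fun i => ∫⁻ x, f x ∂(πs i)) atTop := by
          refine liminf_le_liminf (Eventually.of_forall fun i => ?_)
          rw [← hfe]
          exact lintegral_mono fun x => min_le_left _ _
  have hsup : ∫⁻ x, f x ∂π = ⨆ M : ℕ, ∫⁻ x, min (f x) M ∂π := by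
    rw [← lintegral_iSup (fun M => hf.measurable.min measurable_const)]
    · refine lintegral_congr fun x => ?_
      have : ⨆ M : ℕ, min (f x) (M : ℝ≥0∞) = f x ⊓ ⨆ M : ℕ, (M : ℝ≥0∞) := (inf_iSup_eq _ _).symm
      rw [this, ENNReal.iSup_natCast, inf_top_eq]
    · intro M M' hM x
      have : (M : ℝ≥0∞) ≤ M' := by exact_mod_cast hM
      exact min_le_min le_rfl this
  rw [hsup]
  exact iSup_le key

lemma WeakLim.tendsto_probabilityMeasure [OpensMeasurableSpace X] {πs : ℕ → Measure X}
    {π : Measure X}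
    (hs : ∀ N, IsProbabilityMeasure (πs N)) (hp : IsProbabilityMeasure π) (h : WeakLim πs π) :
    Tendsto (β := ProbabilityMeasure X) (fun N => ⟨πs N, hs N⟩) atTop (𝓝 ⟨π, hp⟩) :=
  ProbabilityMeasure.tendsto_iff_forall_integral_tendsto.2 h

lemma WeakLim.exists_eventuallyEq {πs : ℕ → Measure X} {π : Measure X}
    (hs : ∀ᶠ N in atTop, IsProbabilityMeasure (πs N)) (hp : IsProbabilityMeasure π)
    (h : WeakLim πs π) : ∃ πs' : ℕ → Measure X, (∀ N, IsProbabilityMeasure (πs' N)) ∧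
      πs' =ᶠ[atTop] πs ∧ WeakLim πs' π := by
  classical
  have he : (fun N => if IsProbabilityMeasure (πs N) then πs N else π) =ᶠ[atTop] πs := by
    filter_upwards [hs] with N hN
    exact if_pos hN
  refine ⟨_, fun N => ?_, he, fun φ => (h φ).congr' ?_⟩
  · split_ifs with hN
    exacts [hN, hp]
  · filter_upwards [he] with N hN
    rw [hN]

lemma WeakLim.lintegral_le_liminf [OpensMeasurableSpace X] [HasOuterApproxClosed X]
    {πs : ℕ → Measure X} {π : Measure X}
    (hs : ∀ᶠ N in atTop, IsProbabilityMeasure (πs N)) (hp : IsProbabilityMeasure π)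
    (h : WeakLim πs π) {f : X → ℝ≥0∞} (hf : LowerSemicontinuous f) :
    ∫⁻ x, f x ∂π ≤ liminf (fun i => ∫⁻ x, f x ∂(πs i)) atTop := by
  obtain ⟨πs', hs', he, h'⟩ := h.exists_eventuallyEq hs hp
  have e : (fun i => ∫⁻ x, f x ∂(πs' i)) =ᶠ[atTop] fun i => ∫⁻ x, f x ∂(πs i) := by
    filter_upwards [he] with N hN
    rw [hN]
  rw [← liminf_congr e]
  exact lintegral_le_liminf_lintegral_of_lowerSemicontinuous hf fun G hG =>
    ProbabilityMeasure.le_liminf_measure_open_of_tendsto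
      (h'.tendsto_probabilityMeasure hs' hp) hG

lemma WeakLim.map_eq_of_frequently {Y : Type*} [TopologicalSpace Y] [MeasurableSpace Y]
    [BorelSpace Y] [HasOuterApproxClosed Y] [OpensMeasurableSpace X] {πs : ℕ → Measure X}
    {π : Measure X} [IsProbabilityMeasure π] (h : WeakLim πs π) {f : X → Y} (hf : Continuous f)
    {νs : ℕ → Measure Y} {ν : Measure Y} [IsProbabilityMeasure ν] (hν : WeakLim νs ν)
    (he : ∃ᶠ N in atTop, Measure.map f (πs N) = νs N) : Measure.map f π = ν := by
  have : IsFiniteMeasure (Measure.map f π) := inferInstance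
  refine ext_of_forall_integral_eq_of_IsFiniteMeasure fun φ => ?_
  have h1 := h (φ.compContinuous ⟨f, hf⟩)
  have hi : ∀ ρ : Measure X, ∫ y, φ y ∂(Measure.map f ρ) =
      ∫ x, (φ.compContinuous ⟨f, hf⟩) x ∂ρ := by
    intro ρ
    rw [integral_map hf.measurable.aemeasurable φ.continuous.aestronglyMeasurable]
    rfl
  rw [hi]
  refine tendsto_nhds_unique_of_frequently_eq h1 (hν φ) (he.mono fun N hN => ?_)
  rw [← hN, hi]

end WeakConvergence

lemma measurable_pev_left {a b : ℝ} {n : ℕ} (t : ℝ) : Measurable fun γ : CPath a b n => pev γ t :=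
  (continuous_pev_left t).measurable

lemma continuous_coe_ennreal_sub_coe (c : ℝ) :
    Continuous fun z : ℝ≥0∞ => (z : EReal) - (c : EReal) := by
  have e : (fun z : ℝ≥0∞ => (z : EReal) - (c : EReal)) =
      fun z : ℝ≥0∞ => (z : EReal) + ((-c : ℝ) : EReal) := by
    ext z
    simp [sub_eq_add_neg]
  rw [e, continuous_iff_continuousAt]
  intro z
  refine ContinuousAt.comp (g := fun p : EReal × EReal => p.1 + p.2)
    (f := fun z : ℝ≥0∞ => ((z : EReal), ((-c : ℝ) : EReal)))
    (EReal.continuousAt_add (Or.inr (EReal.coe_ne_bot _)) (Or.inr (EReal.coe_ne_top _)))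
    (continuous_coe_ennreal_ereal.prodMk continuous_const).continuousAt

lemma aFun_le_liminf {a b : ℝ} {n : ℕ} {F : CPath a b n → EReal} {E : CPath a b n → ℝ≥0∞}
    (hE : LowerSemicontinuous E) {c : ℝ} (hc : 0 ≤ c) (hF : ∀ γ, F γ = (E γ : EReal) - (c : EReal))
    {μa μb : Measure (Eu n)} [IsProbabilityMeasure μa] [IsProbabilityMeasure μb]
    {μas μbs : ℕ → Measure (Eu n)} (ha : WeakLim μas μa) (hb : WeakLim μbs μb)
    {πs : ℕ → Measure (CPath a b n)} {π : Measure (CPath a b n)}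
    (hs : ∀ᶠ N in atTop, IsProbabilityMeasure (πs N)) (hp : IsProbabilityMeasure π)
    (h : WeakLim πs π) :
    aFun F μa μb π ≤ liminf (fun N => aFun F (μas N) (μbs N) (πs N)) atTop := by
  classical
  by_cases hf : ∃ᶠ N in atTop, Measure.map (fun γ => pev γ a) (πs N) = μas N ∧
      Measure.map (fun γ => pev γ b) (πs N) = μbs N
  · have m1 := h.map_eq_of_frequently (continuous_pev_left a) ha (hf.mono fun N h => h.1)
    have m2 := h.map_eq_of_frequently (continuous_pev_left b) hb (hf.mono fun N h => h.2)
    rw [aFun, if_pos ⟨m1, m2⟩, mint_eq_lintegral_sub π hE.measurable hc hF]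
    set g : ℝ≥0∞ → EReal := fun z => (z : EReal) - (c : EReal) with hg
    have hgm : Monotone g := fun z w hzw => EReal.sub_le_sub (by exact_mod_cast hzw) le_rfl
    have hgc : Continuous g := continuous_coe_ennreal_sub_coe c
    have h1 := hgm (h.lintegral_le_liminf hs hp hE)
    rw [hgm.map_liminf_of_continuousAt _ hgc.continuousAt] at h1
    refine h1.trans (liminf_le_liminf ?_)
    filter_upwards [hs] with N hN
    simp only [Function.comp_apply, aFun]
    split_ifs
    · rw [mint_eq_lintegral_sub _ hE.measurable hc hF]
    · exact le_top
  · have : ∀ᶠ N in atTop, aFun F (μas N) (μbs N) (πs N) = ⊤ := by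
      filter_upwards [not_frequently.1 hf] with N hN
      exact if_neg hN
    rw [liminf_congr this, liminf_const]
    exact le_top

lemma exists_orderIso_integral {l : ℝ → ℝ} (hl : ∀ t, 1 / 2 ≤ l t)
    (hli : ∀ s t, IntervalIntegrable l volume s t) (a : ℝ) :
    ∃ Θ : ℝ ≃o ℝ, (∀ s t, Θ t - Θ s = ∫ u in s..t, l u) ∧ Θ a = a := by
  set f : ℝ → ℝ := fun t => a + ∫ u in a..t, l u with hf
  have hsub : ∀ s t, f t - f s = ∫ u in s..t, l u := by
    intro s t
    rw [← intervalIntegral.integral_add_adjacent_intervals (hli s a) (hli a t),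
      intervalIntegral.integral_symm a s]
    simp only [hf]
    ring
  have hlow : ∀ s t, s ≤ t → (t - s) / 2 ≤ f t - f s := by
    intro s t hst
    rw [hsub]
    have := intervalIntegral.integral_mono_on hst (intervalIntegrable_const (c := (1 / 2 : ℝ)))
      (hli s t) (fun u _ => hl u)
    rw [intervalIntegral.integral_const, smul_eq_mul] at this
    linarith
  have hmono : StrictMono f := by
    intro s t hst
    have := hlow s t hst.le
    linarith
  have hcont : Continuous f :=
    continuous_const.add (intervalIntegral.continuous_primitive hli a)
  have hsurj : Function.Surjective f := by
    refine hcont.surjective ?_ ?_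
    · refine tendsto_atTop_mono' _ (f₁ := fun t => f a + (t - a) / 2) ?_ ?_
      · filter_upwards [eventually_ge_atTop a] with t ht
        linarith [hlow a t ht]
      · refine tendsto_atTop_add_const_left _ _ (Tendsto.atTop_div_const (by norm_num) ?_)
        exact tendsto_atTop_add_const_right _ _ tendsto_id
    · refine tendsto_atBot_mono' _ (f₁ := fun t => f a + (t - a) / 2) ?_ ?_
      · filter_upwards [eventually_le_atBot a] with t ht
        linarith [hlow t a ht]
      · refine tendsto_atBot_add_const_left _ _ (Tendsto.atBot_div_const (by norm_num) ?_)
        exact tendsto_atBot_add_const_right _ _ tendsto_id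
  refine ⟨hmono.orderIsoOfSurjective f hsurj, hsub, ?_⟩
  simp [hf]

lemma map_withDensity_orderIso {l : ℝ → ℝ} (hl : ∀ t, 1 / 2 ≤ l t)
    (hli : ∀ s t, IntervalIntegrable l volume s t) {Θ : ℝ ≃o ℝ}
    (hΘ : ∀ s t, Θ t - Θ s = ∫ u in s..t, l u) :
    Measure.map Θ (volume.withDensity fun t => ENNReal.ofReal (l t)) = volume := by
  symm
  refine Real.measure_ext_Ioo_rat fun p q => ?_
  symm
  rw [Measure.map_apply Θ.continuous.measurable measurableSet_Ioo]
  have e : Θ ⁻¹' Set.Ioo (p : ℝ) q = Set.Ioo (Θ.symm p) (Θ.symm q) := by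
    ext t
    simp [Θ.symm_apply_lt, Θ.lt_symm_apply]
  rw [e, withDensity_apply _ measurableSet_Ioo, Real.volume_Ioo]
  rcases le_total (p : ℝ) q with hpq | hpq
  · have hpq' : Θ.symm p ≤ Θ.symm q := Θ.symm.monotone hpq
    have h1 := hΘ (Θ.symm p) (Θ.symm q)
    rw [Θ.apply_symm_apply, Θ.apply_symm_apply, intervalIntegral.integral_of_le hpq',
      integral_Ioc_eq_integral_Ioo] at h1
    rw [h1, ofReal_integral_eq_lintegral_ofReal]
    · exact ((intervalIntegrable_iff_integrableOn_Ioo_of_le hpq').1 (hli _ _))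
    · exact Eventually.of_forall fun t => (by linarith [hl t] : (0 : ℝ) ≤ l t)
  · have hpq' : Θ.symm q ≤ Θ.symm p := Θ.symm.monotone hpq
    rw [Set.Ioo_eq_empty (not_lt.2 hpq'), ENNReal.ofReal_of_nonpos (by linarith)]
    simp

lemma HasVel.timeChange {a b : ℝ} {n : ℕ} {γ : CPath a b n} {g : ℝ → Eu n}
    (h : HasVel γ g) {l : ℝ → ℝ} (hlm : Measurable l) (hl : ∀ t, 1 / 2 ≤ l t)
    (hli : ∀ s t, IntervalIntegrable l volume s t) {Θ : ℝ ≃o ℝ}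
    (hΘ : ∀ s t, Θ t - Θ s = ∫ u in s..t, l u) (ha : Θ a = a) (hb : Θ b = b) :
    ∃ η : CPath a b n, HasVel η (fun t => (l (Θ.symm t))⁻¹ • g (Θ.symm t)) ∧
      (∀ t, pev η t = pev γ (Θ.symm t)) ∧
      ∀ f : Eu n → Eu n → ℝ≥0∞,
        ∫⁻ t in Set.Icc a b, f (pev η t) ((l (Θ.symm t))⁻¹ • g (Θ.symm t)) =
          ∫⁻ t in Set.Icc a b, ENNReal.ofReal (l t) * f (pev γ t) ((l t)⁻¹ • g t) := by
  have hmem : ∀ t, Θ.symm t ∈ Set.Icc a b ↔ t ∈ Set.Icc a b := by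
    intro t
    rw [Set.mem_Icc, Set.mem_Icc, Θ.le_symm_apply, Θ.symm_apply_le, ha, hb]
  have hmem' : ∀ t, Θ t ∈ Set.Icc a b ↔ t ∈ Set.Icc a b := by
    intro t
    rw [← hmem (Θ t), Θ.symm_apply_apply]
  have hmap := map_withDensity_orderIso hl hli hΘ
  have hemb : MeasurableEmbedding Θ := Θ.toHomeomorph.measurableEmbedding
  have hpre : ∀ s t, Θ ⁻¹' Set.Ioc (Θ s) (Θ t) = Set.Ioc s t := by
    intro s t
    ext u
    simp
  have hpre' : Θ ⁻¹' Set.Icc a b = Set.Icc a b := by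
    ext u
    exact hmem' u
  have hl0 : ∀ t, 0 < l t := fun t => by linarith [hl t]
  have hdm : Measurable fun t => ENNReal.ofReal (l t) := hlm.ennreal_ofReal
  have hlint : ∀ (φ : ℝ → ℝ≥0∞) (s : Set ℝ), MeasurableSet s →
      ∫⁻ t in s, φ (Θ.symm t) = ∫⁻ t in Θ ⁻¹' s, ENNReal.ofReal (l t) * φ t := by
    intro φ s hs
    have h1 : ∫⁻ t in s, φ (Θ.symm t) =
        ∫⁻ t in s, φ (Θ.symm t) ∂(Measure.map Θ (volume.withDensity fun t => ENNReal.ofReal (l t))) := by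
      rw [hmap]
    rw [h1, hemb.restrict_map, hemb.lintegral_map]
    simp only [Θ.symm_apply_apply]
    rw [restrict_withDensity (hemb.measurable hs),
      lintegral_withDensity_eq_lintegral_mul_non_measurable _ hdm
        (Eventually.of_forall fun t => ENNReal.ofReal_lt_top)]
    rfl
  set g' : ℝ → Eu n := fun t => (l (Θ.symm t))⁻¹ • g (Θ.symm t) with hg'
  have hgi' : IntegrableOn g' (Set.Icc a b) := by
    rw [IntegrableOn, ← hmap, hemb.restrict_map, hemb.integrable_map_iff, hpre',
      restrict_withDensity measurableSet_Icc,
      integrable_withDensity_iff_integrable_smul' hdm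
        (Eventually.of_forall fun t => ENNReal.ofReal_lt_top)]
    refine h.1.congr (Eventually.of_forall fun t => ?_)
    simp only [hg', Function.comp_apply, Θ.symm_apply_apply, ENNReal.toReal_ofReal (hl0 t).le]
    rw [smul_smul, mul_inv_cancel₀ (hl0 t).ne', one_smul]
  have hinteg : ∀ s t, ∫ u in Set.Ioc (Θ s) (Θ t), g' u = ∫ u in Set.Ioc s t, g u := by
    intro s t
    rw [← hmap, hemb.restrict_map, hemb.integral_map, hpre,
      restrict_withDensity measurableSet_Ioc,
      integral_withDensity_eq_integral_toReal_smul hdm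
        (Eventually.of_forall fun t => ENNReal.ofReal_lt_top)]
    rw [hmap]
    refine integral_congr_ae (Eventually.of_forall fun t => ?_)
    simp only [hg', Θ.symm_apply_apply, ENNReal.toReal_ofReal (hl0 t).le]
    rw [smul_smul, mul_inv_cancel₀ (hl0 t).ne', one_smul]
  let η : CPath a b n := ⟨fun t => γ ⟨Θ.symm t, (hmem t).2 t.2⟩, by
    exact γ.continuous.comp ((Θ.symm.continuous.comp continuous_subtype_val).subtype_mk _)⟩
  have hη : ∀ t, pev η t = pev γ (Θ.symm t) := by
    intro t
    by_cases ht : t ∈ Set.Icc a b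
    · rw [pev_of_mem η ht, pev_of_mem γ ((hmem t).2 ht)]
      rfl
    · rw [pev, dif_neg ht, pev, dif_neg (by rwa [hmem])]
  refine ⟨η, hasVel_of_le hgi' fun s t hst => ?_, hη, fun f => ?_⟩
  · have h1 := h.sub_eq (s := ⟨Θ.symm s, (hmem s).2 s.2⟩) (t := ⟨Θ.symm t, (hmem t).2 t.2⟩)
      (Θ.symm.monotone hst)
    have h2 := hinteg (Θ.symm s) (Θ.symm t)
    rw [Θ.apply_symm_apply, Θ.apply_symm_apply] at h2
    rw [h2]
    exact h1
  · simp only [hη]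
    rw [hlint (fun t => f (pev γ t) ((l t)⁻¹ • g t)) _ measurableSet_Icc, hpre']

lemma exists_uniform_modulus_pev {a b : ℝ} {n : ℕ} (γ : CPath a b n) {ε : ℝ} (hε : 0 < ε) :
    ∃ δ > 0, ∀ s ∈ Set.Icc a b, ∀ t ∈ Set.Icc a b, |s - t| ≤ δ → dist (pev γ s) (pev γ t) ≤ ε := by
  have hu := isCompact_Icc.uniformContinuousOn_of_continuous (continuousOn_pev γ)
  obtain ⟨δ, hδ, h⟩ := Metric.uniformContinuousOn_iff.1 hu ε hε
  refine ⟨δ / 2, by positivity, fun s hs t ht hst => (h s hs t ht ?_).le⟩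
  rw [Real.dist_eq]
  linarith

set_option maxHeartbeats 1000000 in
lemma IsTonelli.exists_lipschitz_approx {n : ℕ} {L : Eu n → Eu n → ℝ}
    {D : Eu n → Eu n → Eu n →L[ℝ] ℝ} {c : ℝ} (H : IsTonelli L D c) {a b : ℝ} (hab : a < b)
    {γ : CPath a b n} (hE : energy L c γ ≠ ⊤) {ε : ℝ} (hε : 0 < ε) :
    ∃ (M : ℝ) (η : CPath a b n) (g' : ℝ → Eu n), HasVel η g' ∧ (∀ t, ‖g' t‖ ≤ M) ∧
      pev η a = pev γ a ∧ pev η b = pev γ b ∧ dist η γ ≤ ε ∧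
      energy L c η ≤ energy L c γ + ENNReal.ofReal ε := by
  classical
  have hT : 0 < b - a := by linarith
  obtain ⟨g₀, hgm₀, hg₀⟩ := isACC_of_energy_ne_top hE
  -- extend the velocity by zero
  set g : ℝ → Eu n := (Set.Icc a b).indicator g₀ with hgdef
  have hgm : StronglyMeasurable g := hgm₀.indicator measurableSet_Icc
  have hg : HasVel γ g := hg₀.congr <| by
    filter_upwards [ae_restrict_mem measurableSet_Icc] with t ht
    exact (Set.indicator_of_mem ht g₀).symm
  have hgi : Integrable g := (integrable_indicator_iff measurableSet_Icc).2 hg₀.1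
  set G := ∫ t, ‖g t‖ with hG
  have hG0 : 0 ≤ G := integral_nonneg fun t => norm_nonneg _
  obtain ⟨B₀, hB₀, hBL⟩ := exists_norm_bound H.cont ‖γ‖ 0
  set B := B₀ + |c| with hB
  have hB0 : 0 ≤ B := add_nonneg hB₀ (abs_nonneg _)
  have hLB : ∀ t, L (pev γ t) 0 + c ≤ B := fun t =>
    add_le_add ((Real.le_norm_self _).trans (hBL _ 0 (norm_pev_le γ t) (by simp))) (le_abs_self c)
  -- a set of positive measure on which the velocity is bounded
  obtain ⟨k, hk⟩ : ∃ k : ℕ, volume ({t | ‖g t‖ ≤ k} ∩ Set.Ioc a b) ≠ 0 := by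
    by_contra hcon
    push Not at hcon
    have h0 : volume (⋃ k : ℕ, {t | ‖g t‖ ≤ k} ∩ Set.Ioc a b) = 0 := measure_iUnion_null hcon
    have h1 : Set.Ioc a b ⊆ ⋃ k : ℕ, {t | ‖g t‖ ≤ k} ∩ Set.Ioc a b := by
      intro t ht
      obtain ⟨k, hk⟩ := exists_nat_ge ‖g t‖
      exact Set.mem_iUnion.2 ⟨k, hk, ht⟩
    have h2 := measure_mono_null h1 h0
    rw [Real.volume_Ioc, ENNReal.ofReal_eq_zero] at h2
    linarith
  set M₀ : ℝ := (k : ℝ) with hM₀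
  have hM₀0 : 0 ≤ M₀ := Nat.cast_nonneg k
  set S : Set ℝ := {t | ‖g t‖ ≤ M₀} with hS
  have hSm : MeasurableSet S := measurableSet_le hgm.norm.measurable measurable_const
  set χ : ℝ → ℝ := S.indicator 1 with hχ
  have hχi : ∀ s t, IntegrableOn χ (Set.Ioc s t) := fun s t =>
    (integrable_const (1 : ℝ)).indicator hSm
  have hχ0 : ∀ t, 0 ≤ χ t := fun t => Set.indicator_nonneg (fun _ _ => zero_le_one) t
  set σ := ∫ t in Set.Ioc a b, χ t with hσ
  have hσ0 : 0 < σ := by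
    rw [hσ, hχ, integral_indicator_one hSm, measureReal_restrict_apply hSm]
    exact ENNReal.toReal_pos hk (measure_ne_top_of_subset Set.inter_subset_right (by simp))
  obtain ⟨δ, hδ, hmod⟩ := exists_modulus H.cont ‖γ‖ (2 * M₀)
    (show 0 < ε / (2 * (b - a)) by positivity)
  obtain ⟨δ₂, hδ₂, hmod₂⟩ := exists_uniform_modulus_pev γ hε
  obtain ⟨M, hM1, hM2, hM3, hM4, hM5, hM6⟩ : ∃ M : ℝ, 0 < M ∧ 2 * M₀ ≤ M ∧ G / σ / M ≤ 1 / 2 ∧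
      2 * M₀ * (G / σ) / M ≤ δ ∧ B * G / M ≤ ε / 2 ∧ G / M ≤ δ₂ := by
    have hev : ∀ x y : ℝ, 0 < y → ∀ᶠ M : ℝ in atTop, x / M ≤ y := fun x y hy =>
      (tendsto_const_nhds.div_atTop tendsto_id).eventually_le_const hy
    exact ((eventually_gt_atTop (0 : ℝ)).and ((eventually_ge_atTop _).and
      ((hev _ _ (by norm_num)).and ((hev _ _ hδ).and ((hev _ _ (by positivity)).and
        (hev _ _ hδ₂)))))).exists
  set u : ℝ → ℝ := fun t => max (‖g t‖ / M - 1) 0 with hu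
  have hu0 : ∀ t, 0 ≤ u t := fun t => le_max_right _ _
  have hule : ∀ t, u t ≤ ‖g t‖ / M := fun t =>
    max_le (by linarith) (by positivity)
  have hum : Measurable u := ((hgm.norm.measurable.div_const M).sub_const 1).max measurable_const
  have hui : Integrable u := (hgi.norm.div_const M).mono' hum.aestronglyMeasurable
    (Eventually.of_forall fun t => by rw [Real.norm_of_nonneg (hu0 t)]; exact hule t)
  set e := ∫ t in Set.Ioc a b, u t with he
  have he0 : 0 ≤ e := integral_nonneg hu0
  have heG : e ≤ G / M := by
    rw [hG, ← integral_div]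
    exact (setIntegral_le_integral hui (Eventually.of_forall hu0)).trans
      (integral_mono hui (hgi.norm.div_const M) hule)
  set θ := e / σ with hθ
  have hθ0 : 0 ≤ θ := by positivity
  have hθle : θ ≤ G / σ / M := by
    rw [hθ, div_right_comm]
    gcongr
  have hθσ : θ * σ = e := div_mul_cancel₀ _ hσ0.ne'
  set l : ℝ → ℝ := fun t => 1 + u t - θ * χ t with hl
  have lfast : ∀ t, M < ‖g t‖ → l t = ‖g t‖ / M := by
    intro t ht
    have h1 : t ∉ S := by
      simp only [hS, Set.mem_ofPred_eq, not_le]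
      linarith
    have h2 : 1 ≤ ‖g t‖ / M := (one_le_div hM1).2 ht.le
    simp only [hl, hu, hχ, Set.indicator_of_notMem h1, max_eq_left (sub_nonneg.2 h2)]
    ring
  have lslow : ∀ t, ‖g t‖ ≤ M₀ → l t = 1 - θ := by
    intro t ht
    have h2 : ‖g t‖ / M ≤ 1 := (div_le_one hM1).2 (by linarith)
    simp only [hl, hu, hχ, Set.indicator_of_mem (show t ∈ S from ht),
      max_eq_right (sub_nonpos.2 h2), Pi.one_apply]
    ring
  have lmid : ∀ t, M₀ < ‖g t‖ → ‖g t‖ ≤ M → l t = 1 := by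
    intro t ht ht'
    have h1 : t ∉ S := by simpa [hS] using ht
    have h2 : ‖g t‖ / M ≤ 1 := (div_le_one hM1).2 ht'
    simp only [hl, hu, hχ, Set.indicator_of_notMem h1, max_eq_right (sub_nonpos.2 h2)]
    ring
  have hcases : ∀ t, (M < ‖g t‖ ∧ l t = ‖g t‖ / M) ∨ (‖g t‖ ≤ M₀ ∧ l t = 1 - θ) ∨
      (‖g t‖ ≤ M ∧ l t = 1) := by
    intro t
    rcases lt_or_ge M ‖g t‖ with h1 | h1
    · exact Or.inl ⟨h1, lfast t h1⟩
    · rcases lt_or_ge M₀ ‖g t‖ with h2 | h2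
      · exact Or.inr (Or.inr ⟨h1, lmid t h2 h1⟩)
      · exact Or.inr (Or.inl ⟨h2, lslow t h2⟩)
  have hlm : Measurable l := (measurable_const.add hum).sub
    ((measurable_const.indicator hSm).const_mul θ)
  have hlh : ∀ t, 1 / 2 ≤ l t := by
    intro t
    have : χ t ≤ 1 := Set.indicator_le_self' (fun _ _ => zero_le_one) t
    simp only [hl]
    nlinarith [hu0 t]
  have hlon : ∀ s t, IntegrableOn l (Set.Ioc s t) := fun s t =>
    ((integrable_const (1 : ℝ)).add hui.integrableOn).sub ((hχi s t).const_mul θ)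
  have hli : ∀ s t, IntervalIntegrable l volume s t := fun s t => ⟨hlon s t, hlon t s⟩
  have hlint : ∀ s t, s ≤ t → ∫ τ in s..t, l τ =
      (t - s) + (∫ τ in Set.Ioc s t, u τ) - θ * ∫ τ in Set.Ioc s t, χ τ := by
    intro s t hst
    have e1 : ∫ τ in Set.Ioc s t, l τ = (∫ τ in Set.Ioc s t, (1 + u τ)) -
        ∫ τ in Set.Ioc s t, θ * χ τ := integral_sub
      ((integrable_const (1 : ℝ)).add hui.integrableOn) ((hχi s t).const_mul θ)
    rw [intervalIntegral.integral_of_le hst, e1, integral_const_mul,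
      integral_add (integrable_const (1 : ℝ)) hui.integrableOn]
    simp [Real.volume_real_Ioc_of_le hst]
  obtain ⟨Θ, hΘ, hΘa⟩ := exists_orderIso_integral hlh hli a
  have hΘb : Θ b = b := by
    have h1 := hΘ a b
    rw [hlint a b hab.le, hΘa, ← he, ← hσ, hθσ] at h1
    linarith
  have hΘt : ∀ t ∈ Set.Icc a b, |Θ t - t| ≤ G / M := by
    intro t ht
    have h1 := hΘ a t
    rw [hlint a t ht.1, hΘa] at h1
    have h2 : ∫ τ in Set.Ioc a t, u τ ≤ e := setIntegral_mono_set hui.integrableOn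
      (Eventually.of_forall hu0) (Set.Ioc_subset_Ioc_right ht.2).eventuallyLE
    have h3 : ∫ τ in Set.Ioc a t, χ τ ≤ σ := setIntegral_mono_set (hχi a b)
      (Eventually.of_forall hχ0) (Set.Ioc_subset_Ioc_right ht.2).eventuallyLE
    have h4 : 0 ≤ ∫ τ in Set.Ioc a t, u τ := integral_nonneg hu0
    have h5 : 0 ≤ ∫ τ in Set.Ioc a t, χ τ := integral_nonneg hχ0
    have h6 : θ * ∫ τ in Set.Ioc a t, χ τ ≤ e := by
      rw [← hθσ]
      gcongr
    have h7 : 0 ≤ θ * ∫ τ in Set.Ioc a t, χ τ := by positivity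
    rw [abs_le]
    constructor <;> linarith
  obtain ⟨η, hη, hηγ, hηE⟩ := hg.timeChange hlm hlh hli hΘ hΘa hΘb
  have hl0 : ∀ t, 0 < l t := fun t => by linarith [hlh t]
  have hbound : ∀ t, ‖(l t)⁻¹ • g t‖ ≤ M := by
    intro t
    rw [norm_smul, norm_inv, Real.norm_of_nonneg (hl0 t).le, inv_mul_le_iff₀ (hl0 t)]
    rcases hcases t with ⟨h1, h2⟩ | ⟨h1, h2⟩ | ⟨h1, h2⟩
    · rw [h2, div_mul_cancel₀ _ hM1.ne']
    · nlinarith [hlh t]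
    · rw [h2, one_mul]
      exact h1
  have hsa : Θ.symm a = a := by rw [Θ.symm_apply_eq, hΘa]
  have hsb : Θ.symm b = b := by rw [Θ.symm_apply_eq, hΘb]
  refine ⟨M, η, _, hη, fun t => hbound _, by rw [hηγ, hsa], by rw [hηγ, hsb], ?_, ?_⟩
  · refine (ContinuousMap.dist_le hε.le).2 fun t => ?_
    have hm : Θ.symm t ∈ Set.Icc a b := by
      rw [Set.mem_Icc, Θ.le_symm_apply, Θ.symm_apply_le, hΘa, hΘb]
      exact t.2
    rw [← pev_coe η t, ← pev_coe γ t, hηγ]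
    refine hmod₂ _ hm _ t.2 ?_
    have := hΘt _ hm
    rw [Θ.apply_symm_apply, abs_sub_comm] at this
    exact this.trans hM6
  · rw [hη.energy_eq hab, hg.energy_eq hab, hηE fun x v => ENNReal.ofReal (L x v + c)]
    have hpt : ∀ t, ENNReal.ofReal (l t) * ENNReal.ofReal (L (pev γ t) ((l t)⁻¹ • g t) + c) ≤
        ENNReal.ofReal (L (pev γ t) (g t) + c) +
          ENNReal.ofReal (ε / (2 * (b - a)) + B / M * ‖g t‖) := by
      intro t
      rw [← ENNReal.ofReal_mul (hl0 t).le, ← ENNReal.ofReal_add (H.nonneg _ _) (by positivity)]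
      apply ENNReal.ofReal_le_ofReal
      have hp1 : 0 ≤ ε / (2 * (b - a)) := by positivity
      have hp2 : 0 ≤ B / M * ‖g t‖ := by positivity
      rcases hcases t with ⟨h1, h2⟩ | ⟨h1, h2⟩ | ⟨h1, h2⟩
      · have h3 : 1 ≤ l t := by
          rw [h2]
          exact (one_le_div hM1).2 h1.le
        have h4 := H.slow_le (pev γ t) (g t) h3
        have h5 : (l t - 1) * (L (pev γ t) 0 + c) ≤ ‖g t‖ / M * B :=
          mul_le_mul (by rw [h2]; linarith) (hLB t) (H.nonneg _ _) (by positivity)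
        have h6 : ‖g t‖ / M * B = B / M * ‖g t‖ := by ring
        linarith
      · have hθh : θ ≤ 1 / 2 := hθle.trans hM3
        have hv : ‖(l t)⁻¹ • g t - g t‖ ≤ δ := by
          have e1 : (l t)⁻¹ • g t - g t = (θ / (1 - θ)) • g t := by
            have : (1 - θ) ≠ 0 := by linarith
            have e2 : (l t)⁻¹ = θ / (1 - θ) + 1 := by
              rw [h2]
              field_simp
              ring
            rw [e2, add_smul, one_smul, add_sub_cancel_right]
          rw [e1, norm_smul, Real.norm_of_nonneg (div_nonneg hθ0 (by linarith))]
          have h3 : θ / (1 - θ) ≤ 2 * θ := by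
            rw [div_le_iff₀ (by linarith)]
            nlinarith
          calc θ / (1 - θ) * ‖g t‖ ≤ 2 * θ * M₀ := by gcongr
            _ ≤ 2 * (G / σ / M) * M₀ := by gcongr
            _ = 2 * M₀ * (G / σ) / M := by ring
            _ ≤ δ := hM4
        have hn : ‖(l t)⁻¹ • g t‖ ≤ 2 * M₀ := by
          rw [norm_smul, norm_inv, Real.norm_of_nonneg (hl0 t).le, inv_mul_le_iff₀ (hl0 t)]
          nlinarith [hlh t]
        have h3 := hmod (pev γ t) (pev γ t) ((l t)⁻¹ • g t) (g t) (norm_pev_le γ t)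
          (norm_pev_le γ t) hn (by linarith) (by simpa using hδ.le) hv
        rw [Real.dist_eq] at h3
        have h4 := (abs_lt.1 h3).2
        have h5 : l t ≤ 1 := by rw [h2]; linarith
        have h6 := mul_le_mul_of_nonneg_right h5 (H.nonneg (pev γ t) ((l t)⁻¹ • g t))
        linarith
      · rw [h2, inv_one, one_smul, one_mul]
        linarith
    have hinteg : Integrable (fun t => ε / (2 * (b - a)) + B / M * ‖g t‖)
        (volume.restrict (Set.Icc a b)) :=
      (integrable_const _).add (hgi.norm.integrableOn.const_mul _)
    have hmeas : Measurable fun t => ENNReal.ofReal (ε / (2 * (b - a)) + B / M * ‖g t‖) :=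
      (measurable_const.add (hgm.norm.measurable.const_mul _)).ennreal_ofReal
    refine (lintegral_mono hpt).trans ?_
    rw [lintegral_add_right _ hmeas,
      ← ofReal_integral_eq_lintegral_ofReal hinteg (Eventually.of_forall fun t => by positivity)]
    gcongr
    rw [integral_add (integrable_const _) (hgi.norm.integrableOn.const_mul _), integral_const_mul]
    have h1 : ∫ t in Set.Icc a b, ‖g t‖ ≤ G :=
      setIntegral_le_integral hgi.norm (Eventually.of_forall fun t => norm_nonneg _)
    have h2 : B / M * ∫ t in Set.Icc a b, ‖g t‖ ≤ ε / 2 := by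
      calc _ ≤ B / M * G := by gcongr
        _ = B * G / M := by ring
        _ ≤ ε / 2 := hM5
    have h3 : ∫ _t in Set.Icc a b, ε / (2 * (b - a)) = ε / 2 := by
      simp only [integral_const, MeasurableSet.univ, measureReal_restrict_apply,
        Set.univ_inter, Real.volume_real_Icc_of_le hab.le, smul_eq_mul]
      field_simp
    linarith

lemma hasVel_of_hasDerivAt {a b : ℝ} {n : ℕ} {γ : CPath a b n} {f f' : ℝ → Eu n}
    (hf : ∀ t, HasDerivAt f (f' t) t) (hf' : Continuous f') (h : ∀ t : Set.Icc a b, γ t = f t) :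
    HasVel γ f' := by
  refine ⟨hf'.continuousOn.integrableOn_compact isCompact_Icc, fun s t => ?_⟩
  rw [intervalIntegral.integral_eq_sub_of_hasDerivAt (fun u _ => hf u)
    (hf'.intervalIntegrable _ _), h, h]
  abel

lemma HasVel.add {a b : ℝ} {n : ℕ} {γ γ' : CPath a b n} {g g' : ℝ → Eu n} (h : HasVel γ g)
    (h' : HasVel γ' g') : HasVel (γ + γ') (fun t => g t + g' t) := by
  refine hasVel_of_le (h.1.add h'.1) fun s t hst => ?_
  have hsub : Set.Ioc (s : ℝ) t ⊆ Set.Icc a b := fun u hu =>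
    ⟨s.2.1.trans hu.1.le, hu.2.trans t.2.2⟩
  rw [integral_add (h.1.mono_set hsub) (h'.1.mono_set hsub), ← h.sub_eq hst, ← h'.sub_eq hst]
  simp only [ContinuousMap.add_apply]
  abel

/-- The affine curve from `p` to `q`. -/
noncomputable def affPath (a b : ℝ) {n : ℕ} (p q : Eu n) : CPath a b n :=
  ⟨fun t => p + (((t : ℝ) - a) / (b - a)) • (q - p), by fun_prop⟩

lemma affPath_apply {a b : ℝ} {n : ℕ} (p q : Eu n) (t : Set.Icc a b) :
    affPath a b p q t = p + (((t : ℝ) - a) / (b - a)) • (q - p) := rfl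

lemma hasVel_affPath {a b : ℝ} {n : ℕ} (p q : Eu n) :
    HasVel (affPath a b p q) (fun _ => (b - a)⁻¹ • (q - p)) := by
  refine hasVel_of_hasDerivAt (f := fun t => p + ((t - a) / (b - a)) • (q - p)) (fun t => ?_)
    continuous_const fun t => rfl
  have h1 : HasDerivAt (fun t : ℝ => (t - a) / (b - a)) (1 / (b - a)) t :=
    ((hasDerivAt_id t).sub_const a).div_const _
  rw [one_div] at h1
  exact (h1.smul_const (q - p)).const_add p

lemma pev_affPath_left {a b : ℝ} (hab : a < b) {n : ℕ} (p q : Eu n) :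
    pev (affPath a b p q) a = p := by
  rw [pev_of_mem _ (Set.left_mem_Icc.2 hab.le), affPath_apply]
  simp

lemma pev_affPath_right {a b : ℝ} (hab : a < b) {n : ℕ} (p q : Eu n) :
    pev (affPath a b p q) b = q := by
  rw [pev_of_mem _ (Set.right_mem_Icc.2 hab.le), affPath_apply, div_self (by linarith), one_smul]
  abel

lemma norm_affPath_le {a b : ℝ} (hab : a < b) {n : ℕ} {p q : Eu n} {R : ℝ} (hp : ‖p‖ ≤ R)
    (hq : ‖q‖ ≤ R) : ‖affPath a b p q‖ ≤ R := by
  refine (ContinuousMap.norm_le _ ((norm_nonneg p).trans hp)).2 fun t => ?_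
  have h0 : 0 ≤ ((t : ℝ) - a) / (b - a) := div_nonneg (by linarith [t.2.1]) (by linarith)
  have h1 : ((t : ℝ) - a) / (b - a) ≤ 1 := (div_le_one (by linarith)).2 (by linarith [t.2.2])
  have := (convex_closedBall (0 : Eu n) R).add_smul_sub_mem (by simpa using hp) (by simpa using hq)
    ⟨h0, h1⟩
  simpa [affPath_apply] using this

lemma pev_add {a b : ℝ} {n : ℕ} (γ γ' : CPath a b n) (t : ℝ) :
    pev (γ + γ') t = pev γ t + pev γ' t := by
  by_cases ht : t ∈ Set.Icc a b
  · rw [pev_of_mem _ ht, pev_of_mem _ ht, pev_of_mem _ ht, ContinuousMap.add_apply]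
  · simp only [pev, dif_neg ht, add_zero]

lemma IsTonelli.exists_energy_affPath_le {n : ℕ} {L : Eu n → Eu n → ℝ}
    {D : Eu n → Eu n → Eu n →L[ℝ] ℝ} {c : ℝ} (H : IsTonelli L D c) {a b : ℝ} (hab : a < b)
    (R : ℝ) : ∃ C : ℝ≥0, ∀ p q : Eu n, ‖p‖ ≤ R → ‖q‖ ≤ R → energy L c (affPath a b p q) ≤ C := by
  obtain ⟨B, hB0, hB⟩ := exists_norm_bound H.cont R ((b - a)⁻¹ * (2 * R))
  have hfin : ENNReal.ofReal (B + c) * ENNReal.ofReal (b - a) ≠ ⊤ :=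
    ENNReal.mul_ne_top ENNReal.ofReal_ne_top ENNReal.ofReal_ne_top
  refine ⟨(_ : ℝ≥0∞).toNNReal, fun p q hp hq => le_of_le_of_eq ?_ (ENNReal.coe_toNNReal hfin).symm⟩
  rw [(hasVel_affPath p q).energy_eq hab]
  have : ∀ t, ENNReal.ofReal (L (pev (affPath a b p q) t) ((b - a)⁻¹ • (q - p)) + c) ≤
      ENNReal.ofReal (B + c) := by
    intro t
    apply ENNReal.ofReal_le_ofReal
    gcongr
    refine (Real.le_norm_self _).trans
      (hB _ _ ((norm_pev_le _ t).trans (norm_affPath_le hab hp hq)) ?_)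
    rw [norm_smul, norm_inv, Real.norm_of_nonneg (by linarith)]
    have hs : 0 < b - a := by linarith
    have := norm_sub_le q p
    gcongr
    linarith
  refine (lintegral_mono this).trans_eq ?_
  simp

lemma IsTonelli.exists_perturbation {n : ℕ} {L : Eu n → Eu n → ℝ}
    {D : Eu n → Eu n → Eu n →L[ℝ] ℝ} {c : ℝ} (H : IsTonelli L D c) {a b : ℝ} (hab : a < b)
    (R M : ℝ) {ε : ℝ} (hε : 0 < ε) : ∃ δ > 0, ∀ (γ : CPath a b n) (g : ℝ → Eu n), HasVel γ g →
      (∀ t, ‖g t‖ ≤ M) → ‖γ‖ ≤ R → ∀ p q : Eu n, ‖p - pev γ a‖ ≤ δ → ‖q - pev γ b‖ ≤ δ →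
      ∃ η : CPath a b n, IsACC η ∧ pev η a = p ∧ pev η b = q ∧ dist η γ ≤ ε ∧
        energy L c η ≤ energy L c γ + ENNReal.ofReal ε := by
  have hT : 0 < b - a := by linarith
  obtain ⟨δ', hδ', hmod⟩ := exists_modulus H.cont (R + 1) (M + 1)
    (show 0 < ε / (b - a) by positivity)
  set δ := min (min δ' 1) (min ε ((b - a) / 2 * min δ' 1)) with hδ
  have hd1 : δ ≤ δ' := (min_le_left _ _).trans (min_le_left _ _)
  have hd2 : δ ≤ 1 := (min_le_left _ _).trans (min_le_right _ _)
  have hd3 : δ ≤ ε := (min_le_right _ _).trans (min_le_left _ _)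
  have hd4 : δ ≤ (b - a) / 2 * min δ' 1 := (min_le_right _ _).trans (min_le_right _ _)
  refine ⟨δ, by positivity, fun γ g hg hM hR p q hp hq => ?_⟩
  set σ := affPath a b (p - pev γ a) (q - pev γ b) with hσ
  have hσn : ‖σ‖ ≤ δ := norm_affPath_le hab hp hq
  set w := (b - a)⁻¹ • (q - pev γ b - (p - pev γ a)) with hw
  have hwn : ‖w‖ ≤ min δ' 1 := by
    rw [hw, norm_smul, norm_inv, Real.norm_of_nonneg hT.le, inv_mul_le_iff₀ hT]
    have := norm_sub_le (q - pev γ b) (p - pev γ a)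
    linarith
  have hη : HasVel (γ + σ) (fun t => g t + w) := hg.add (hasVel_affPath _ _)
  refine ⟨γ + σ, hη.isACC, ?_, ?_, ?_, ?_⟩
  · rw [pev_add, pev_affPath_left hab, add_sub_cancel]
  · rw [pev_add, pev_affPath_right hab, add_sub_cancel]
  · rw [dist_eq_norm, add_sub_cancel_left]
    exact hσn.trans hd3
  · rw [hη.energy_eq hab, hg.energy_eq hab]
    have hpt : ∀ t, ENNReal.ofReal (L (pev (γ + σ) t) (g t + w) + c) ≤
        ENNReal.ofReal (L (pev γ t) (g t) + c) + ENNReal.ofReal (ε / (b - a)) := by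
      intro t
      rw [← ENNReal.ofReal_add (H.nonneg _ _) (by positivity)]
      apply ENNReal.ofReal_le_ofReal
      have hst := norm_pev_le σ t
      have h1 := hmod (pev (γ + σ) t) (pev γ t) (g t + w) (g t) ?_ ?_ ?_ ?_ ?_ ?_
      · rw [Real.dist_eq] at h1
        linarith [(abs_lt.1 h1).2]
      · rw [pev_add]
        refine (norm_add_le _ _).trans ?_
        linarith [norm_pev_le γ t]
      · linarith [norm_pev_le γ t]
      · refine (norm_add_le _ _).trans ?_
        linarith [hM t, min_le_right δ' 1]
      · linarith [hM t]
      · rw [pev_add, add_sub_cancel_left]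
        linarith
      · rw [add_sub_cancel_left]
        exact hwn.trans (min_le_left _ _)
    refine (lintegral_mono hpt).trans_eq ?_
    rw [lintegral_add_right _ measurable_const]
    simp only [lintegral_const, MeasurableSet.univ, Measure.restrict_apply, Set.univ_inter,
      Real.volume_Icc]
    rw [← ENNReal.ofReal_mul (by positivity), div_mul_cancel₀ _ hT.ne']

lemma exists_isACC_dist_le {a b : ℝ} {n : ℕ} (γ : CPath a b n) {ε : ℝ} (hε : 0 < ε) :
    ∃ η : CPath a b n, IsACC η ∧ dist η γ ≤ ε := by
  have hn : 0 < ε / (n + 1) := by positivity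
  have hp : ∀ i : Fin n, ∃ p : Polynomial ℝ, ∀ t : Set.Icc a b,
      ‖p.eval (t : ℝ) - γ t i‖ ≤ ε / (n + 1) := by
    intro i
    obtain ⟨p, hp⟩ := exists_polynomial_near_of_continuousOn a b (fun t => pev γ t i)
      ((EuclideanSpace.proj (𝕜 := ℝ) i).continuous.comp_continuousOn (continuousOn_pev γ)) _ hn
    refine ⟨p, fun t => ?_⟩
    have := (hp t t.2).le
    rwa [pev_coe] at this
  choose p hp using hp
  have hfd : ∀ t : ℝ, HasDerivAt
      (fun t : ℝ => ∑ i, (p i).eval t • EuclideanSpace.basisFun (Fin n) ℝ i)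
      (∑ i, (p i).derivative.eval t • EuclideanSpace.basisFun (Fin n) ℝ i) t := fun t =>
    HasDerivAt.fun_sum fun i _ => ((p i).hasDerivAt t).smul_const _
  have hcont : ∀ q : Fin n → Polynomial ℝ, Continuous
      (fun t : ℝ => ∑ i, (q i).eval t • EuclideanSpace.basisFun (Fin n) ℝ i) := fun q =>
    continuous_finsetSum _ fun i _ => (q i).continuous.smul continuous_const
  refine ⟨⟨fun t => ∑ i, (p i).eval (t : ℝ) • EuclideanSpace.basisFun (Fin n) ℝ i,
    (hcont p).comp continuous_subtype_val⟩,
    (hasVel_of_hasDerivAt hfd (hcont fun i => (p i).derivative) fun t => rfl).isACC,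
    (ContinuousMap.dist_le hε.le).2 fun t => ?_⟩
  have h1 : γ t = ∑ i, γ t i • EuclideanSpace.basisFun (Fin n) ℝ i := by
    conv_lhs => rw [← (EuclideanSpace.basisFun (Fin n) ℝ).sum_repr (γ t)]
    simp
  rw [dist_eq_norm, h1]
  simp only [ContinuousMap.coe_mk]
  rw [← Finset.sum_sub_distrib]
  calc _ ≤ ∑ i : Fin n, ε / (n + 1) := by
        refine norm_sum_le_of_le _ fun i _ => ?_
        rw [← sub_smul, norm_smul, OrthonormalBasis.norm_eq_one, mul_one]
        exact hp i t
    _ = n * (ε / (n + 1)) := by simp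
    _ ≤ (n + 1) * (ε / (n + 1)) := by gcongr; linarith
    _ = ε := by field_simp

lemma exists_injective_comp_eq {S I T : Type*} [Finite S] [Finite I] (f : S → T) (g : I → T)
    (h : ∀ t, Nat.card {s // f s = t} ≤ Nat.card {i // g i = t}) :
    ∃ e : S → I, Function.Injective e ∧ ∀ s, g (e s) = f s := by
  have h' : ∀ t, Nonempty ({s // f s = t} ↪ {i // g i = t}) := fun t => by
    have := Fintype.ofFinite {s // f s = t}
    have := Fintype.ofFinite {i // g i = t}
    have := h t
    rw [Nat.card_eq_fintype_card, Nat.card_eq_fintype_card] at this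
    exact Function.Embedding.nonempty_of_card_le this
  have emb : ∀ t, {s // f s = t} ↪ {i // g i = t} := fun t => (h' t).some
  have hval : ∀ s, g (emb (f s) ⟨s, rfl⟩) = f s := fun s => (emb (f s) ⟨s, rfl⟩).2
  have hcongr : ∀ s t (hs : f s = t), (emb (f s) ⟨s, rfl⟩ : I) = emb t ⟨s, hs⟩ := by
    rintro s t rfl
    rfl
  refine ⟨fun s => emb (f s) ⟨s, rfl⟩, fun s s' hss => ?_, hval⟩
  have hff : f s = f s' := by
    have := congrArg g hss
    simpa only [hval] using this
  simp only [hcongr s _ hff] at hss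
  exact congrArg Subtype.val ((emb (f s')).injective (Subtype.ext hss))

lemma exists_perm_comp_eq {S I : Type*} [Finite I] {e e' : S → I} (he : Function.Injective e)
    (he' : Function.Injective e') : ∃ σ : Equiv.Perm I, ∀ s, σ (e s) = e' s := by
  classical
  have := Fintype.ofFinite I
  refine ⟨((Equiv.ofInjective e he).symm.trans (Equiv.ofInjective e' he')).extendSubtype,
    fun s => ?_⟩
  rw [Equiv.extendSubtype_apply_of_mem _ _ ⟨s, rfl⟩]
  simp

lemma exists_perm_matching {I T Ta Tb : Type*} [Fintype I] [Fintype T] (ℓa : T → Ta) (ℓb : T → Tb)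
    (k : T → ℕ) (xl : I → Ta) (yl : I → Tb)
    (ha : ∀ s, Nat.card {p : Σ t, Fin (k t) // ℓa p.1 = s} ≤ Nat.card {i // xl i = s})
    (hb : ∀ s, Nat.card {p : Σ t, Fin (k t) // ℓb p.1 = s} ≤ Nat.card {i // yl i = s}) :
    ∃ (σ : Equiv.Perm I) (τ : I → Option T),
      (∀ i t, τ i = some t → ℓa t = xl i ∧ ℓb t = yl (σ i)) ∧
      ∀ t, Nat.card {i // τ i = some t} = k t := by
  classical
  obtain ⟨e, he, hel⟩ := exists_injective_comp_eq (fun p : Σ t, Fin (k t) => ℓa p.1) xl ha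
  obtain ⟨e', he', hel'⟩ := exists_injective_comp_eq (fun p : Σ t, Fin (k t) => ℓb p.1) yl hb
  obtain ⟨σ, hσ⟩ := exists_perm_comp_eq he he'
  have hinv : ∀ i p, Function.partialInv e i = some p ↔ e p = i := fun i p =>
    he.isPartialInv p i
  refine ⟨σ, fun i => (Function.partialInv e i).map Sigma.fst, fun i t hit => ?_, fun t => ?_⟩
  · obtain ⟨p, hp, rfl⟩ := Option.map_eq_some_iff.1 hit
    rw [hinv] at hp
    subst hp
    rw [hσ, hel, hel']
    exact ⟨rfl, rfl⟩
  · rw [← Nat.card_fin (k t)]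
    refine (Nat.card_congr (Equiv.ofBijective (fun j : Fin (k t) =>
      (⟨e ⟨t, j⟩, ?_⟩ : {i // (Function.partialInv e i).map Sigma.fst = some t})) ⟨?_, ?_⟩)).symm
    · rw [(hinv _ _).2 rfl]
      rfl
    · intro j j' hj
      have := he (congrArg Subtype.val hj)
      simpa using this
    · rintro ⟨i, hi⟩
      obtain ⟨⟨t', j⟩, hp, rfl⟩ := Option.map_eq_some_iff.1 hi
      exact ⟨j, Subtype.ext ((hinv _ _).1 hp)⟩

lemma sum_option_elim {I T M : Type*} [Fintype I] [Fintype T] [AddCommMonoid M] (τ : I → Option T)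
    (f : T → M) :
    ∑ i, (τ i).elim 0 f = ∑ t, Nat.card {i // τ i = some t} • f t := by
  classical
  have h : ∀ o : Option T, o.elim 0 f = ∑ t, if o = some t then f t else 0 := by
    rintro (_ | t)
    · simp
    · simp
  simp_rw [h]
  rw [Finset.sum_comm]
  refine Finset.sum_congr rfl fun t _ => ?_
  rw [← Finset.sum_filter, Finset.sum_const, Nat.card_eq_fintype_card, Fintype.card_subtype]

lemma exists_mem_mul_le_lintegral {X : Type*} [MeasurableSpace X] (π : Measure X)
    [IsFiniteMeasure π] {A G : Set X} (hA : MeasurableSet A) {F : X → ℝ≥0∞} (hF : Measurable F)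
    (hq : π (A ∩ G) ≠ 0) : ∃ η ∈ A ∩ G, π (A ∩ G) * F η ≤ ∫⁻ x in A, F x ∂π := by
  by_contra! hcon
  set I := ∫⁻ x in A, F x ∂π with hI
  set q := π (A ∩ G) with hqd
  have hq' : q ≠ ⊤ := measure_ne_top _ _
  have hItop : I ≠ ⊤ := by
    obtain ⟨η, hη⟩ := nonempty_of_measure_ne_zero hq
    exact ((hcon η hη).trans_le le_top).ne
  set B := A ∩ {x | I / q < F x} with hB
  have hBm : MeasurableSet B := hA.inter (measurableSet_lt measurable_const hF)
  have hsub : A ∩ G ⊆ B := fun x hx => ⟨hx.1, by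
    have := hcon x hx
    rw [mul_comm] at this
    exact ENNReal.div_lt_of_lt_mul this⟩
  have hqB : q ≤ π B := measure_mono hsub
  have h1 : ∫⁻ x in B, (fun _ => I / q) x ∂π < ∫⁻ x in B, F x ∂π := by
    refine setLIntegral_strict_mono hBm (fun h0 => hq (le_antisymm (h0 ▸ hqB) bot_le)) hF ?_
      (ae_of_all _ fun x hx => hx.2)
    rw [setLIntegral_const]
    exact ENNReal.mul_ne_top (ENNReal.div_ne_top hItop hq) (measure_ne_top _ _)
  rw [setLIntegral_const] at h1
  have h2 : ∫⁻ x in B, F x ∂π ≤ I := lintegral_mono_set Set.inter_subset_left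
  have h3 : I ≤ I / q * π B := by
    calc I = I / q * q := (ENNReal.div_mul_cancel hq hq').symm
      _ ≤ _ := by gcongr
  exact absurd (h1.trans_le h2) (not_lt.2 h3)

/-- The set of indices of the balls `ball (u j) r` to which a point belongs. -/
def ballLabel {X : Type*} [PseudoMetricSpace X] {m : ℕ} (u : Fin m → X) (r : ℝ) (x : X) :
    Fin m → Prop :=
  fun j => x ∈ Metric.ball (u j) r

lemma dist_lt_of_ballLabel_eq {X : Type*} [PseudoMetricSpace X] {m : ℕ} {u : Fin m → X} {r : ℝ}
    {x y : X} (h : ballLabel u r x = ballLabel u r y) (hx : x ∈ ⋃ j, Metric.ball (u j) r) :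
    dist x y < 2 * r := by
  obtain ⟨j, hj⟩ := Set.mem_iUnion.1 hx
  have hy : y ∈ Metric.ball (u j) r := by
    have := congrFun h j
    exact cast this hj
  have := dist_triangle_right x y (u j)
  rw [Metric.mem_ball] at hj hy
  linarith

lemma measurableSet_ballLabel_eq {X : Type*} [PseudoMetricSpace X] [MeasurableSpace X]
    [OpensMeasurableSpace X] {m : ℕ} (u : Fin m → X) (r : ℝ) (v : Fin m → Prop) :
    MeasurableSet {x | ballLabel u r x = v} := by
  have : {x | ballLabel u r x = v} = ⋂ j, {x | x ∈ Metric.ball (u j) r ↔ v j} := by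
    ext x
    simp [ballLabel, funext_iff]
  rw [this]
  refine MeasurableSet.iInter fun j => ?_
  by_cases hv : v j
  · simp only [hv, iff_true]
    exact (Metric.isOpen_ball (x := u j) (ε := r)).measurableSet
  · simp only [hv, iff_false]
    exact (Metric.isOpen_ball (x := u j) (ε := r)).measurableSet.compl

lemma exists_measure_compl_iUnion_ball_le {X : Type*} [PseudoMetricSpace X] [MeasurableSpace X]
    [OpensMeasurableSpace X] [TopologicalSpace.SeparableSpace X] (π : Measure X)
    [IsProbabilityMeasure π] {r ε : ℝ} (hr : 0 < r) (hε : 0 < ε) :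
    ∃ (m : ℕ) (u : Fin m → X), π (⋃ j, Metric.ball (u j) r)ᶜ ≤ ENNReal.ofReal ε := by
  have : Nonempty X := nonempty_of_isProbabilityMeasure π
  set d := TopologicalSpace.denseSeq X
  have hmono : Antitone fun m : ℕ => (⋃ j : Fin m, Metric.ball (d j) r)ᶜ := fun m m' hm =>
    Set.compl_subset_compl.2 (Set.iUnion_subset fun j =>
      Set.subset_iUnion (fun j : Fin m' => Metric.ball (d j) r) (Fin.castLE hm j))
  have hlim := tendsto_measure_iInter_atTop (μ := π)
    (fun m => (MeasurableSet.iUnion fun j : Fin m =>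
      (Metric.isOpen_ball (x := d j) (ε := r)).measurableSet).compl.nullMeasurableSet) hmono
    ⟨0, measure_ne_top _ _⟩
  have hempty : ⋂ m : ℕ, (⋃ j : Fin m, Metric.ball (d j) r)ᶜ = ∅ := by
    refine Set.eq_empty_of_forall_notMem fun x hx => ?_
    obtain ⟨k, hk⟩ := (TopologicalSpace.denseRange_denseSeq X).exists_dist_lt x hr
    exact Set.mem_iInter.1 hx (k + 1) (Set.mem_iUnion.2 ⟨Fin.last k, hk⟩)
  rw [hempty, measure_empty] at hlim
  obtain ⟨m, hm⟩ := ((tendsto_order.1 hlim).2 (ENNReal.ofReal ε) (by simpa)).exists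
  exact ⟨m, fun j => d j, hm.le⟩

lemma card_sigma_fiber {T S : Type*} [Fintype T] [DecidableEq S] (k : T → ℕ) (ℓ : T → S) (s : S) :
    Nat.card {p : Σ t, Fin (k t) // ℓ p.1 = s} = ∑ t, if ℓ t = s then k t else 0 := by
  classical
  rw [Nat.card_eq_fintype_card, Fintype.card_subtype, Finset.card_filter, Fintype.sum_sigma]
  refine Finset.sum_congr rfl fun t _ => ?_
  split_ifs <;> simp

/-- Mass of the labels: the sum of the masses of disjoint measurable cells. -/
lemma sum_measureReal_fiber {X T : Type*} [MeasurableSpace X] [Fintype T] (π : Measure X)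
    [IsFiniteMeasure π] {f : X → T} (hf : ∀ t, MeasurableSet (f ⁻¹' {t})) (p : T → Prop)
    [DecidablePred p] :
    ∑ t, (if p t then π.real (f ⁻¹' {t}) else 0) = π.real {x | p (f x)} := by
  rw [← Finset.sum_filter, ← measureReal_biUnion_finset]
  · congr 1
    ext x
    simp
  · intro t _ t' _ h
    exact Disjoint.preimage _ (by simpa using h)
  · exact fun t _ => hf t

lemma iUnion_fiber {X T : Type*} (f : X → T) : ⋃ t, f ⁻¹' {t} = Set.univ := by
  ext x
  simp

lemma sum_setIntegral_fiber {X T : Type*} [MeasurableSpace X] [Fintype T] (π : Measure X)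
    {f : X → T} (hf : ∀ t, MeasurableSet (f ⁻¹' {t})) {φ : X → ℝ} (hφ : Integrable φ π) :
    ∑ t, ∫ x in f ⁻¹' {t}, φ x ∂π = ∫ x, φ x ∂π := by
  rw [← integral_iUnion_fintype hf (pairwise_disjoint_fiber f) fun _ => hφ.integrableOn,
    iUnion_fiber, setIntegral_univ]

lemma sum_setLIntegral_fiber {X T : Type*} [MeasurableSpace X] [Fintype T] (π : Measure X)
    {f : X → T} (hf : ∀ t, MeasurableSet (f ⁻¹' {t})) (F : X → ℝ≥0∞) :
    ∑ t, ∫⁻ x in f ⁻¹' {t}, F x ∂π = ∫⁻ x, F x ∂π := by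
  rw [← tsum_fintype (L := .unconditional T), ← lintegral_iUnion hf (pairwise_disjoint_fiber f),
    iUnion_fiber, setLIntegral_univ]

theorem exists_quantization {X : Type*} {Ta Tb : Type} [PseudoMetricSpace X] [MeasurableSpace X]
    [BorelSpace X] [TopologicalSpace.SeparableSpace X] [Fintype Ta] [Fintype Tb] (π : Measure X)
    [IsProbabilityMeasure π] {ℓa : X → Ta} {ℓb : X → Tb} (hℓa : ∀ s, MeasurableSet (ℓa ⁻¹' {s}))
    (hℓb : ∀ s, MeasurableSet (ℓb ⁻¹' {s})) {F : X → ℝ≥0∞} (hF : Measurable F) {G : Set X}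
    {ε : ℝ} (hε0 : 0 < ε) (hε1 : ε < 1) (hG : 1 - ε ≤ π.real G) :
    ∃ N₀ : ℕ, ∀ N ≥ N₀, ∀ (xl : Fin N → Ta) (yl : Fin N → Tb),
      (∀ s, (1 - ε) * π.real (ℓa ⁻¹' {s}) * N ≤ Nat.card {i // xl i = s}) →
      (∀ s, (1 - ε) * π.real (ℓb ⁻¹' {s}) * N ≤ Nat.card {i // yl i = s}) →
      ∃ (σ : Equiv.Perm (Fin N)) (h : Fin N → Option X),
        (∀ i η, h i = some η → η ∈ G ∧ ℓa η = xl i ∧ ℓb η = yl (σ i)) ∧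
        (Nat.card {i // h i = none} : ℝ) ≤ 4 * ε * N ∧
        ∑ i, (h i).elim 0 F ≤ N * ∫⁻ x, F x ∂π ∧
        ∀ φ : X → ℝ, (∀ x, |φ x| ≤ 1) → LipschitzWith 1 φ →
          |∑ i, (h i).elim 0 φ - N * ∫ x, φ x ∂π| ≤ 6 * ε * N := by
  classical
  have hX : Nonempty X := nonempty_of_isProbabilityMeasure π
  obtain ⟨m, u, hu⟩ := exists_measure_compl_iUnion_ball_le π hε0 hε0
  set U := ⋃ j, Metric.ball (u j) ε with hU
  have hUm : MeasurableSet U := MeasurableSet.iUnion fun j =>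
    (Metric.isOpen_ball (x := u j) (ε := ε)).measurableSet
  set f : X → (Ta × Tb) × (Fin m → Prop) := fun x => ((ℓa x, ℓb x), ballLabel u ε x) with hf
  have hfm : ∀ t, MeasurableSet (f ⁻¹' {t}) := by
    rintro ⟨⟨s, s'⟩, v⟩
    have : f ⁻¹' {((s, s'), v)} = (ℓa ⁻¹' {s} ∩ ℓb ⁻¹' {s'}) ∩ {x | ballLabel u ε x = v} := by
      ext x
      simp [hf]
    rw [this]
    exact ((hℓa s).inter (hℓb s')).inter (measurableSet_ballLabel_eq u ε v)
  set ν := π.restrict (G ∩ U) with hν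
  have hνA : ∀ t, ν (f ⁻¹' {t}) = π (f ⁻¹' {t} ∩ (G ∩ U)) := fun t =>
    Measure.restrict_apply (hfm t)
  have hνle : ∀ s, ν.real s ≤ π.real s := fun s =>
    ENNReal.toReal_mono (measure_ne_top _ _) (Measure.restrict_apply_le _ _)
  have hνtot : ∑ t, ν.real (f ⁻¹' {t}) ≥ 1 - 2 * ε := by
    have h1 := sum_measureReal_fiber ν hfm fun _ => True
    simp only [if_true, Set.ofPred_true] at h1
    rw [h1]
    have h2 : ν.real Set.univ = π.real (G ∩ U) := by simp [hν, measureReal_def]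
    have h3 := measureReal_inter_add_sdiff (μ := π) (s := G) hUm
    have h4 : π.real (G \ U) ≤ ε := by
      refine (measureReal_mono (s₁ := G \ U) (s₂ := Uᶜ) fun x hx => hx.2).trans ?_
      exact ENNReal.toReal_le_of_le_ofReal hε0.le hu
    linarith
  have hrep : ∀ t, ∃ η, ν (f ⁻¹' {t}) ≠ 0 → η ∈ f ⁻¹' {t} ∩ (G ∩ U) ∧
      ν (f ⁻¹' {t}) * F η ≤ ∫⁻ x in f ⁻¹' {t}, F x ∂π := by
    intro t
    by_cases ht : ν (f ⁻¹' {t}) = 0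
    · exact ⟨hX.some, fun h => absurd ht h⟩
    · rw [hνA] at ht ⊢
      obtain ⟨η, h1, h2⟩ := exists_mem_mul_le_lintegral π (hfm t) hF ht
      exact ⟨η, fun _ => ⟨h1, h2⟩⟩
  choose r hr using hrep
  obtain ⟨N₀, hN₀⟩ := exists_nat_ge (Fintype.card ((Ta × Tb) × (Fin m → Prop)) / ε)
  refine ⟨N₀, fun N hN xl yl hxl hyl => ?_⟩
  have hcard : Fintype.card ((Ta × Tb) × (Fin m → Prop)) ≤ ε * N := by
    rw [div_le_iff₀ hε0] at hN₀
    have : (N₀ : ℝ) ≤ N := by exact_mod_cast hN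
    nlinarith
  set k : (Ta × Tb) × (Fin m → Prop) → ℕ := fun t => ⌊(1 - ε) * ν.real (f ⁻¹' {t}) * N⌋₊ with hk
  have hknn : ∀ t, 0 ≤ (1 - ε) * ν.real (f ⁻¹' {t}) * N := fun t => by
    have : 0 ≤ 1 - ε := by linarith
    positivity
  have hkle : ∀ t, (k t : ℝ) ≤ (1 - ε) * ν.real (f ⁻¹' {t}) * N := fun t => Nat.floor_le (hknn t)
  have hkle' : ∀ t, (k t : ℝ) ≤ ν.real (f ⁻¹' {t}) * N := fun t => (hkle t).trans (by
    have : 0 ≤ ν.real (f ⁻¹' {t}) * N := by positivity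
    nlinarith)
  have hkge : ∀ t, (1 - ε) * ν.real (f ⁻¹' {t}) * N - 1 ≤ k t := fun t =>
    (Nat.sub_one_lt_floor _).le
  have hksum : (1 - 4 * ε) * N ≤ ∑ t, (k t : ℝ) := by
    have h1 := Finset.sum_le_sum fun t (_ : t ∈ Finset.univ) => hkge t
    rw [Finset.sum_sub_distrib, ← Finset.sum_mul, ← Finset.mul_sum] at h1
    simp only [Finset.sum_const, Finset.card_univ, nsmul_eq_mul, mul_one] at h1
    have h2 : (1 - ε) * (1 - 2 * ε) ≤ (1 - ε) * ∑ t, ν.real (f ⁻¹' {t}) := by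
      gcongr
    have h3 := mul_le_mul_of_nonneg_right h2 (Nat.cast_nonneg (α := ℝ) N)
    have h4 : 0 ≤ ε ^ 2 * N := by positivity
    nlinarith
  have hfib : ∀ {S : Type} [DecidableEq S] (ℓ : (Ta × Tb) × (Fin m → Prop) → S) (s : S) (c : ℕ),
      (1 - ε) * π.real {x | ℓ (f x) = s} * N ≤ c →
      Nat.card {p : Σ t, Fin (k t) // ℓ p.1 = s} ≤ c := by
    intro S _ ℓ s c hc
    rw [card_sigma_fiber]
    have : ((∑ t, if ℓ t = s then k t else 0 : ℕ) : ℝ) ≤ c := by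
      push_cast
      refine le_trans ?_ hc
      calc _ ≤ ∑ t, (1 - ε) * (if ℓ t = s then ν.real (f ⁻¹' {t}) else 0) * N := by
            refine Finset.sum_le_sum fun t _ => ?_
            split_ifs
            · exact hkle t
            · simp
        _ = (1 - ε) * ν.real {x | ℓ (f x) = s} * N := by
            rw [← Finset.sum_mul, ← Finset.mul_sum, sum_measureReal_fiber ν hfm fun t => ℓ t = s]
        _ ≤ _ := by
            have : 0 ≤ 1 - ε := by linarith
            gcongr
            exact hνle _
    exact_mod_cast this
  obtain ⟨σ, τ, hτ, hτk⟩ := exists_perm_matching (fun t => t.1.1) (fun t => t.1.2) k xl yl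
    (fun s => hfib (fun t => t.1.1) s _ (hxl s)) (fun s => hfib (fun t => t.1.2) s _ (hyl s))
  have hkpos : ∀ t, k t ≠ 0 → ν (f ⁻¹' {t}) ≠ 0 := by
    intro t ht h0
    apply ht
    simp [hk, measureReal_def, h0]
  have helim : ∀ {M : Type} [AddCommMonoid M] (g : X → M),
      ∑ i, ((τ i).map r).elim 0 g = ∑ t, k t • g (r t) := by
    intro M _ g
    have := sum_option_elim τ fun t => g (r t)
    simp only [hτk] at this
    rw [← this]
    refine Finset.sum_congr rfl fun i _ => ?_
    cases τ i <;> rfl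
  refine ⟨σ, fun i => (τ i).map r, fun i η hi => ?_, ?_, ?_, fun φ hφ1 hφL => ?_⟩
  · obtain ⟨t, ht, rfl⟩ := Option.map_eq_some_iff.1 hi
    have hkt : k t ≠ 0 := by
      rw [← hτk t]
      have : Nonempty {i // τ i = some t} := ⟨i, ht⟩
      exact Nat.card_pos.ne'
    obtain ⟨⟨h1, h2⟩, -⟩ := hr t (hkpos t hkt)
    have h1 : f (r t) = t := h1
    obtain ⟨h3, h4⟩ := hτ i t ht
    rw [← h3, ← h4]
    exact ⟨h2.1, congrArg (fun t => t.1.1) h1, congrArg (fun t => t.1.2) h1⟩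
  · have h1 := helim (fun _ => (1 : ℝ))
    simp only [nsmul_eq_mul, mul_one] at h1
    have h2 : (Nat.card {i // (τ i).map r = none} : ℝ) +
        ∑ i, ((τ i).map r).elim 0 (fun _ => (1 : ℝ)) = N := by
      rw [Nat.card_eq_fintype_card, Fintype.card_subtype, Finset.card_filter]
      push_cast
      rw [← Finset.sum_add_distrib]
      trans ∑ i : Fin N, (1 : ℝ)
      · refine Finset.sum_congr rfl fun i _ => ?_
        cases τ i <;> simp
      · simp
    linarith
  · rw [helim, ← sum_setLIntegral_fiber π hfm F, Finset.mul_sum]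
    refine Finset.sum_le_sum fun t _ => ?_
    by_cases ht : k t = 0
    · simp [ht]
    obtain ⟨-, h1⟩ := hr t (hkpos t ht)
    have h2 : (k t : ℝ≥0∞) ≤ N * ν (f ⁻¹' {t}) := by
      rw [← ENNReal.ofReal_natCast (k t), ← ENNReal.ofReal_natCast N,
        ← ENNReal.ofReal_toReal (measure_ne_top ν (f ⁻¹' {t})),
          ← ENNReal.ofReal_mul (by positivity)]
      exact ENNReal.ofReal_le_ofReal (by rw [mul_comm]; exact hkle' t)
    rw [nsmul_eq_mul]
    calc (k t : ℝ≥0∞) * F (r t) ≤ N * ν (f ⁻¹' {t}) * F (r t) := by gcongr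
      _ ≤ _ := by rw [mul_assoc]; gcongr
  · have hφi : Integrable φ π := Integrable.of_bound
      hφL.continuous.measurable.aestronglyMeasurable 1 (ae_of_all _ fun x => hφ1 x)
    rw [helim, ← sum_setIntegral_fiber π hfm hφi, Finset.mul_sum, ← Finset.sum_sub_distrib]
    have hterm : ∀ t, |k t • φ (r t) - N * ∫ x in f ⁻¹' {t}, φ x ∂π| ≤
        (N * π.real (f ⁻¹' {t}) - k t) + N * (2 * ε * π.real (f ⁻¹' {t})) := by
      intro t
      rw [nsmul_eq_mul]
      have hkN : (k t : ℝ) ≤ N * π.real (f ⁻¹' {t}) := by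
        refine (hkle' t).trans ?_
        rw [mul_comm]
        gcongr
        exact hνle _
      by_cases ht : k t = 0
      · have h1 := norm_setIntegral_le_of_norm_le_const (μ := π) (s := f ⁻¹' {t}) (f := φ) (C := 1)
          (measure_lt_top _ _) (fun x _ => hφ1 x)
        rw [Real.norm_eq_abs, one_mul] at h1
        rw [ht, Nat.cast_zero, zero_mul, zero_sub, abs_neg, abs_mul, Nat.abs_cast, sub_zero]
        have : 0 ≤ N * (2 * ε * π.real (f ⁻¹' {t})) := by positivity
        have := mul_le_mul_of_nonneg_left h1 (Nat.cast_nonneg (α := ℝ) N)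
        linarith
      · obtain ⟨⟨h1, -, h2⟩, -⟩ := hr t (hkpos t ht)
        have h3 : |∫ x in f ⁻¹' {t}, (φ (r t) - φ x) ∂π| ≤ 2 * ε * π.real (f ⁻¹' {t}) := by
          rw [← Real.norm_eq_abs]
          refine norm_setIntegral_le_of_norm_le_const (measure_lt_top _ _) fun x hx => ?_
          rw [← dist_eq_norm]
          refine (hφL.dist_le_mul _ _).trans ?_
          rw [NNReal.coe_one, one_mul]
          refine (dist_lt_of_ballLabel_eq (u := u) (r := ε) ?_ h2).le
          have h1 : f (r t) = t := h1
          have h5 : f x = t := hx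
          exact congrArg Prod.snd (h1.trans h5.symm)
        rw [integral_sub (integrable_const _) hφi.integrableOn, setIntegral_const, smul_eq_mul] at h3
        have h4 : (k t : ℝ) * φ (r t) - N * ∫ x in f ⁻¹' {t}, φ x ∂π =
          -((N * π.real (f ⁻¹' {t}) - k t) * φ (r t)) +
            N * (π.real (f ⁻¹' {t}) * φ (r t) - ∫ x in f ⁻¹' {t}, φ x ∂π) := by ring
        rw [h4]
        refine (abs_add_le _ _).trans (add_le_add ?_ ?_)
        · rw [abs_neg, abs_mul, abs_of_nonneg (sub_nonneg.2 hkN)]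
          exact mul_le_of_le_one_right (sub_nonneg.2 hkN) (hφ1 _)
        · rw [abs_mul, Nat.abs_cast]
          gcongr
    refine (Finset.abs_sum_le_sum_abs _ _).trans ((Finset.sum_le_sum fun t _ => hterm t).trans ?_)
    have h1 := sum_measureReal_fiber π hfm fun _ => True
    simp only [if_true, Set.ofPred_true, probReal_univ] at h1
    rw [Finset.sum_add_distrib, Finset.sum_sub_distrib, ← Finset.mul_sum, ← Finset.mul_sum,
      ← Finset.mul_sum, h1]
    linarith

lemma emp_apply {X : Type*} [MeasurableSpace X] {N : ℕ} (x : Fin N → X) {A : Set X}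
    (hA : MeasurableSet A) : emp N x A = (N : ℝ≥0∞)⁻¹ * Nat.card {i // x i ∈ A} := by
  classical
  rw [emp, Measure.smul_apply, Measure.finsetSum_apply, smul_eq_mul, Nat.card_eq_fintype_card,
    Fintype.card_subtype, Finset.card_filter]
  push_cast
  congr 1
  refine Finset.sum_congr rfl fun i _ => ?_
  rw [Measure.dirac_apply' _ hA, Set.indicator_apply]
  rfl

lemma isProbabilityMeasure_emp {X : Type*} [MeasurableSpace X] {N : ℕ} (hN : N ≠ 0)
    (x : Fin N → X) : IsProbabilityMeasure (emp N x) := by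
  refine ⟨?_⟩
  rw [emp_apply x MeasurableSet.univ]
  simp only [Set.mem_univ, Nat.card_eq_fintype_card, Fintype.card_subtype_true, Fintype.card_fin]
  exact ENNReal.inv_mul_cancel (by exact_mod_cast hN) (ENNReal.natCast_ne_top N)

lemma map_emp {X Y : Type*} [MeasurableSpace X] [MeasurableSpace Y] {N : ℕ} (x : Fin N → X)
    {f : X → Y} (hf : Measurable f) : Measure.map f (emp N x) = emp N fun i => f (x i) := by
  ext A hA
  rw [Measure.map_apply hf hA, emp_apply _ hA, emp_apply _ (hf hA)]
  rfl

lemma emp_comp_perm {X : Type*} [MeasurableSpace X] {N : ℕ} (x : Fin N → X)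
    (σ : Equiv.Perm (Fin N)) : emp N (fun i => x (σ i)) = emp N x := by
  rw [emp, emp, Equiv.sum_comp σ fun i => Measure.dirac (x i)]

lemma lintegral_emp {X : Type*} [MeasurableSpace X] [MeasurableSingletonClass X] {N : ℕ}
    (x : Fin N → X) (F : X → ℝ≥0∞) :
    ∫⁻ z, F z ∂(emp N x) = (N : ℝ≥0∞)⁻¹ * ∑ i, F (x i) := by
  rw [emp, lintegral_smul_measure, lintegral_finsetSum_measure, smul_eq_mul]
  simp only [lintegral_dirac]

lemma integral_emp {X : Type*} [MeasurableSpace X] [MeasurableSingletonClass X] {N : ℕ}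
    (x : Fin N → X) (F : X → ℝ) :
    ∫ z, F z ∂(emp N x) = (N : ℝ)⁻¹ * ∑ i, F (x i) := by
  rw [emp, integral_smul_measure, integral_finsetSum_measure]
  · simp
  · exact fun i _ => integrable_dirac enorm_lt_top

lemma weakLim_emp_of_lipschitz {X : Type*} [PseudoMetricSpace X] [MeasurableSpace X] [BorelSpace X]
    [MeasurableSingletonClass X] {π : Measure X} (hp : IsProbabilityMeasure π)
    {γ : (N : ℕ) → Fin N → X}
    (h : ∀ φ : X → ℝ, (∀ x, |φ x| ≤ 1) → LipschitzWith 1 φ →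
      Tendsto (fun N : ℕ => (N : ℝ)⁻¹ * ∑ i, φ (γ N i)) atTop (𝓝 (∫ x, φ x ∂π))) :
    WeakLim (fun N => emp N (γ N)) π := by
  classical
  have hX : Nonempty X := nonempty_of_isProbabilityMeasure π
  have hs : ∀ N, IsProbabilityMeasure (if N = 0 then π else emp N (γ N)) := by
    intro N
    split_ifs with hN
    · exact hp
    · exact isProbabilityMeasure_emp hN _
  have he : ∀ᶠ N in atTop, (if N = 0 then π else emp N (γ N)) = emp N (γ N) := by
    filter_upwards [eventually_ne_atTop 0] with N hN
    exact if_neg hN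
  have key : Tendsto (β := ProbabilityMeasure X) (fun N => ⟨_, hs N⟩) atTop (𝓝 ⟨π, hp⟩) := by
    refine tendsto_iff_forall_lipschitz_integral_tendsto.2 ?_
    rintro f ⟨C, hC⟩ ⟨K, hK⟩
    obtain ⟨z⟩ := hX
    set S : ℝ := max (max C K) 1 with hS
    have hS0 : 0 < S := lt_of_lt_of_le one_pos (le_max_right _ _)
    have hfc : Continuous f := hK.continuous
    set φ : X → ℝ := fun x => S⁻¹ * (f x - f z) with hφ
    have hφ1 : ∀ x, |φ x| ≤ 1 := fun x => by
      rw [hφ, abs_mul, abs_of_pos (inv_pos.2 hS0), inv_mul_le_iff₀ hS0, mul_one, ← Real.dist_eq]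
      exact (hC x z).trans ((le_max_left _ _).trans (le_max_left _ _))
    have hφL : LipschitzWith 1 φ := LipschitzWith.of_dist_le_mul fun x y => by
      rw [NNReal.coe_one, one_mul, Real.dist_eq, hφ]
      simp only
      rw [← mul_sub, sub_sub_sub_cancel_right, abs_mul, abs_of_pos (inv_pos.2 hS0),
        inv_mul_le_iff₀ hS0, ← Real.dist_eq]
      refine (hK.dist_le_mul x y).trans ?_
      gcongr
      exact (le_max_right _ _).trans (le_max_left _ _)
    have hfφ : ∀ x, f x = S * φ x + f z := fun x => by
      simp only [hφ]
      field_simp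
      ring
    have hinteg : ∀ ν : Measure X, IsProbabilityMeasure ν →
        ∫ x, f x ∂ν = S * ∫ x, φ x ∂ν + f z := by
      intro ν hν
      refine (integral_congr_ae (ae_of_all ν hfφ)).trans ?_
      rw [integral_add, integral_const_mul]
      · simp
      · exact (Integrable.of_bound hφL.continuous.measurable.aestronglyMeasurable 1
          (ae_of_all _ fun x => hφ1 x)).const_mul S
      · exact integrable_const _
    simp only [ProbabilityMeasure.coe_mk]
    rw [hinteg π hp]
    simp_rw [fun N => hinteg _ (hs N)]
    refine ((h φ hφ1 hφL).congr' ?_ |>.const_mul S).add_const _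
    filter_upwards [he] with N hN
    rw [hN, integral_emp]
  intro φ
  have := ProbabilityMeasure.tendsto_iff_forall_integral_tendsto.1 key φ
  refine this.congr' ?_
  filter_upwards [he] with N hN
  simp only [ProbabilityMeasure.coe_mk, hN]

lemma measure_frontier_ballLabel {n : ℕ} (hn : 1 ≤ n) {μ : Measure (Eu n)} (hμ : μ ≪ volume)
    {m : ℕ} (u : Fin m → Eu n) (r : ℝ) (v : Fin m → Prop) :
    μ (frontier {p | ballLabel u r p = v}) = 0 := by
  have : Nonempty (Fin n) := ⟨⟨0, hn⟩⟩
  have hsub : frontier {p | ballLabel u r p = v} ⊆ ⋃ j, Metric.sphere (u j) r := by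
    intro p hp
    by_contra hcon
    simp only [Set.mem_iUnion, not_exists] at hcon
    have hev : ∀ᶠ q in 𝓝 p, ballLabel u r q = ballLabel u r p := by
      have : ∀ j, ∀ᶠ q in 𝓝 p, ballLabel u r q j = ballLabel u r p j := by
        intro j
        rcases lt_trichotomy (dist p (u j)) r with h | h | h
        · filter_upwards [Metric.isOpen_ball.mem_nhds h] with q hq
          simp only [ballLabel, Metric.mem_ball] at hq ⊢
          simp [hq, h]
        · exact absurd h (hcon j)
        · filter_upwards [(isOpen_lt continuous_const
            (continuous_id.dist continuous_const)).mem_nhds h] with q hq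
          have hq : r < dist q (u j) := hq
          simp [ballLabel, not_lt.2 hq.le, not_lt.2 h.le]
      filter_upwards [eventually_all.2 this] with q hq
      exact funext hq
    by_cases hv : ballLabel u r p = v
    · refine hp.2 (mem_interior_iff_mem_nhds.2 ?_)
      filter_upwards [hev] with q hq
      exact hq.trans hv
    · obtain ⟨q, hq1, hq2⟩ := ((mem_closure_iff_frequently.1 hp.1).and_eventually hev).exists
      exact hv (hq2.symm.trans hq1)
  refine measure_mono_null hsub (hμ ?_)
  exact measure_iUnion_null fun j => Measure.addHaar_sphere _ _ _

lemma eventually_le_card_ballLabel {n : ℕ} (hn : 1 ≤ n) {μ : Measure (Eu n)}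
    [IsProbabilityMeasure μ] (hμ : μ ≪ volume) {x : (N : ℕ) → Fin N → Eu n}
    (hx : WeakLim (fun N => emp N (x N)) μ) {m : ℕ} (u : Fin m → Eu n) (r : ℝ) {ε : ℝ}
    (hε : 0 < ε) : ∀ᶠ N in atTop, ∀ v : Fin m → Prop,
      (1 - ε) * μ.real {p | ballLabel u r p = v} * N ≤ Nat.card {i // ballLabel u r (x N i) = v} := by
  rw [eventually_all]
  intro v
  set A := {p | ballLabel u r p = v} with hA
  have hAm : MeasurableSet A := measurableSet_ballLabel_eq u r v
  obtain ⟨πs, hπ, he, hw⟩ := hx.exists_eventuallyEq (by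
    filter_upwards [eventually_ne_atTop 0] with N hN
    exact isProbabilityMeasure_emp hN _) ‹_›
  have h1 := ProbabilityMeasure.tendsto_measure_of_null_frontier_of_tendsto'
    (hw.tendsto_probabilityMeasure hπ ‹_›) (E := A) (measure_frontier_ballLabel hn hμ u r v)
  simp only [ProbabilityMeasure.coe_mk] at h1
  have h2 := (ENNReal.tendsto_toReal (measure_ne_top μ A)).comp h1
  rcases eq_or_lt_of_le (measureReal_nonneg (μ := μ) (s := A)) with h0 | h0
  · filter_upwards with N
    rw [← h0]
    simp
  have h3 : (1 - ε) * μ.real A < (μ A).toReal := by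
    change _ < μ.real A
    nlinarith
  filter_upwards [h2.eventually_const_lt h3, he, eventually_gt_atTop 0] with N hN heN hN0
  have hN0' : (0 : ℝ) < N := by exact_mod_cast hN0
  simp only [Function.comp_apply, heN, emp_apply _ hAm] at hN
  rw [ENNReal.toReal_mul, ENNReal.toReal_inv, ENNReal.toReal_natCast, ENNReal.toReal_natCast,
    lt_inv_mul_iff₀ hN0', mul_comm] at hN
  exact hN.le

lemma exists_tendsto_atTop_of_forall_eventually {p : ℕ → ℕ → Prop}
    (h : ∀ k, ∀ᶠ N in atTop, p k N) :
    ∃ κ : ℕ → ℕ, Tendsto κ atTop atTop ∧ ∀ᶠ N in atTop, p (κ N) N := by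
  classical
  refine ⟨fun N => Nat.findGreatest (fun k => p k N) N, tendsto_atTop.2 fun k => ?_, ?_⟩
  · filter_upwards [h k, eventually_ge_atTop k] with N h1 h2
    exact Nat.le_findGreatest h2 h1
  · filter_upwards [h 0] with N h0
    exact Nat.findGreatest_spec (P := fun k => p k N) (Nat.zero_le N) h0

lemma abs_sum_sub_le_of_matching {X : Type*} [PseudoMetricSpace X] {N : ℕ} {h : Fin N → Option X}
    {γ : Fin N → X} {ε : ℝ} (hε : 0 ≤ ε) (hd : ∀ i η, h i = some η → dist (γ i) η ≤ ε) {φ : X → ℝ}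
    (hφ1 : ∀ x, |φ x| ≤ 1) (hφL : LipschitzWith 1 φ) :
    |∑ i, φ (γ i) - ∑ i, (h i).elim 0 φ| ≤ ε * N + Nat.card {i // h i = none} := by
  classical
  rw [← Finset.sum_sub_distrib]
  have hterm : ∀ i, |φ (γ i) - (h i).elim 0 φ| ≤ ε + if h i = none then 1 else 0 := by
    intro i
    rcases hi : h i with _ | η
    · simpa using (hφ1 (γ i)).trans (by linarith)
    · have := (hφL.dist_le_mul (γ i) η).trans (by simpa using hd i η hi)
      simpa [Real.dist_eq] using this
  refine (Finset.abs_sum_le_sum_abs _ _).trans ((Finset.sum_le_sum fun i _ => hterm i).trans_eq ?_)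
  rw [Finset.sum_add_distrib, Nat.card_eq_fintype_card, Fintype.card_subtype, Finset.card_filter]
  push_cast
  simp [mul_comm]

lemma eventually_exists_isACC_curves {a b : ℝ} {n : ℕ} {π : Measure (CPath a b n)}
    [IsProbabilityMeasure π] {ε : ℝ} (hε : 0 < ε) :
    ∀ᶠ N : ℕ in atTop, ∃ γ : Fin N → CPath a b n, (∀ i, IsACC (γ i)) ∧
      ∀ φ : CPath a b n → ℝ, (∀ γ, |φ γ| ≤ 1) → LipschitzWith 1 φ →
        |∑ i, φ (γ i) - N * ∫ γ, φ γ ∂π| ≤ ε * N := by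
  set ε' := min (ε / 11) (1 / 2) with hε'
  have hε0 : 0 < ε' := by positivity
  have hε1 : ε' < 1 := (min_le_right _ _).trans_lt (by norm_num)
  have hε2 : 11 * ε' ≤ ε := by linarith [min_le_left (ε / 11) (1 / 2)]
  obtain ⟨N₀, hN₀⟩ := exists_quantization π (ℓa := fun _ => ()) (ℓb := fun _ => ())
    (fun _ => by simp) (fun _ => by simp) (F := fun _ => 0) measurable_const (G := Set.univ) hε0 hε1
    (by simpa using hε0.le)
  filter_upwards [eventually_ge_atTop N₀] with N hN
  have hlab : ∀ s : Unit, (1 - ε') * π.real ((fun _ : CPath a b n => ()) ⁻¹' {s}) * N ≤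
      Nat.card {i : Fin N // (fun _ => ()) i = s} := by
    intro s
    have : 0 ≤ ε' * N := by positivity
    simp
    linarith
  obtain ⟨σ, h, -, hnone, -, hφ⟩ := hN₀ N hN (fun _ => ()) (fun _ => ()) hlab hlab
  have hγ : ∀ i, ∃ γ : CPath a b n, IsACC γ ∧ ∀ η, h i = some η → dist γ η ≤ ε' := by
    intro i
    rcases h i with _ | η
    · exact ⟨affPath a b 0 0, (hasVel_affPath 0 0).isACC, fun η h => by cases h⟩
    · obtain ⟨γ, h1, h2⟩ := exists_isACC_dist_le η hε0
      exact ⟨γ, h1, fun η' h => by cases h; exact h2⟩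
  choose γ hγ1 hγ2 using hγ
  refine ⟨γ, hγ1, fun φ hφ1 hφL => ?_⟩
  have h1 := abs_sum_sub_le_of_matching hε0.le hγ2 hφ1 hφL
  have h2 := hφ φ hφ1 hφL
  have h3 : 11 * ε' * N ≤ ε * N := by gcongr
  have h4 := abs_sub_le (∑ i, φ (γ i)) (∑ i, (h i).elim 0 φ) (N * ∫ γ, φ γ ∂π)
  linarith

lemma IsCompact.exists_fin_cover_balls {X : Type*} [PseudoMetricSpace X] {K : Set X}
    (hK : IsCompact K) {r : ℝ} (hr : 0 < r) :
    ∃ (m : ℕ) (u : Fin m → X), K ⊆ ⋃ j, Metric.ball (u j) r := by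
  obtain ⟨t, -, htf, ht⟩ := hK.finite_cover_balls hr
  have := htf.to_subtype
  obtain ⟨m, ⟨e⟩⟩ := Finite.exists_equiv_fin t
  refine ⟨m, fun j => (e.symm j : X), ht.trans fun p hp => ?_⟩
  obtain ⟨z, hz, hpz⟩ := Set.mem_iUnion₂.1 hp
  exact Set.mem_iUnion.2 ⟨e ⟨z, hz⟩, by simpa using hpz⟩

lemma IsTonelli.exists_measureReal_lipschitz_approx_ge {n : ℕ} {L : Eu n → Eu n → ℝ}
    {D : Eu n → Eu n → Eu n →L[ℝ] ℝ} {c : ℝ} (H : IsTonelli L D c) {a b : ℝ} (hab : a < b)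
    {π : Measure (CPath a b n)} [IsProbabilityMeasure π] (hE : ∫⁻ γ, energy L c γ ∂π ≠ ⊤) {ε : ℝ}
    (hε : 0 < ε) : ∃ M : ℝ, 1 - ε ≤ π.real {γ | ∃ η g, HasVel η g ∧ (∀ t, ‖g t‖ ≤ M) ∧ ‖η‖ ≤ M ∧
      pev η a = pev γ a ∧ pev η b = pev γ b ∧ dist η γ ≤ ε ∧
      energy L c η ≤ energy L c γ + ENNReal.ofReal ε} := by
  set G : ℕ → Set (CPath a b n) := fun M => {γ | ∃ η g, HasVel η g ∧ (∀ t, ‖g t‖ ≤ M) ∧ ‖η‖ ≤ M ∧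
      pev η a = pev γ a ∧ pev η b = pev γ b ∧ dist η γ ≤ ε ∧
      energy L c η ≤ energy L c γ + ENNReal.ofReal ε} with hG
  have hmono : Monotone G := by
    rintro M M' hM γ ⟨η, g, h1, h2, h3, h4⟩
    have hM' : (M : ℝ) ≤ M' := by exact_mod_cast hM
    exact ⟨η, g, h1, fun t => (h2 t).trans hM', h3.trans hM', h4⟩
  have hfull : π (⋃ M, G M) = 1 := by
    have hae : ∀ᵐ γ ∂π, γ ∈ ⋃ M, G M := by
      filter_upwards [ae_lt_top (H.lowerSemicontinuous_energy hab).measurable hE] with γ hγ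
      obtain ⟨M, η, g, h1, h2, h3⟩ := H.exists_lipschitz_approx hab hγ.ne hε
      obtain ⟨k, hk⟩ := exists_nat_ge (max M ‖η‖)
      exact Set.mem_iUnion.2 ⟨k, η, g, h1, fun t => (h2 t).trans ((le_max_left _ _).trans hk),
        (le_max_right _ _).trans hk, h3⟩
    exact (measure_congr (eventuallyEq_univ.2 hae)).trans measure_univ
  have hlim := tendsto_measure_iUnion_atTop (μ := π) hmono
  rw [hfull] at hlim
  have hlim' := (ENNReal.tendsto_toReal ENNReal.one_ne_top).comp hlim
  obtain ⟨M, hM⟩ := (hlim'.eventually_const_lt (u := 1 - ε) (by simpa using hε)).exists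
  exact ⟨M, hM.le⟩

theorem IsTonelli.eventually_exists_recovery {n : ℕ} (hn : 1 ≤ n) {L : Eu n → Eu n → ℝ}
    {D : Eu n → Eu n → Eu n →L[ℝ] ℝ} {c : ℝ} (H : IsTonelli L D c) {a b : ℝ} (hab : a < b)
    {π : Measure (CPath a b n)} [IsProbabilityMeasure π] (hE : ∫⁻ γ, energy L c γ ∂π ≠ ⊤)
    (ha : Measure.map (fun γ => pev γ a) π ≪ volume)
    (hb : Measure.map (fun γ => pev γ b) π ≪ volume)
    {x y : (N : ℕ) → Fin N → Eu n} {K : Set (Eu n)} (hK : IsCompact K)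
    (hxy : ∀ N i, x N i ∈ K ∧ y N i ∈ K)
    (hx : WeakLim (fun N => emp N (x N)) (Measure.map (fun γ => pev γ a) π))
    (hy : WeakLim (fun N => emp N (y N)) (Measure.map (fun γ => pev γ b) π))
    {ε : ℝ} (hε : 0 < ε) :
    ∀ᶠ N : ℕ in atTop, ∃ (γ : Fin N → CPath a b n) (σ : Equiv.Perm (Fin N)),
      (∀ i, IsACC (γ i) ∧ pev (γ i) a = x N i ∧ pev (γ i) b = y N (σ i)) ∧
      ∑ i, energy L c (γ i) ≤ N * (∫⁻ γ, energy L c γ ∂π + ENNReal.ofReal ε) ∧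
      ∀ φ : CPath a b n → ℝ, (∀ γ, |φ γ| ≤ 1) → LipschitzWith 1 φ →
        |∑ i, φ (γ i) - N * ∫ γ, φ γ ∂π| ≤ ε * N := by
  have hpa : IsProbabilityMeasure (Measure.map (fun γ : CPath a b n => pev γ a) π) :=
    Measure.isProbabilityMeasure_map (measurable_pev_left a).aemeasurable
  have hpb : IsProbabilityMeasure (Measure.map (fun γ : CPath a b n => pev γ b) π) :=
    Measure.isProbabilityMeasure_map (measurable_pev_left b).aemeasurable
  obtain ⟨R, hR⟩ := hK.isBounded.exists_norm_le
  obtain ⟨C, hC⟩ := H.exists_energy_affPath_le hab R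
  set ε' := min (ε / (12 + 4 * C)) (1 / 2) with hε'
  have hε0 : 0 < ε' := by positivity
  have hε1 : ε' < 1 := (min_le_right _ _).trans_lt (by norm_num)
  have hε2 : (12 + 4 * C) * ε' ≤ ε := by
    have h1 : 0 < 12 + 4 * (C : ℝ) := by positivity
    calc _ ≤ (12 + 4 * C) * (ε / (12 + 4 * C)) := by gcongr; exact min_le_left _ _
      _ = ε := by field_simp
  have hCε : 0 ≤ 4 * C * ε' := by positivity
  obtain ⟨M, hM⟩ := H.exists_measureReal_lipschitz_approx_ge hab hE hε0
  obtain ⟨δ, hδ, hpert⟩ := H.exists_perturbation hab M M hε0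
  obtain ⟨m, u, hu⟩ := hK.exists_fin_cover_balls (half_pos hδ)
  obtain ⟨N₀, hN₀⟩ := exists_quantization π
    (ℓa := fun γ : CPath a b n => ballLabel u (δ / 2) (pev γ a))
    (ℓb := fun γ : CPath a b n => ballLabel u (δ / 2) (pev γ b))
    (fun s => measurable_pev_left a (measurableSet_ballLabel_eq u (δ / 2) s))
    (fun s => measurable_pev_left b (measurableSet_ballLabel_eq u (δ / 2) s))
    (H.lowerSemicontinuous_energy hab).measurable hε0 hε1 hM
  filter_upwards [eventually_ge_atTop N₀, eventually_le_card_ballLabel hn ha hx u (δ / 2) hε0,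
    eventually_le_card_ballLabel hn hb hy u (δ / 2) hε0] with N hN hNx hNy
  obtain ⟨σ, h, hG, hnone, hF, hφ⟩ := hN₀ N hN (fun i => ballLabel u (δ / 2) (x N i))
    (fun i => ballLabel u (δ / 2) (y N i))
    (fun s => by
      have := hNx s
      rwa [map_measureReal_apply (measurable_pev_left a) (measurableSet_ballLabel_eq _ _ _)] at this)
    (fun s => by
      have := hNy s
      rwa [map_measureReal_apply (measurable_pev_left b) (measurableSet_ballLabel_eq _ _ _)] at this)
  have hγ : ∀ i, ∃ γ : CPath a b n, (IsACC γ ∧ pev γ a = x N i ∧ pev γ b = y N (σ i)) ∧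
      (∀ η, h i = some η → dist γ η ≤ 2 * ε') ∧
      energy L c γ ≤ (h i).elim 0 (energy L c) + (if h i = none then (C : ℝ≥0∞) else 0) +
        ENNReal.ofReal (2 * ε') := by
    intro i
    rcases hi : h i with _ | η
    · refine ⟨affPath a b (x N i) (y N (σ i)), ⟨(hasVel_affPath _ _).isACC, pev_affPath_left hab _ _,
        pev_affPath_right hab _ _⟩, by simp, ?_⟩
      simp only [Option.elim_none, if_true, zero_add]
      exact (hC _ _ (hR _ (hxy N i).1) (hR _ (hxy N _).2)).trans le_self_add
    · obtain ⟨⟨ζ, g, h1, h2, h3, h4, h5, h6, h7⟩, hla, hlb⟩ := hG i η hi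
      have hda : ‖x N i - pev ζ a‖ ≤ δ := by
        rw [h4, ← dist_eq_norm]
        have := dist_lt_of_ballLabel_eq hla.symm (hu (hxy N i).1)
        linarith
      have hdb : ‖y N (σ i) - pev ζ b‖ ≤ δ := by
        rw [h5, ← dist_eq_norm]
        have := dist_lt_of_ballLabel_eq hlb.symm (hu (hxy N (σ i)).2)
        linarith
      obtain ⟨γ, k1, k2, k3, k4, k5⟩ := hpert ζ g h1 h2 h3 _ _ hda hdb
      refine ⟨γ, ⟨k1, k2, k3⟩, fun η' hη' => ?_, ?_⟩
      · cases hη'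
        linarith [dist_triangle γ ζ η]
      · simp only [Option.elim_some, reduceCtorEq, if_false, add_zero]
        rw [two_mul, ENNReal.ofReal_add hε0.le hε0.le, ← add_assoc]
        exact k5.trans (by gcongr)
  choose γ hγ1 hγ2 hγ3 using hγ
  refine ⟨γ, σ, hγ1, ?_, fun φ hφ1 hφL => ?_⟩
  · have hcard : ∑ i, (if h i = none then (C : ℝ≥0∞) else 0) ≤
        ENNReal.ofReal (4 * C * ε') * N := by
      rw [← Finset.sum_filter, Finset.sum_const, ← Fintype.card_subtype, ← Nat.card_eq_fintype_card,
        nsmul_eq_mul, ← ENNReal.ofReal_natCast, ← ENNReal.ofReal_natCast N, ← ENNReal.ofReal_coe_nnreal,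
        ← ENNReal.ofReal_mul (by positivity), ← ENNReal.ofReal_mul (by positivity)]
      apply ENNReal.ofReal_le_ofReal
      have := mul_le_mul_of_nonneg_right hnone C.2
      calc _ ≤ 4 * ε' * N * C := this
        _ = _ := by ring
    calc ∑ i, energy L c (γ i) ≤ ∑ i, ((h i).elim 0 (energy L c) +
          (if h i = none then (C : ℝ≥0∞) else 0) + ENNReal.ofReal (2 * ε')) :=
          Finset.sum_le_sum fun i _ => hγ3 i
      _ ≤ N * ∫⁻ γ, energy L c γ ∂π + ENNReal.ofReal (4 * C * ε') * N +
          N * ENNReal.ofReal (2 * ε') := by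
          rw [Finset.sum_add_distrib, Finset.sum_add_distrib]
          simp only [Finset.sum_const, Finset.card_univ, Fintype.card_fin, nsmul_eq_mul]
          gcongr
      _ = N * (∫⁻ γ, energy L c γ ∂π + ENNReal.ofReal (4 * C * ε' + 2 * ε')) := by
          rw [ENNReal.ofReal_add hCε (by positivity)]
          ring
      _ ≤ _ := by
          gcongr
          linarith
  · have h1 := abs_sum_sub_le_of_matching (by positivity) hγ2 hφ1 hφL
    have h2 := hφ φ hφ1 hφL
    have h3 : 12 * ε' * N ≤ ε * N := by
      gcongr
      linarith
    have h4 := abs_sub_le (∑ i, φ (γ i)) (∑ i, (h i).elim 0 φ) (N * ∫ γ, φ γ ∂π)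
    linarith

lemma weakLim_emp_of_abs_sum_sub_le {X : Type*} [PseudoMetricSpace X] [MeasurableSpace X]
    [BorelSpace X] [MeasurableSingletonClass X] {π : Measure X} (hp : IsProbabilityMeasure π)
    {γ : (N : ℕ) → Fin N → X} {δ : ℕ → ℝ} (hδ : Tendsto δ atTop (𝓝 0))
    (h : ∀ᶠ N : ℕ in atTop, ∀ φ : X → ℝ, (∀ x, |φ x| ≤ 1) → LipschitzWith 1 φ →
      |∑ i, φ (γ N i) - N * ∫ x, φ x ∂π| ≤ δ N * N) :
    WeakLim (fun N => emp N (γ N)) π := by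
  refine weakLim_emp_of_lipschitz hp fun φ hφ1 hφL => ?_
  rw [tendsto_iff_norm_sub_tendsto_zero]
  refine squeeze_zero' (Eventually.of_forall fun _ => norm_nonneg _) ?_ hδ
  filter_upwards [h, eventually_ne_atTop 0] with N hN hN0
  have hN1 : (0 : ℝ) < N := by positivity
  have e : (N : ℝ)⁻¹ * ∑ i, φ (γ N i) - ∫ x, φ x ∂π =
      (N : ℝ)⁻¹ * (∑ i, φ (γ N i) - N * ∫ x, φ x ∂π) := by
    field_simp
  rw [e, Real.norm_eq_abs, abs_mul, abs_of_pos (inv_pos.2 hN1), inv_mul_le_iff₀ hN1]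
  exact (hN φ hφ1 hφL).trans_eq (mul_comm _ _)

lemma exists_seq_of_forall_eventually_exists {X : Type*} {P : X → Prop}
    {Q : (N : ℕ) → (Fin N → X) → ℝ → Prop} (hX : ∃ x, P x)
    (h : ∀ ε : ℝ, 0 < ε → ∀ᶠ N : ℕ in atTop, ∃ γ : Fin N → X, (∀ i, P (γ i)) ∧ Q N γ ε) :
    ∃ (γ : (N : ℕ) → Fin N → X) (δ : ℕ → ℝ), Tendsto δ atTop (𝓝 0) ∧ (∀ N i, P (γ N i)) ∧
      ∀ᶠ N in atTop, Q N (γ N) (δ N) := by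
  obtain ⟨κ, hκ, hev⟩ := exists_tendsto_atTop_of_forall_eventually fun k =>
    h (1 / ((k : ℝ) + 1)) (by positivity)
  have hγ : ∀ N, ∃ γ : Fin N → X, (∀ i, P (γ i)) ∧
      ((∃ γ : Fin N → X, (∀ i, P (γ i)) ∧ Q N γ (1 / ((κ N : ℝ) + 1))) →
        Q N γ (1 / ((κ N : ℝ) + 1))) := by
    intro N
    by_cases hN : ∃ γ : Fin N → X, (∀ i, P (γ i)) ∧ Q N γ (1 / ((κ N : ℝ) + 1))
    · obtain ⟨γ, h1, h2⟩ := hN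
      exact ⟨γ, h1, fun _ => h2⟩
    · obtain ⟨x, hx⟩ := hX
      exact ⟨fun _ => x, fun _ => hx, fun h => absurd h hN⟩
  choose γ h1 h2 using hγ
  exact ⟨γ, fun N => 1 / ((κ N : ℝ) + 1), tendsto_one_div_add_atTop_nhds_zero_nat.comp hκ, h1,
    hev.mono fun N hN => h2 N hN⟩

theorem IsTonelli.exists_recovery {n : ℕ} (hn : 1 ≤ n) {L : Eu n → Eu n → ℝ}
    {D : Eu n → Eu n → Eu n →L[ℝ] ℝ} {c : ℝ} (H : IsTonelli L D c) {a b : ℝ} (hab : a < b)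
    {F : CPath a b n → EReal} {C : ℝ} (hC : 0 ≤ C)
    (hF : ∀ γ, F γ = (energy L c γ : EReal) - (C : EReal))
    {μa μb : Measure (Eu n)} [IsProbabilityMeasure μa] [IsProbabilityMeasure μb]
    (hμa : μa ≪ volume) (hμb : μb ≪ volume)
    {x y : (N : ℕ) → Fin N → Eu n} {K : Set (Eu n)} (hK : IsCompact K)
    (hxy : ∀ N i, x N i ∈ K ∧ y N i ∈ K)
    (hx : WeakLim (fun N => emp N (x N)) μa) (hy : WeakLim (fun N => emp N (y N)) μb)
    (π : Measure (CPath a b n)) [hp : IsProbabilityMeasure π] :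
    ∃ γ : (N : ℕ) → Fin N → CPath a b n,
      (∀ N i, IsACC (γ N i)) ∧
      WeakLim (fun N => emp N (γ N)) π ∧
      Tendsto (fun N => aFun F (emp N (x N)) (emp N (y N)) (emp N (γ N)))
        atTop (𝓝 (aFun F μa μb π)) := by
  have hX : ∃ γ : CPath a b n, IsACC γ := ⟨affPath a b 0 0, (hasVel_affPath 0 0).isACC⟩
  have hlsc := H.lowerSemicontinuous_energy hab
  have hprob : ∀ γ : (N : ℕ) → Fin N → CPath a b n,
      ∀ᶠ N in atTop, IsProbabilityMeasure (emp N (γ N)) := fun γ => by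
    filter_upwards [eventually_ne_atTop 0] with N hN using isProbabilityMeasure_emp hN _
  by_cases htop : aFun F μa μb π = ⊤
  · obtain ⟨γ, δ, hδ, hγ, hφ⟩ := exists_seq_of_forall_eventually_exists hX fun ε hε =>
      eventually_exists_isACC_curves (π := π) hε
    have hw := weakLim_emp_of_abs_sum_sub_le hp hδ hφ
    have hl := aFun_le_liminf hlsc hC hF hx hy (hprob γ) hp hw
    refine ⟨γ, hγ, hw, tendsto_of_le_liminf_of_limsup_le hl ?_⟩
    rw [htop]
    exact le_top
  · obtain ⟨rfl, rfl⟩ : Measure.map (fun γ => pev γ a) π = μa ∧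
        Measure.map (fun γ => pev γ b) π = μb := by
      by_contra hne
      exact htop (if_neg hne)
    have hmint := mint_eq_lintegral_sub π hlsc.measurable hC hF
    have haF : aFun F (Measure.map (fun γ => pev γ a) π) (Measure.map (fun γ => pev γ b) π) π =
        ((∫⁻ γ, energy L c γ ∂π : ℝ≥0∞) : EReal) - (C : EReal) := by
      rw [← hmint]
      exact if_pos ⟨rfl, rfl⟩
    have hE : ∫⁻ γ, energy L c γ ∂π ≠ ⊤ := by
      intro hE
      rw [haF, hE, EReal.coe_ennreal_top, EReal.top_sub_coe] at htop
      exact htop rfl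
    obtain ⟨γ, δ, hδ, hγ, hQ⟩ := exists_seq_of_forall_eventually_exists
      (Q := fun N γ ε => (∃ σ : Equiv.Perm (Fin N),
        ∀ i, pev (γ i) a = x N i ∧ pev (γ i) b = y N (σ i)) ∧
        ∑ i, energy L c (γ i) ≤ N * (∫⁻ γ, energy L c γ ∂π + ENNReal.ofReal ε) ∧
        ∀ φ : CPath a b n → ℝ, (∀ γ, |φ γ| ≤ 1) → LipschitzWith 1 φ →
          |∑ i, φ (γ i) - N * ∫ γ, φ γ ∂π| ≤ ε * N) hX fun ε hε => by
        filter_upwards [H.eventually_exists_recovery hn hab hE hμa hμb hK hxy hx hy hε] with N hN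
        obtain ⟨γ, σ, h1, h2, h3⟩ := hN
        exact ⟨γ, fun i => (h1 i).1, ⟨σ, fun i => (h1 i).2⟩, h2, h3⟩
    have hw := weakLim_emp_of_abs_sum_sub_le hp hδ (hQ.mono fun N h => h.2.2)
    have hl := aFun_le_liminf hlsc hC hF hx hy (hprob γ) hp hw
    refine ⟨γ, hγ, hw, tendsto_of_le_liminf_of_limsup_le hl ?_⟩
    have hlim : Tendsto (fun N => ((∫⁻ γ, energy L c γ ∂π + ENNReal.ofReal (δ N) : ℝ≥0∞) : EReal) -
        (C : EReal)) atTop (𝓝 (((∫⁻ γ, energy L c γ ∂π : ℝ≥0∞) : EReal) - (C : EReal))) := by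
      refine ((continuous_coe_ennreal_sub_coe C).tendsto _).comp ?_
      simpa using (ENNReal.tendsto_ofReal hδ).const_add (∫⁻ γ, energy L c γ ∂π)
    rw [haF, ← hlim.limsup_eq]
    refine limsup_le_limsup ?_
    filter_upwards [hQ, eventually_ne_atTop 0] with N ⟨⟨σ, hσ⟩, hen, _⟩ hN
    have hpN := isProbabilityMeasure_emp hN (γ N)
    have ea : Measure.map (fun γ => pev γ a) (emp N (γ N)) = emp N (x N) := by
      rw [map_emp _ (measurable_pev_left a)]
      simp only [(hσ _).1]
    have eb : Measure.map (fun γ => pev γ b) (emp N (γ N)) = emp N (y N) := by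
      rw [map_emp _ (measurable_pev_left b), ← emp_comp_perm (y N) σ]
      simp only [(hσ _).2]
    rw [aFun, if_pos ⟨ea, eb⟩, mint_eq_lintegral_sub _ hlsc.measurable hC hF, lintegral_emp]
    refine EReal.sub_le_sub (EReal.coe_ennreal_le_coe_ennreal_iff.2 ?_) le_rfl
    rw [ENNReal.inv_mul_le_iff (by exact_mod_cast hN) (ENNReal.natCast_ne_top N)]
    exact hen

/-- **Γ-convergence of many-particle actions (Theorem 3.1).**
The functionals `𝔸_{μ_a^{(N)},μ_b^{(N)}}` Γ-converge to `𝔸_{μ_a,μ_b}` on the space of Borel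
probability measures on `C([a,b];ℝⁿ)` with respect to weak convergence: (i) the liminf
inequality holds along every weakly convergent sequence, and (ii) every `π` admits a
recovery sequence of empirical measures of `N` absolutely continuous curves. -/
theorem gamma_convergence_of_many_particle_actions
    {n : ℕ} (hn : 1 ≤ n) {a b : ℝ} (hab : a < b)
    (L : Eu n → Eu n → ℝ)
    (hL1 : ContDiff ℝ (⊤ : ℕ∞) (Function.uncurry L))
    (hL2 : ∀ K : Set (Eu n), IsCompact K → ∃ c₀ : ℝ, 0 < c₀ ∧
      ∀ x ∈ K, ∀ v w : Eu n, c₀ * ‖w‖ ^ 2 ≤ fderiv ℝ (fderiv ℝ (L x)) v w w)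
    (c₁ c₂ : ℝ) (hc₁ : 0 < c₁) (hc₂ : 0 < c₂)
    (hL3 : ∀ x v : Eu n, c₁ * ‖v‖ - c₂ ≤ L x v)
    (μa μb : Measure (Eu n)) [IsProbabilityMeasure μa] [IsProbabilityMeasure μb]
    (hμaC : ∃ K : Set (Eu n), IsCompact K ∧ μa K = 1)
    (hμbC : ∃ K : Set (Eu n), IsCompact K ∧ μb K = 1)
    (hμaAC : μa ≪ volume) (hμbAC : μb ≪ volume)
    (x y : (N : ℕ) → Fin N → Eu n)
    (hxinj : ∀ N, Function.Injective (x N))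
    (hsupp : ∃ K : Set (Eu n), IsCompact K ∧ ∀ N i, x N i ∈ K ∧ y N i ∈ K)
    (hxw : WeakLim (fun N => emp N (x N)) μa)
    (hyw : WeakLim (fun N => emp N (y N)) μb) :
    (∀ (πs : ℕ → Measure (CPath a b n)) (π : Measure (CPath a b n)),
      (∀ N, IsProbabilityMeasure (πs N)) → IsProbabilityMeasure π → WeakLim πs π →
      aFun (action L a b) μa μb π ≤
        liminf (fun N => aFun (action L a b) (emp N (x N)) (emp N (y N)) (πs N)) atTop) ∧
    (∀ π : Measure (CPath a b n), IsProbabilityMeasure π →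
      ∃ γ : (N : ℕ) → Fin N → CPath a b n,
        (∀ N i, IsACC (γ N i)) ∧
        WeakLim (fun N => emp N (γ N)) π ∧
        Tendsto (fun N => aFun (action L a b) (emp N (x N)) (emp N (y N)) (emp N (γ N)))
          atTop (𝓝 (aFun (action L a b) μa μb π))) := by
  have H := isTonelli_of_contDiff hL1 hL2 hc₁ hL3
  have hC : 0 ≤ c₂ * (b - a) := mul_nonneg hc₂.le (sub_nonneg.2 hab.le)
  have hF := action_eq_energy_sub hab hL1.continuous (c := c₂) fun x v => by
    nlinarith [hL3 x v, mul_nonneg hc₁.le (norm_nonneg v)]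
  obtain ⟨K, hK, hxy⟩ := hsupp
  refine ⟨fun πs π hs hp hw => ?_, fun π hp => ?_⟩
  · exact aFun_le_liminf (H.lowerSemicontinuous_energy hab) hC hF hxw hyw
      (Eventually.of_forall hs) hp hw
  · exact H.exists_recovery hn hab hC hF hμaAC hμbAC hK hxy hxw hyw π
end

section
/- (Compactness, Theorem 3.2.) If (π^{(N)})_{N∈ℕ} is a sequence in 𝒫(C([a,b];ℝⁿ)) such that there is one compact set K ⊆ ℝⁿ with (pr_a#π^{(N)})(K) = 1 for all N, and sup_N 𝔸(π^{(N)}) < ∞, then (π^{(N)}) is relatively compact with respect to weak convergence: every subsequence admits a further subsequence converging weakly to some element of 𝒫(C([a,b];ℝⁿ)). -/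
open MeasureTheory Filter Topology
open scoped ENNReal NNReal

/-- Strong convexity of `f`, evaluated at the midpoint of the segment from `0` to `v`. -/
lemma two_mul_midpoint_add_le {E : Type*} [NormedAddCommGroup E] [NormedSpace ℝ E]
    {f : E → ℝ} (hf : ContDiff ℝ 2 f) {c : ℝ}
    (hc : ∀ v w : E, c * ‖w‖ ^ 2 ≤ fderiv ℝ (fderiv ℝ f) v w w) (v : E) :
    2 * f ((2 : ℝ)⁻¹ • v) + c / 4 * ‖v‖ ^ 2 ≤ f 0 + f v := by
  have hlin (s : ℝ) : HasDerivAt (fun s : ℝ => s • v) v s := by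
    simpa using (hasDerivAt_id s).smul_const v
  have h1 (s : ℝ) : HasDerivAt (fun s : ℝ => f (s • v) - c / 2 * ‖v‖ ^ 2 * s ^ 2)
      (fderiv ℝ f (s • v) v - c * ‖v‖ ^ 2 * s) s := by
    have hd : HasDerivAt (fun s : ℝ => f (s • v)) (fderiv ℝ f (s • v) v) s :=
      ((hf.differentiable (by norm_num)) (s • v)).hasFDerivAt.comp_hasDerivAt s (hlin s)
    exact (hd.fun_sub ((hasDerivAt_pow 2 s).const_mul (c / 2 * ‖v‖ ^ 2))).congr_deriv
      (by push_cast; ring)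
  have hf' : Differentiable ℝ (fderiv ℝ f) :=
    (hf.fderiv_right (m := 1) (by norm_num)).differentiable (by norm_num)
  have h2 (s : ℝ) : HasDerivAt (fun s : ℝ => fderiv ℝ f (s • v) v - c * ‖v‖ ^ 2 * s)
      (fderiv ℝ (fderiv ℝ f) (s • v) v v - c * ‖v‖ ^ 2) s := by
    have hd : HasDerivAt (fun s : ℝ => fderiv ℝ f (s • v))
        (fderiv ℝ (fderiv ℝ f) (s • v) v) s :=
      (hf' (s • v)).hasFDerivAt.comp_hasDerivAt s (hlin s)
    have hd' : HasDerivAt (fun s : ℝ => fderiv ℝ f (s • v) v)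
        (fderiv ℝ (fderiv ℝ f) (s • v) v v) s := by
      simpa using hd.clm_apply (hasDerivAt_const s v)
    exact (hd'.fun_sub ((hasDerivAt_id' s).const_mul (c * ‖v‖ ^ 2))).congr_deriv (by ring)
  have hd1 : deriv (fun s : ℝ => f (s • v) - c / 2 * ‖v‖ ^ 2 * s ^ 2) =
      fun s => fderiv ℝ f (s • v) v - c * ‖v‖ ^ 2 * s := funext fun s => (h1 s).deriv
  have hconv := convexOn_univ_of_deriv2_nonneg (fun s => (h1 s).differentiableAt)
    (by rw [hd1]; exact fun s => (h2 s).differentiableAt)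
    (fun s => by
      simp only [Function.iterate_succ, Function.iterate_zero, Function.comp_apply, id, hd1,
        (h2 s).deriv]
      linarith [hc (s • v) v])
  have := hconv.2 (Set.mem_univ 0) (Set.mem_univ 1)
    (show (0 : ℝ) ≤ 2⁻¹ by norm_num) (show (0 : ℝ) ≤ 2⁻¹ by norm_num) (by norm_num)
  simp at this
  linarith

/-- A Lagrangian that is uniformly strongly convex in `v` for `x` in a compact set and bounded
below grows at least quadratically in `v`, uniformly on that set. -/
lemma exists_quadratic_lower_bound {E : Type*} [NormedAddCommGroup E] [NormedSpace ℝ E]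
    {L : E → E → ℝ} (hL : ContDiff ℝ 2 (Function.uncurry L)) {B : ℝ} (hB : ∀ x v, -B ≤ L x v)
    {K : Set E} (hK : IsCompact K) {c : ℝ}
    (hc : ∀ x ∈ K, ∀ v w : E, c * ‖w‖ ^ 2 ≤ fderiv ℝ (fderiv ℝ (L x)) v w w) :
    ∃ D : ℝ, ∀ x ∈ K, ∀ v, c / 4 * ‖v‖ ^ 2 - D ≤ L x v := by
  have hcont : Continuous fun x => L x 0 :=
    hL.continuous.comp (continuous_id.prodMk continuous_const)
  obtain ⟨M, hM⟩ := hK.bddAbove_image hcont.continuousOn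
  refine ⟨2 * B + M, fun x hx v => ?_⟩
  have hLx : ContDiff ℝ 2 (L x) := hL.comp (contDiff_const.prodMk contDiff_id)
  have h1 := two_mul_midpoint_add_le hLx (hc x hx) v
  have h2 := hB x ((2 : ℝ)⁻¹ • v)
  have h3 : L x 0 ≤ M := hM (Set.mem_image_of_mem _ hx)
  linarith

lemma continuous_pev {a b : ℝ} {n : ℕ} (t : ℝ) :
    Continuous fun γ : CPath a b n => pev γ t := by
  by_cases ht : t ∈ Set.Icc a b
  · simpa [pev, ht] using
      ContinuousEvalConst.continuous_eval_const (F := CPath a b n) (⟨t, ht⟩ : Set.Icc a b)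
  · simpa [pev, ht] using continuous_const

lemma exists_of_action_le {n : ℕ} {L : Eu n → Eu n → ℝ} {a b : ℝ} {γ : CPath a b n} {R : ℝ}
    (h : action L a b γ ≤ (R : EReal)) :
    ∃ g : ℝ → Eu n, IntegrableOn g (Set.Icc a b) ∧
      (∀ s t : Set.Icc a b, γ t = γ s + ∫ u in (s : ℝ)..(t : ℝ), g u) ∧
      IntegrableOn (fun t => L (pev γ t) (g t)) (Set.Icc a b) ∧
      ∫ t in Set.Icc a b, L (pev γ t) (g t) ≤ R := by
  unfold action at h
  split_ifs at h with h1 h2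
  · exact ⟨h1.choose, h1.choose_spec.1, h1.choose_spec.2, h2, EReal.coe_le_coe_iff.1 h⟩
  · simp at h
  · simp at h

lemma neg_le_action {n : ℕ} {L : Eu n → Eu n → ℝ} {B : ℝ} (hB : ∀ x v, -B ≤ L x v) {a b : ℝ}
    (hab : a ≤ b) (γ : CPath a b n) : ((-(B * (b - a)) : ℝ) : EReal) ≤ action L a b γ := by
  unfold action
  split_ifs with h1 h2
  · rw [EReal.coe_le_coe_iff]
    have := setIntegral_mono_on (integrableOn_const (C := -B) (by simp)) h2 measurableSet_Icc
      (fun t _ => hB (pev γ t) (h1.choose t))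
    simp [hab] at this
    linarith
  · exact le_top
  · exact le_top

lemma norm_sub_le_setIntegral {a b : ℝ} {n : ℕ} {γ : CPath a b n} {g : ℝ → Eu n}
    (hγ : ∀ s t : Set.Icc a b, γ t = γ s + ∫ u in (s : ℝ)..(t : ℝ), g u)
    (s t : Set.Icc a b) : ‖γ t - γ s‖ ≤ ∫ u in Set.uIoc (s : ℝ) t, ‖g u‖ := by
  rw [hγ s t, add_sub_cancel_left]
  exact intervalIntegral.norm_integral_le_integral_norm_uIoc

lemma uIoc_coe_subset_Icc {a b : ℝ} (s t : Set.Icc a b) :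
    Set.uIoc (s : ℝ) t ⊆ Set.Icc a b :=
  Set.uIoc_subset_uIcc.trans (Set.uIcc_subset_Icc s.2 t.2)

/-- Curves of bounded action starting in a fixed compact set stay in a common compact set. -/
lemma exists_isCompact_of_action_le {n : ℕ} {a b : ℝ} (hab : a ≤ b) {L : Eu n → Eu n → ℝ}
    {c₁ c₂ : ℝ} (hc₁ : 0 < c₁) (hL : ∀ x v : Eu n, c₁ * ‖v‖ - c₂ ≤ L x v)
    {K : Set (Eu n)} (hK : IsCompact K) (R : ℝ) :
    ∃ Q : Set (Eu n), IsCompact Q ∧ ∀ γ : CPath a b n, pev γ a ∈ K →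
      action L a b γ ≤ (R : EReal) → ∀ t, γ t ∈ Q := by
  refine ⟨Metric.cthickening ((R + c₂ * (b - a)) / c₁) K, hK.cthickening, fun γ hγ hR t => ?_⟩
  obtain ⟨g, hg, hγg, hLi, hLR⟩ := exists_of_action_le hR
  let s : Set.Icc a b := ⟨a, Set.left_mem_Icc.2 hab⟩
  refine Metric.mem_cthickening_of_dist_le _ _ _ _ hγ ?_
  have hs : pev γ a = γ s := pev_coe γ s
  rw [dist_eq_norm, hs]
  refine (norm_sub_le_setIntegral hγg s t).trans ?_
  have h1 : ∫ u in Set.uIoc (s : ℝ) t, ‖g u‖ ≤ ∫ u in Set.Icc a b, ‖g u‖ :=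
    setIntegral_mono_set hg.norm (ae_of_all _ fun _ => norm_nonneg _)
      (uIoc_coe_subset_Icc s t).eventuallyLE
  have h2 : ∫ u in Set.Icc a b, (c₁ * ‖g u‖ - c₂) ≤ ∫ u in Set.Icc a b, L (pev γ u) (g u) :=
    setIntegral_mono_on ((hg.norm.const_mul c₁).sub (integrableOn_const (by simp))) hLi
      measurableSet_Icc fun u _ => hL _ _
  rw [integral_sub (hg.norm.const_mul c₁) (integrableOn_const (by simp)),
    integral_const_mul] at h2
  simp [hab] at h2
  rw [le_div_iff₀ hc₁]
  nlinarith

/-- Quadratic growth of the integrand along the curve gives a modulus of continuity depending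
only on the value of the action. -/
lemma norm_sub_le_of_quadratic {n : ℕ} {a b : ℝ} (hab : a ≤ b) {ℓ : ℝ → ℝ} {q D R : ℝ}
    (hq : 0 < q) {γ : CPath a b n} {g : ℝ → Eu n} (hg : IntegrableOn g (Set.Icc a b))
    (hγ : ∀ s t : Set.Icc a b, γ t = γ s + ∫ u in (s : ℝ)..(t : ℝ), g u)
    (hℓ : IntegrableOn ℓ (Set.Icc a b)) (hℓR : ∫ t in Set.Icc a b, ℓ t ≤ R)
    (hgℓ : ∀ t ∈ Set.Icc a b, q * ‖g t‖ ^ 2 - D ≤ ℓ t) {δ : ℝ} (hδ : 0 < δ)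
    (s t : Set.Icc a b) :
    ‖γ t - γ s‖ ≤ δ / q * (R + D * (b - a)) + dist s t / (4 * δ) := by
  refine (norm_sub_le_setIntegral hγ s t).trans ?_
  have hsub := uIoc_coe_subset_Icc s t
  have hi : IntegrableOn (fun u => δ / q * (ℓ u + D)) (Set.Icc a b) :=
    (hℓ.add (integrableOn_const (by simp))).const_mul _
  have hnn : ∀ u ∈ Set.Icc a b, ‖g u‖ ^ 2 ≤ (ℓ u + D) / q := fun u hu => by
    rw [le_div_iff₀ hq]
    linarith [hgℓ u hu]
  have hpt : ∀ u ∈ Set.uIoc (s : ℝ) t, ‖g u‖ ≤ δ / q * (ℓ u + D) + 1 / (4 * δ) := fun u hu => by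
    have h1 : ‖g u‖ ≤ δ * ‖g u‖ ^ 2 + 1 / (4 * δ) := by
      have : δ * ‖g u‖ ^ 2 + 1 / (4 * δ) - ‖g u‖ = (2 * δ * ‖g u‖ - 1) ^ 2 / (4 * δ) := by
        field_simp
        ring
      have : 0 ≤ (2 * δ * ‖g u‖ - 1) ^ 2 / (4 * δ) := by positivity
      linarith
    have h2 := mul_le_mul_of_nonneg_left (hnn u (hsub hu)) hδ.le
    have h3 : δ * ((ℓ u + D) / q) = δ / q * (ℓ u + D) := by ring
    linarith
  have hcst : IntegrableOn (fun _ : ℝ => 1 / (4 * δ)) (Set.uIoc (s : ℝ) t) :=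
    integrableOn_const (by simp [Set.uIoc])
  have h1 := setIntegral_mono_on (hg.mono_set hsub).norm ((hi.mono_set hsub).add hcst)
    measurableSet_uIoc hpt
  have h2 : ∫ u in Set.uIoc (s : ℝ) t, δ / q * (ℓ u + D) ≤
      ∫ u in Set.Icc a b, δ / q * (ℓ u + D) := by
    refine setIntegral_mono_set hi ?_ hsub.eventuallyLE
    filter_upwards [ae_restrict_mem measurableSet_Icc] with u hu
    have : 0 ≤ (ℓ u + D) / q := (sq_nonneg _).trans (hnn u hu)
    calc (0 : ℝ) ≤ δ * ((ℓ u + D) / q) := by positivity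
      _ = δ / q * (ℓ u + D) := by ring
  have h3 : ∫ u in Set.Icc a b, δ / q * (ℓ u + D) ≤ δ / q * (R + D * (b - a)) := by
    rw [integral_const_mul, integral_add hℓ (integrableOn_const (by simp))]
    refine mul_le_mul_of_nonneg_left ?_ (by positivity)
    simp [hab]
    linarith
  have h4 : ∫ _ in Set.uIoc (s : ℝ) t, 1 / (4 * δ) = dist s t / (4 * δ) := by
    rw [setIntegral_const, smul_eq_mul, measureReal_def, Set.uIoc, Real.volume_Ioc,
      max_sub_min_eq_abs', ENNReal.toReal_ofReal (abs_nonneg _), Subtype.dist_eq, Real.dist_eq]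
    ring
  rw [integral_add' (hi.mono_set hsub) hcst, h4] at h1
  linarith

/-- Action sublevels with initial point in a compact set are relatively compact. -/
lemma isCompact_closure_setOf_action_le {n : ℕ} {a b : ℝ} (hab : a ≤ b) {L : Eu n → Eu n → ℝ}
    (hL1 : ContDiff ℝ 2 (Function.uncurry L))
    (hL2 : ∀ K : Set (Eu n), IsCompact K → ∃ c₀ : ℝ, 0 < c₀ ∧
      ∀ x ∈ K, ∀ v w : Eu n, c₀ * ‖w‖ ^ 2 ≤ fderiv ℝ (fderiv ℝ (L x)) v w w)
    {c₁ c₂ : ℝ} (hc₁ : 0 < c₁) (hL3 : ∀ x v : Eu n, c₁ * ‖v‖ - c₂ ≤ L x v)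
    {K : Set (Eu n)} (hK : IsCompact K) (R : ℝ) :
    IsCompact (closure {γ : CPath a b n | pev γ a ∈ K ∧ action L a b γ ≤ (R : EReal)}) := by
  obtain ⟨Q, hQ, hmem⟩ := exists_isCompact_of_action_le hab hc₁ hL3 hK R
  obtain ⟨c₀, hc₀, hcv⟩ := hL2 Q hQ
  obtain ⟨D, hD⟩ := exists_quadratic_lower_bound hL1
    (fun x v => by nlinarith [hL3 x v, norm_nonneg v] : ∀ x v, -c₂ ≤ L x v) hQ hcv
  have hmod : ∀ γ : CPath a b n, pev γ a ∈ K → action L a b γ ≤ (R : EReal) →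
      ∀ δ > 0, ∀ s t, ‖γ t - γ s‖ ≤
        δ / (c₀ / 4) * (R + D * (b - a)) + dist s t / (4 * δ) := by
    intro γ hγ hR δ hδ s t
    have hγQ := hmem γ hγ hR
    obtain ⟨g, hg, hγg, hLi, hLR⟩ := exists_of_action_le hR
    exact norm_sub_le_of_quadratic hab (by positivity) hg hγg hLi hLR
      (fun u hu => hD _ (by rw [show pev γ u = γ ⟨u, hu⟩ from pev_coe γ ⟨u, hu⟩]; exact hγQ _) _)
      hδ s t
  set A := {γ : CPath a b n | pev γ a ∈ K ∧ action L a b γ ≤ (R : EReal)}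
  let e := (ContinuousMap.isometryEquivBoundedOfCompact (Set.Icc a b) (Eu n)).toHomeomorph
  rw [← e.isCompact_image, e.image_closure]
  refine BoundedContinuousFunction.arzela_ascoli Q hQ _ ?_ ?_
  · rintro _ t ⟨γ, hγ, rfl⟩
    exact hmem γ hγ.1 hγ.2 t
  · refine UniformEquicontinuous.equicontinuous (Metric.uniformEquicontinuous_iff.2 ?_)
    intro ε hε
    set M := |R + D * (b - a)| / (c₀ / 4) + 1
    have hM : 0 < M := by positivity
    set δ := ε / (2 * M)
    have hδ : 0 < δ := by positivity
    refine ⟨2 * δ * ε, by positivity, fun s t hst i => ?_⟩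
    obtain ⟨γ, hγ, hγi⟩ := i.2
    have hval (u : Set.Icc a b) : i.1 u = γ u := by rw [← hγi]; rfl
    rw [hval, hval, dist_comm, dist_eq_norm]
    refine (hmod γ hγ.1 hγ.2 δ hδ s t).trans_lt ?_
    have h1 : δ / (c₀ / 4) * (R + D * (b - a)) ≤ δ * M := by
      rw [div_mul_eq_mul_div, mul_div_assoc]
      refine mul_le_mul_of_nonneg_left ?_ hδ.le
      have : (R + D * (b - a)) / (c₀ / 4) ≤ |R + D * (b - a)| / (c₀ / 4) := by
        gcongr
        exact le_abs_self _
      exact this.trans (le_add_of_nonneg_right zero_le_one)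
    have h2 : δ * M = ε / 2 := by simp only [δ]; field_simp
    have h3 : dist s t / (4 * δ) < ε / 2 := by
      rw [div_lt_iff₀ (by positivity)]
      linarith
    linarith

lemma ofReal_le_epos_of_coe_lt {x : EReal} {R : ℝ} (h : (R : EReal) < x) :
    ENNReal.ofReal R ≤ epos x := by
  induction x with
  | bot => simp at h
  | top => simp [epos]
  | coe y => simpa [epos] using ENNReal.ofReal_le_ofReal (EReal.coe_lt_coe_iff.1 h).le

lemma epos_neg_le {x : EReal} {B : ℝ} (h : ((-B : ℝ) : EReal) ≤ x) :
    epos (-x) ≤ ENNReal.ofReal B := by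
  induction x with
  | bot => simp at h
  | top => simp [epos]
  | coe y =>
    have := EReal.coe_le_coe_iff.1 h
    simp only [epos, ← EReal.coe_neg, EReal.coe_ne_top, if_false, EReal.toReal_coe]
    exact ENNReal.ofReal_le_ofReal (by linarith)

lemma lintegral_epos_le_of_mint_le {X : Type*} [MeasurableSpace X] {F : X → EReal}
    {π : Measure X} [IsProbabilityMeasure π] {B C : ℝ} (hF : ∀ x, ((-B : ℝ) : EReal) ≤ F x)
    (h : mint F π ≤ (C : EReal)) :
    ∫⁻ x, epos (F x) ∂π ≤ ENNReal.ofReal C + ENNReal.ofReal B := by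
  have hneg : ∫⁻ x, epos (-(F x)) ∂π ≤ ENNReal.ofReal B := by
    simpa using lintegral_mono (μ := π) fun x => epos_neg_le (hF x)
  have hC : (C : EReal) ≤ (ENNReal.ofReal C : ℝ≥0∞) := by
    rw [EReal.coe_ennreal_ofReal]
    exact EReal.coe_le_coe_iff.2 (le_max_left _ _)
  have hfin : ((∫⁻ x, epos (-(F x)) ∂π : ℝ≥0∞) : EReal) ≠ ⊤ := by
    simpa using ne_top_of_le_ne_top ENNReal.ofReal_ne_top hneg
  rw [mint, EReal.sub_le_iff_le_add (.inr (by simp)) (.inr (by simp))] at h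
  rw [← EReal.coe_ennreal_le_coe_ennreal_iff, EReal.coe_ennreal_add]
  exact h.trans (add_le_add hC (EReal.coe_ennreal_le_coe_ennreal_iff.2 hneg))

/-- Markov's inequality for a possibly non-measurable integrand. -/
lemma mul_measure_compl_closure_le {X : Type*} [TopologicalSpace X] [MeasurableSpace X]
    [OpensMeasurableSpace X] {F : X → EReal} {π : Measure X} {p : X → Prop}
    (hp : ∀ᵐ x ∂π, p x) (R : ℝ) :
    ENNReal.ofReal R * π (closure {x | p x ∧ F x ≤ (R : EReal)})ᶜ ≤ ∫⁻ x, epos (F x) ∂π := by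
  rw [← lintegral_indicator_const isClosed_closure.measurableSet.compl]
  refine lintegral_mono_ae ?_
  filter_upwards [hp] with x hx
  refine Set.indicator_apply_le' (fun hxS => ofReal_le_epos_of_coe_lt ?_) fun _ => zero_le
  by_contra! hle
  exact hxS (subset_closure ⟨hx, hle⟩)

/-- Every sequence in a tight set of probability measures has a weakly convergent subsequence. -/
lemma exists_subseq_weakLim_of_isTight {X : Type*} [TopologicalSpace X]
    [TopologicalSpace.MetrizableSpace X] [TopologicalSpace.SeparableSpace X] [MeasurableSpace X]
    [BorelSpace X] {μ : ℕ → Measure X} (hμ : ∀ k, IsProbabilityMeasure (μ k))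
    (ht : IsTightMeasureSet (Set.range μ)) :
    ∃ ψ : ℕ → ℕ, StrictMono ψ ∧ ∃ π : Measure X,
      IsProbabilityMeasure π ∧ WeakLim (fun k => μ (ψ k)) π := by
  let ν : ℕ → ProbabilityMeasure X := fun k => ⟨μ k, hμ k⟩
  have hcpt : IsCompact (closure (Set.range ν)) := by
    refine isCompact_closure_of_isTightMeasureSet (ht.subset ?_)
    rintro _ ⟨_, ⟨k, rfl⟩, rfl⟩
    exact ⟨k, rfl⟩
  obtain ⟨π, -, ψ, hψ, hlim⟩ := hcpt.tendsto_subseq fun k => subset_closure ⟨k, rfl⟩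
  exact ⟨ψ, hψ, π, π.2, ProbabilityMeasure.tendsto_iff_forall_integral_tendsto.1 hlim⟩

/-- **Compactness (Theorem 3.2).**
If a sequence of probability measures on `C([a,b];ℝⁿ)` has all its initial-time marginals
supported in one compact set and uniformly bounded actions, then it is relatively compact
with respect to weak convergence: every subsequence admits a further subsequence that
converges weakly to a probability measure. -/
theorem compactness_of_bounded_action_sequences
    {n : ℕ} (hn : 1 ≤ n) {a b : ℝ} (hab : a < b)
    (L : Eu n → Eu n → ℝ)
    (hL1 : ContDiff ℝ (⊤ : ℕ∞) (Function.uncurry L))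
    (hL2 : ∀ K : Set (Eu n), IsCompact K → ∃ c₀ : ℝ, 0 < c₀ ∧
      ∀ x ∈ K, ∀ v w : Eu n, c₀ * ‖w‖ ^ 2 ≤ fderiv ℝ (fderiv ℝ (L x)) v w w)
    (c₁ c₂ : ℝ) (hc₁ : 0 < c₁) (hc₂ : 0 < c₂)
    (hL3 : ∀ x v : Eu n, c₁ * ‖v‖ - c₂ ≤ L x v)
    (πs : ℕ → Measure (CPath a b n)) (hprob : ∀ N, IsProbabilityMeasure (πs N))
    (K : Set (Eu n)) (hK : IsCompact K)
    (hKsupp : ∀ N, Measure.map (fun γ => pev γ a) (πs N) K = 1)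
    (C : ℝ) (hC : ∀ N, mint (action L a b) (πs N) ≤ (C : EReal)) :
    ∀ φ : ℕ → ℕ, StrictMono φ →
      ∃ ψ : ℕ → ℕ, StrictMono ψ ∧ ∃ π : Measure (CPath a b n),
        IsProbabilityMeasure π ∧ WeakLim (fun k => πs (φ (ψ k))) π := by
  intro φ _
  refine exists_subseq_weakLim_of_isTight (fun k => hprob (φ k)) ?_
  have hLB : ∀ x v, -c₂ ≤ L x v := fun x v => by nlinarith [hL3 x v, norm_nonneg v]
  set M := ENNReal.ofReal C + ENNReal.ofReal (c₂ * (b - a))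
  have hMtop : M ≠ ⊤ := by simp [M]
  rw [isTightMeasureSet_iff_exists_isCompact_measure_compl_le]
  intro ε hε
  obtain ⟨R, hR⟩ : ∃ R : ℝ, 0 < R ∧ M / ENNReal.ofReal R ≤ ε := by
    rcases eq_or_ne ε ⊤ with rfl | hεtop
    · exact ⟨1, one_pos, le_top⟩
    · refine ⟨(M / ε).toReal + 1, by positivity, ?_⟩
      refine ENNReal.div_le_of_le_mul' ?_
      rw [← ENNReal.div_le_iff_le_mul (.inl hε.ne') (.inl hεtop)]
      calc M / ε = ENNReal.ofReal (M / ε).toReal :=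
            (ENNReal.ofReal_toReal (ENNReal.div_ne_top hMtop hε.ne')).symm
        _ ≤ _ := ENNReal.ofReal_le_ofReal (le_add_of_nonneg_right zero_le_one)
  refine ⟨_, isCompact_closure_setOf_action_le hab.le (hL1.of_le (by norm_cast))
    hL2 hc₁ hL3 hK R, ?_⟩
  rintro _ ⟨k, rfl⟩
  have := hprob (φ k)
  have hpev := (continuous_pev (a := a) (b := b) (n := n) a).measurable
  have hstart : ∀ᵐ γ ∂(πs (φ k)), pev γ a ∈ K := by
    have h1 := hKsupp (φ k)
    rw [Measure.map_apply hpev hK.measurableSet] at h1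
    exact (mem_ae_iff_prob_eq_one (hpev hK.measurableSet)).2 h1
  refine le_trans ?_ hR.2
  rw [ENNReal.le_div_iff_mul_le (.inl (by simpa using hR.1)) (.inl ENNReal.ofReal_ne_top),
    mul_comm]
  exact (mul_measure_compl_closure_le hstart R).trans
    (lintegral_epos_le_of_mint_le (neg_le_action hLB hab.le) (hC (φ k)))
end
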